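/- arXiv:2412.18336 — 2 statements merged into one kernel-verified Lean document; each statement's English description precedes it below -/
import Mathlib

section
/- Let k ≥ 2 and let Q ≥ 10^{1000k}. There exists n₀ ∈ ℕ such that for every n ≥ n₀ the following holds: if G is an n-vertex oriented graph with minimum semi-degree δ⁰(G) ≥ (1/2 − 1/(20Q)³)n, then V(G) can be partitioned into sets S of size Q or Q+1 such that for each such S, the induced subgraph G[S] is a tournament with δ⁰(G[S]) ≥ 2|S|/5 that contains the kth power of a Hamilton cycle. In particular, V(G) can be partitioned into at most n/Q vertex-disjoint k-cycles. -/
namespace Paper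

/-- `G` is a digraph: a loopless directed graph (edges in both directions allowed). -/
def IsDigraph {n : ℕ} (G : Fin n → Fin n → Prop) : Prop := ∀ v, ¬ G v v

/-- `G` is an oriented graph: no loops and at most one directed edge per pair. -/
def IsOriented {n : ℕ} (G : Fin n → Fin n → Prop) : Prop := ∀ u v, G u v → ¬ G v u

/-- Out-degree of `v` in `G`. -/
noncomputable def outDeg {n : ℕ} (G : Fin n → Fin n → Prop) (v : Fin n) : ℕ :=
  {w | G v w}.ncard

/-- In-degree of `v` in `G`. -/
noncomputable def inDeg {n : ℕ} (G : Fin n → Fin n → Prop) (v : Fin n) : ℕ :=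
  {w | G w v}.ncard

/-- `G` contains the `k`-th power of a Hamilton cycle: a cyclic ordering `f` of all the
vertices such that each vertex sends an edge to the next `k` vertices (indices mod `n`). -/
def HasPowHamCycle {n : ℕ} (k : ℕ) (G : Fin n → Fin n → Prop) : Prop :=
  ∃ f : Fin n ≃ Fin n, ∀ (i : Fin n) (j : ℕ), 1 ≤ j → j ≤ k →
    G (f i) (f ⟨((i : ℕ) + j) % n, Nat.mod_lt _ (Nat.lt_of_le_of_lt (Nat.zero_le _) i.isLt)⟩)

/-- `P` is a `k`-path in `G` (the `k`-th power of a directed path): a list of distinct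
vertices in which every vertex sends an edge to each of the next `k` vertices. -/
def IsKPath {n : ℕ} (k : ℕ) (G : Fin n → Fin n → Prop) (P : List (Fin n)) : Prop :=
  P.Nodup ∧ ∀ i j : Fin P.length, (i : ℕ) < (j : ℕ) → (j : ℕ) ≤ (i : ℕ) + k →
    G (P.get i) (P.get j)

/-- The induced subgraph of `G` on the finite vertex set `S` contains the `k`-th power of a
Hamilton cycle: there is a cyclic ordering of the vertices of `S` in which every vertex
sends an edge to each of the next `k` vertices. -/
def HasPowHamCycleOn {n : ℕ} (k : ℕ) (G : Fin n → Fin n → Prop) (S : Finset (Fin n)) :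
    Prop :=
  ∃ f : Fin S.card → Fin n, Function.Injective f ∧ (∀ i, f i ∈ S) ∧
    ∀ (i : Fin S.card) (j : ℕ), 1 ≤ j → j ≤ k →
      G (f i) (f ⟨((i : ℕ) + j) % S.card,
        Nat.mod_lt _ (Nat.lt_of_le_of_lt (Nat.zero_le _) i.isLt)⟩)

section PowPath

variable {V : Type*} {k : ℕ} {G : V → V → Prop}

/-- The list `L` is a `k`-th power of a path: every entry sends an edge to each of the next `k`
entries. -/
def PowPath (k : ℕ) (G : V → V → Prop) : List V → Prop
  | [] => True
  | x :: L => (∀ y ∈ L.take k, G x y) ∧ PowPath k G L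

theorem powPath_of_pairwise {L : List V} (h : L.Pairwise G) : PowPath k G L := by
  induction h with
  | nil => trivial
  | cons h _ ih => exact ⟨fun y hy => h y (List.mem_of_mem_take hy), ih⟩

/-- Two powers of paths that overlap in at least `k` vertices can be glued together. -/
theorem PowPath.glue {P X Y : List V} (h₁ : PowPath k G (P ++ X)) (h₂ : PowPath k G (X ++ Y))
    (hX : k ≤ X.length) : PowPath k G (P ++ X ++ Y) := by
  induction P with
  | nil => simpa using h₂
  | cons x P ih =>
    refine ⟨fun y hy => h₁.1 y ?_, ih h₁.2⟩
    change y ∈ (P ++ X ++ Y).take k at hy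
    change y ∈ (P ++ X).take k
    rwa [List.take_append_of_le_length (by simp; omega)] at hy

theorem PowPath.getElem {L : List V} (h : PowPath k G L) {i j : ℕ} (hij : i < j) (hjk : j ≤ i + k)
    (hj : j < L.length) : G L[i] L[j] := by
  induction L generalizing i j with
  | nil => simp at hj
  | cons x L ih =>
    obtain ⟨j, rfl⟩ : ∃ j', j = j' + 1 := ⟨j - 1, by omega⟩
    rcases i with _ | i
    · refine h.1 _ ?_
      simp only [List.getElem_cons_succ]
      simp only [List.length_cons] at hj
      rw [List.mem_take_iff_getElem]
      exact ⟨j, by omega, rfl⟩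
    · simpa using ih h.2 (i := i) (j := j) (by omega) (by omega) (by simpa using hj)

/-- A power of a path that returns to its own beginning is a power of a cycle. -/
theorem PowPath.cyclic {C : List V} (h : PowPath k G (C ++ C.take k)) (hk : k ≤ C.length)
    {i j : ℕ} (hi : i < C.length) (hj : 1 ≤ j) (hjk : j ≤ k) :
    G C[i] (C[(i + j) % C.length]'(Nat.mod_lt _ (by omega))) := by
  have hl : i + j < (C ++ C.take k).length := by simp; omega
  have := h.getElem (i := i) (j := i + j) (by omega) (by omega) hl
  rw [List.getElem_append_left hi] at this
  by_cases hc : i + j < C.length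
  · rw [List.getElem_append_left hc] at this
    simpa [Nat.mod_eq_of_lt hc] using this
  · rw [List.getElem_append_right (by omega), List.getElem_take] at this
    have e : (i + j) % C.length = i + j - C.length := by
      rw [Nat.mod_eq_sub_mod (by omega), Nat.mod_eq_of_lt (by omega)]
    simpa [e] using this

end PowPath

section Pigeonhole

variable {V : Type*}

/-- The common neighbourhood in `Y`, with respect to `r`, of the entries of the list `X`. -/
def commonNbr (r : V → V → Prop) [DecidableRel r] (X : List V) (Y : Finset V) : Finset V :=
  {y ∈ Y | ∀ x ∈ X, r x y}

theorem mem_commonNbr {r : V → V → Prop} [DecidableRel r] {X : List V} {Y : Finset V} {y : V} :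
    y ∈ commonNbr r X Y ↔ y ∈ Y ∧ ∀ x ∈ X, r x y := by
  simp [commonNbr]

theorem commonNbr_mono {r : V → V → Prop} [DecidableRel r] {X X' : List V} (h : X' ⊆ X)
    (Y : Finset V) : commonNbr r X Y ⊆ commonNbr r X' Y := by
  intro y
  simp only [mem_commonNbr]
  exact fun hy => ⟨hy.1, fun x hx => hy.2 x (h hx)⟩

/-- If every `y ∈ Y` has at least `k` neighbours in the list `X`, then some `k` of the entries of
`X` have many common neighbours in `Y`. -/
theorem exists_sublist_commonNbr (r : V → V → Prop) [DecidableRel r] (X : List V) (k : ℕ)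
    (Y : Finset V) (h : ∀ y ∈ Y, k ≤ X.countP (fun x => r x y)) (hk : Y = ∅ → k ≤ X.length) :
    ∃ X', X'.Sublist X ∧ X'.length = k ∧ Y.card ≤ 2 ^ X.length * (commonNbr r X' Y).card := by
  induction X generalizing k Y with
  | nil =>
    have hk0 : k = 0 := by
      rcases Y.eq_empty_or_nonempty with h' | ⟨y, hy⟩
      · simpa using hk h'
      · simpa using h y hy
    subst hk0
    exact ⟨[], by simp [commonNbr]⟩
  | cons x X ih =>
    rcases k with _ | k
    · refine ⟨[], by simp, rfl, ?_⟩
      simp only [commonNbr, List.not_mem_nil, false_imp_iff, implies_true, Finset.filter_true]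
      exact Nat.le_mul_of_pos_left _ (by positivity)
    have hsplit := Finset.card_filter_add_card_filter_not (s := Y) (r x)
    by_cases hc : Y.card ≤ 2 * (Y.filter (r x)).card
    · obtain ⟨X', h1, h2, h3⟩ := ih k (Y.filter (r x)) (fun y hy => by
        have := h y (Finset.mem_of_mem_filter y hy)
        rw [List.countP_cons] at this
        split_ifs at this <;> omega) (fun he => by
          rcases Y.eq_empty_or_nonempty with h' | ⟨y, hy⟩
          · simpa using hk h'
          · rw [he] at hc
            simp only [Finset.card_empty, mul_zero, nonpos_iff_eq_zero, Finset.card_eq_zero] at hc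
            simpa using hk hc)
      refine ⟨x :: X', h1.cons_cons x, by simp [h2], ?_⟩
      have e : commonNbr r (x :: X') Y = commonNbr r X' (Y.filter (r x)) := by
        ext y
        simp [mem_commonNbr, and_assoc]
      rw [e, List.length_cons, pow_succ]
      nlinarith
    · have hc' : Y.card ≤ 2 * (Y.filter (fun y => ¬ r x y)).card := by omega
      obtain ⟨X', h1, h2, h3⟩ := ih (k + 1) (Y.filter (fun y => ¬ r x y)) (fun y hy => by
        have := h y (Finset.mem_of_mem_filter y hy)
        rw [List.countP_cons] at this
        simpa [(Finset.mem_filter.1 hy).2] using this) (fun he => by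
          rw [he] at hc'
          simp only [Finset.card_empty, mul_zero, nonpos_iff_eq_zero, Finset.card_eq_zero] at hc'
          subst hc'
          simp at hc)
      refine ⟨X', h1.cons x, h2, ?_⟩
      have e : (commonNbr r X' (Y.filter (fun y => ¬ r x y))).card ≤ (commonNbr r X' Y).card :=
        Finset.card_le_card (Finset.filter_subset_filter _ (Finset.filter_subset _ _))
      rw [List.length_cons, pow_succ]
      nlinarith [Nat.mul_le_mul_left (2 ^ X.length) e]

theorem sum_map_card_filter (r : V → V → Prop) [DecidableRel r] (X : List V) (Y : Finset V) :
    (X.map fun x => (Y.filter (r x)).card).sum = ∑ y ∈ Y, X.countP (fun x => r x y) := by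
  induction X with
  | nil => simp
  | cons x X ih =>
    rw [List.map_cons, List.sum_cons, ih, Finset.card_filter, add_comm]
    simp only [List.countP_cons, Finset.sum_add_distrib, decide_eq_true_eq]

/-- Markov-type bound: if all entries of `X` have degree at least `d` into `Y`, then many vertices
of `Y` have at least `k` neighbours in `X`. -/
theorem length_mul_le_card_popular (r : V → V → Prop) [DecidableRel r] (X : List V) (k d : ℕ)
    (Y : Finset V) (h : ∀ x ∈ X, d ≤ (Y.filter (r x)).card) :
    X.length * d ≤
      (Y.filter fun y => k ≤ X.countP (fun x => r x y)).card * X.length + k * Y.card := by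
  have h1 : X.length * d ≤ ∑ y ∈ Y, X.countP (fun x => r x y) := by
    rw [← sum_map_card_filter]
    have := List.card_nsmul_le_sum (X.map fun x => (Y.filter (r x)).card) d (by simpa using h)
    simpa using this
  refine h1.trans ?_
  rw [← Finset.sum_filter_add_sum_filter_not Y (fun y => k ≤ X.countP (fun x => r x y))]
  refine add_le_add ?_ ?_
  · exact Finset.sum_le_card_nsmul _ _ _ fun y _ => List.countP_le_length
  · refine (Finset.sum_le_card_nsmul _ _ k fun y hy => ?_).trans ?_
    · have := (Finset.mem_filter.1 hy).2
      omega
    · rw [smul_eq_mul, mul_comm]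
      exact Nat.mul_le_mul_left _ (Finset.card_le_card (Finset.filter_subset _ _))

/-- If every entry of `X` is adjacent to a `1 / q` proportion of `Y` and `X` has `2 * q * k`
entries, then some `k` entries of `X` have many common neighbours in `Y`. -/
theorem exists_sublist_rich (r : V → V → Prop) [DecidableRel r] (X : List V) (k q : ℕ)
    (hk : 0 < k) (hq : 0 < q)
    (Y : Finset V) (hX : X.length = 2 * q * k)
    (h : ∀ x ∈ X, Y.card ≤ q * (Y.filter (r x)).card) :
    ∃ X', X'.Sublist X ∧ X'.length = k ∧
      Y.card ≤ 2 * q * 2 ^ (2 * q * k) * (commonNbr r X' Y).card := by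
  set Y₁ := Y.filter fun y => k ≤ X.countP (fun x => r x y) with hY₁
  have h1 : Y.card ≤ 2 * q * Y₁.card := by
    have h2 : ∀ x ∈ X, (Y.card + q - 1) / q ≤ (Y.filter (r x)).card := fun x hx => by
      have := h x hx
      rw [Nat.div_le_iff_le_mul_add_pred hq]
      omega
    have h3 := length_mul_le_card_popular r X k _ Y h2
    rw [hX, ← hY₁] at h3
    have h4 : Y.card ≤ q * ((Y.card + q - 1) / q) := by
      have := Nat.div_add_mod (Y.card + q - 1) q
      have := Nat.mod_lt (Y.card + q - 1) hq
      omega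
    have h5 : 2 * Y.card ≤ 2 * q * Y₁.card + Y.card := by
      refine le_of_mul_le_mul_left (a := k) ?_ hk
      nlinarith [Nat.mul_le_mul_left (2 * k) h4]
    omega
  obtain ⟨X', h1', h2, h3⟩ := exists_sublist_commonNbr r X k Y₁
    (fun y hy => (Finset.mem_filter.1 hy).2) (fun _ => by rw [hX]; nlinarith)
  refine ⟨X', h1', h2, h1.trans ?_⟩
  have e : (commonNbr r X' Y₁).card ≤ (commonNbr r X' Y).card :=
    Finset.card_le_card (Finset.filter_subset_filter _ (Finset.filter_subset _ _))
  rw [hX] at h3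
  calc 2 * q * Y₁.card ≤ 2 * q * (2 ^ (2 * q * k) * (commonNbr r X' Y).card) :=
        Nat.mul_le_mul_left _ (h3.trans (Nat.mul_le_mul_left _ e))
    _ = _ := by ring

end Pigeonhole

section Tournament

variable {V : Type*} [DecidableEq V] {G : V → V → Prop} [DecidableRel G]

/-- `G` is a tournament on the whole vertex type. -/
structure IsTourn (G : V → V → Prop) : Prop where
  asymm : ∀ x y, G x y → ¬ G y x
  total : ∀ x y, x ≠ y → G x y ∨ G y x

theorem IsTourn.irrefl {V : Type*} {G : V → V → Prop} (hG : IsTourn G) (x : V) :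
    ¬ G x x := fun h => hG.asymm x x h h

theorem IsTourn.nodup {V : Type*} {G : V → V → Prop} (hG : IsTourn G) {L : List V}
    (h : L.Pairwise G) : L.Nodup :=
  h.imp fun {a b} hab => by rintro rfl; exact hG.irrefl _ hab

/-- A tournament on at least `2 ^ s` vertices contains a transitive tournament on `s` vertices. -/
theorem IsTourn.exists_transitive (hG : IsTourn G) (s : ℕ) (Y : Finset V) (hY : 2 ^ s ≤ Y.card) :
    ∃ X : List V, X.length = s ∧ X.Pairwise G ∧ ∀ x ∈ X, x ∈ Y := by
  induction s generalizing Y with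
  | zero => exact ⟨[], by simp⟩
  | succ s ih =>
    obtain ⟨y, hy⟩ : Y.Nonempty := Finset.card_pos.1 (lt_of_lt_of_le (by positivity) hY)
    have h1 := Finset.card_erase_add_one hy
    have h2 := Finset.card_filter_add_card_filter_not (s := Y.erase y) (G y)
    rw [pow_succ] at hY
    by_cases hc : 2 ^ s ≤ ((Y.erase y).filter (G y)).card
    · obtain ⟨X, hl, hp, hm⟩ := ih _ hc
      refine ⟨y :: X, by simp [hl], List.pairwise_cons.2
        ⟨fun x hx => (Finset.mem_filter.1 (hm x hx)).2, hp⟩, fun x hx => ?_⟩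
      rcases List.mem_cons.1 hx with rfl | hx
      · exact hy
      · exact Finset.mem_of_mem_erase (Finset.mem_filter.1 (hm x hx)).1
    · obtain ⟨X, hl, hp, hm⟩ := ih ((Y.erase y).filter (fun x => ¬ G y x)) (by omega)
      refine ⟨X ++ [y], by simp [hl], List.pairwise_append.2 ⟨hp, by simp, fun x hx z hz => ?_⟩,
        fun x hx => ?_⟩
      · obtain rfl : z = y := by simpa using hz
        have := Finset.mem_filter.1 (hm x hx)
        exact (hG.total x z (Finset.ne_of_mem_erase this.1)).resolve_right this.2
      · rcases List.mem_append.1 hx with hx | hx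
        · exact Finset.mem_of_mem_erase (Finset.mem_filter.1 (hm x hx)).1
        · obtain rfl : x = y := by simpa using hx
          exact hy

theorem IsTourn.two_mul_sum_out (hG : IsTourn G) (O : Finset V) :
    2 * ∑ x ∈ O, (O.filter (G x)).card + O.card = O.card * O.card := by
  have h1 : ∑ x ∈ O, (O.filter (G x)).card = ∑ x ∈ O, (O.filter (fun y => G y x)).card :=
    Finset.sum_card_bipartiteAbove_eq_sum_card_bipartiteBelow (s := O) (t := O) G
  have h2 : ∀ x ∈ O, (O.filter (G x)).card + (O.filter (fun y => G y x)).card + 1 = O.card := by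
    intro x hx
    rw [← Finset.card_union_of_disjoint, ← Finset.card_erase_add_one hx]
    · congr 2
      ext y
      simp only [Finset.mem_union, Finset.mem_filter, Finset.mem_erase]
      constructor
      · rintro (⟨h, h'⟩ | ⟨h, h'⟩) <;> refine ⟨?_, h⟩ <;> rintro rfl <;> exact hG.irrefl _ h'
      · rintro ⟨h, h'⟩
        exact (hG.total x y (Ne.symm h)).imp (⟨h', ·⟩) (⟨h', ·⟩)
    · rw [Finset.disjoint_filter]
      exact fun y _ h => hG.asymm _ _ h
  have h3 := Finset.sum_congr rfl h2
  simp only [Finset.sum_add_distrib, Finset.sum_const, smul_eq_mul, mul_one] at h3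
  omega

/-- Every vertex sends edges to, and receives edges from, at least 45% of the vertices of `H`. -/
def Balanced (G : V → V → Prop) [DecidableRel G] (H : Finset V) : Prop :=
  ∀ x, 45 * H.card ≤ 100 * (H.filter (G x)).card ∧
    45 * H.card ≤ 100 * (H.filter (fun y => G y x)).card

/-- In a balanced set, many vertices of any large subset `Y₁` send many edges to any large
subset `Y₂`. -/
theorem IsTourn.exists_dense (hG : IsTourn G) {H : Finset V} (hH : Balanced G H)
    (hh : 1000 ≤ H.card) {Y₁ Y₂ : Finset V} (hY₁ : Y₁ ⊆ H) (hY₂ : Y₂ ⊆ H)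
    (h₁ : 43 * H.card ≤ 100 * Y₁.card) (h₂ : 43 * H.card ≤ 100 * Y₂.card) :
    H.card ≤ 50 * (Y₁.filter fun y => H.card ≤ 50 * (Y₂.filter (G y)).card).card := by
  by_contra hc
  set Yb := Y₁.filter fun y => ¬ H.card ≤ 50 * (Y₂.filter (G y)).card with hYb
  have hsplit := Finset.card_filter_add_card_filter_not (s := Y₁)
    (fun y => H.card ≤ 50 * (Y₂.filter (G y)).card)
  rw [← hYb] at hsplit
  have hYbH : Yb ⊆ H := (Finset.filter_subset _ _).trans hY₁
  have hsmall : ∀ y ∈ Yb, 50 * (Y₂.filter (G y)).card ≤ H.card := fun y hy => by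
    have := (Finset.mem_filter.1 hy).2
    omega
  have hO := hG.two_mul_sum_out (Yb ∩ Y₂)
  have hO' : 50 * ∑ x ∈ Yb ∩ Y₂, ((Yb ∩ Y₂).filter (G x)).card ≤ (Yb ∩ Y₂).card * H.card := by
    rw [Finset.mul_sum]
    refine Finset.sum_le_card_nsmul _ _ _ fun x hx => ?_
    refine le_trans ?_ (hsmall x (Finset.mem_of_mem_inter_left hx))
    exact Nat.mul_le_mul_left _ (Finset.card_le_card
      (Finset.filter_subset_filter _ Finset.inter_subset_right))
  have hcO : 25 * (Yb ∩ Y₂).card ≤ H.card + 25 := by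
    rcases Nat.eq_zero_or_pos (Yb ∩ Y₂).card with h0 | h0
    · omega
    · refine le_of_mul_le_mul_left (a := (Yb ∩ Y₂).card) ?_ h0
      nlinarith
  have hB := hG.two_mul_sum_out Yb
  have hunion := Finset.card_union_add_card_inter Yb Y₂
  have hrest := Finset.card_sdiff_add_card_eq_card (Finset.union_subset hYbH hY₂)
  have hdeg : ∀ x ∈ Yb, (H.filter (G x)).card ≤ (Yb.filter (G x)).card + (Y₂.filter (G x)).card +
      (H \ (Yb ∪ Y₂)).card := fun x _ => by
    have hsub : H.filter (G x) ⊆ Yb.filter (G x) ∪ Y₂.filter (G x) ∪ (H \ (Yb ∪ Y₂)) := by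
      intro y
      simp only [Finset.mem_union, Finset.mem_filter, Finset.mem_sdiff]
      tauto
    exact (Finset.card_le_card hsub).trans ((Finset.card_union_le _ _).trans
      (Nat.add_le_add_right (Finset.card_union_le _ _) _))
  have hsum : Yb.card * (45 * H.card) ≤ 100 * ∑ x ∈ Yb, (Yb.filter (G x)).card +
      100 * ∑ x ∈ Yb, (Y₂.filter (G x)).card + 100 * (Yb.card * (H \ (Yb ∪ Y₂)).card) := by
    rw [← smul_eq_mul, ← Finset.sum_const, ← smul_eq_mul (Yb.card), ← Finset.sum_const,
      ← Nat.mul_add, ← Nat.mul_add, ← Finset.sum_add_distrib, ← Finset.sum_add_distrib,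
      Finset.mul_sum]
    exact Finset.sum_le_sum fun x hx => (hH x).1.trans (Nat.mul_le_mul_left _ (hdeg x hx))
  have hY2sum : 50 * ∑ x ∈ Yb, (Y₂.filter (G x)).card ≤ Yb.card * H.card := by
    rw [Finset.mul_sum]
    exact Finset.sum_le_card_nsmul _ _ _ hsmall
  have hbpos : 0 < Yb.card := by omega
  have key : 45 * H.card + 50 ≤ 50 * Yb.card + 2 * H.card + 100 * (H \ (Yb ∪ Y₂)).card := by
    refine le_of_mul_le_mul_left (a := Yb.card) ?_ hbpos
    nlinarith
  omega

end Tournament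

section Connecting

variable {V : Type*} [DecidableEq V] {G : V → V → Prop} [DecidableRel G] {k D : ℕ}

/-- The entries of `B` have many common out-neighbours in `H`. -/
def RichOut (D : ℕ) (G : V → V → Prop) [DecidableRel G] (H : Finset V) (B : List V) : Prop :=
  H.card ≤ D * (commonNbr G B H).card

/-- The entries of `A` have many common in-neighbours in `H`. -/
def RichIn (D : ℕ) (G : V → V → Prop) [DecidableRel G] (H : Finset V) (A : List V) : Prop :=
  H.card ≤ D * (commonNbr (fun x y => G y x) A H).card

theorem le_of_pow_hundred_le (hD : 10 ^ 6 * k * 2 ^ (100 * k) ≤ D) : 10 ^ 6 * k ≤ D :=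
  (Nat.le_mul_of_pos_right _ (by positivity)).trans hD

/-- The entries of a list of length `100 * k` have a combined neighbourhood of nearly the full
size, even when each neighbour is required to see `k` entries. -/
theorem card_popular {V : Type*} (r : V → V → Prop) [DecidableRel r] {H : Finset V}
    (hk : 0 < k)
    (hr : ∀ x, 45 * H.card ≤ 100 * (H.filter (r x)).card) {X : List V} (hX : X.length = 100 * k) :
    44 * H.card ≤ 100 * (H.filter fun y => k ≤ X.countP (fun x => r x y)).card := by
  have h := length_mul_le_card_popular r X k ((45 * H.card + 99) / 100) H
    (fun x _ => by have := hr x; omega)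
  rw [hX] at h
  have h2 : 100 * ((45 * H.card + 99) / 100) ≤
      100 * (H.filter fun y => k ≤ X.countP (fun x => r x y)).card + H.card := by
    refine le_of_mul_le_mul_left (a := k) ?_ hk
    nlinarith
  omega

theorem card_lower_of_rich {D h z u : ℕ} (hD : 4 ≤ D) (hz : h ≤ D * z) (hu : u * D ^ 2 ≤ h)
    (hh : D ^ 4 ≤ h) : 4 * u ≤ z ∧ D ^ 3 ≤ z := by
  constructor
  · have : D * (u * D) ≤ D * z := by nlinarith
    have := le_of_mul_le_mul_left this (by omega)
    nlinarith
  · have : D * D ^ 3 ≤ D * z := by nlinarith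
    exact le_of_mul_le_mul_left this (by omega)

/-- Two transitive lists whose neighbourhoods cover large sets `Y₁` and `Y₂` can be bridged by two
transitive lists inside these sets. -/
theorem IsTourn.exists_bridge (hG : IsTourn G) (hk : 0 < k) {H Y₁ Y₂ : Finset V}
    (hH : Balanced G H) (hh : 10 ^ 6 * (2 ^ (100 * k)) ^ 3 ≤ H.card) (hY₁H : Y₁ ⊆ H) (hY₂H : Y₂ ⊆ H)
    (h₁ : 43 * H.card ≤ 100 * Y₁.card) (h₂ : 43 * H.card ≤ 100 * Y₂.card) {X₀ X₁ : List V}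
    (hX₀ : X₀.length = 100 * k) (hX₁ : X₁.length = 100 * k)
    (hY₁ : ∀ y ∈ Y₁, k ≤ X₀.countP (fun x => G x y))
    (hY₂ : ∀ y ∈ Y₂, k ≤ X₁.countP (fun x => G y x)) :
    ∃ X C C' X' : List V, X.Sublist X₀ ∧ X'.Sublist X₁ ∧ X.length = k ∧ C.length = k ∧
      C'.length = k ∧ X'.length = k ∧ C.Pairwise G ∧ C'.Pairwise G ∧
      (∀ c ∈ C, c ∈ Y₁ ∧ ∀ x ∈ X, G x c) ∧
      (∀ c ∈ C', c ∈ Y₂ ∧ (∀ x ∈ C, G x c) ∧ ∀ x ∈ X', G c x) := by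
  obtain ⟨T, hT⟩ : ∃ T, T = 2 ^ (100 * k) := ⟨_, rfl⟩
  have hT1 : 0 < T := hT ▸ Nat.two_pow_pos _
  rw [← hT] at hh
  have hT3 : 0 < T ^ 3 := by positivity
  have hT23 : T * T ≤ T ^ 3 := by
    rw [← pow_two]
    exact Nat.pow_le_pow_right hT1 (by norm_num)
  have hd := hG.exists_dense hH (by omega) hY₁H hY₂H h₁ h₂
  obtain ⟨Ys, hYs⟩ : ∃ Y, Y = Y₁.filter fun y => H.card ≤ 50 * (Y₂.filter (G y)).card := ⟨_, rfl⟩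
  rw [← hYs] at hd
  rw [Finset.ext_iff] at hYs
  simp only [Finset.mem_filter] at hYs
  obtain ⟨X, hXs, hXl, hXc⟩ := exists_sublist_commonNbr G X₀ k Ys
    (fun y hy => hY₁ y ((hYs _).1 hy).1) (fun _ => by omega)
  rw [hX₀, ← hT] at hXc
  obtain ⟨C₀, hC₀l, hC₀p, hC₀m⟩ := hG.exists_transitive (100 * k) (commonNbr G X Ys) (by
    rw [← hT]
    by_contra hlt
    have : T * (commonNbr G X Ys).card ≤ T * T := Nat.mul_le_mul_left _ (by omega)
    omega)
  simp only [mem_commonNbr] at hC₀m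
  obtain ⟨C, hCs, hCl, hCc⟩ := exists_sublist_rich G C₀ k 50 hk (by norm_num) Y₂ hC₀l
    (fun x hx => (Finset.card_le_card hY₂H).trans ((hYs _).1 (hC₀m x hx).1).2)
  rw [show 2 * 50 * k = 100 * k by ring, ← hT] at hCc
  obtain ⟨X', hX's, hX'l, hX'c⟩ := exists_sublist_commonNbr (fun x y => G y x) X₁ k
    (commonNbr G C Y₂) (fun y hy => hY₂ y (mem_commonNbr.1 hy).1) (fun _ => by omega)
  rw [hX₁, ← hT] at hX'c
  obtain ⟨C', hC'l, hC'p, hC'm⟩ := hG.exists_transitive k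
    (commonNbr (fun x y => G y x) X' (commonNbr G C Y₂)) (by
    have hkT : 2 ^ k ≤ T := hT ▸ Nat.pow_le_pow_right (by norm_num) (by omega)
    refine hkT.trans ?_
    by_contra hlt
    have h1 : T * (commonNbr (fun x y => G y x) X' (commonNbr G C Y₂)).card ≤ T * T :=
      Nat.mul_le_mul_left _ (by omega)
    have h2 : 2 * 50 * T * (commonNbr G C Y₂).card ≤ 2 * 50 * T * (T * T) :=
      Nat.mul_le_mul_left _ (hX'c.trans h1)
    have h3 : 2 * 50 * T * (T * T) = 100 * T ^ 3 := by ring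
    omega)
  simp only [mem_commonNbr] at hC'm
  exact ⟨X, C, C', X', hXs, hX's, hXl, hCl, hC'l, hX'l, hC₀p.sublist hCs, hC'p,
    fun c hc => ⟨((hYs _).1 (hC₀m c (hCs.subset hc)).1).1, (hC₀m c (hCs.subset hc)).2⟩,
    fun c hc => ⟨(hC'm c hc).1.1, (hC'm c hc).1.2, (hC'm c hc).2⟩⟩

/-- A rich list can be connected to another one through any large balanced set. -/
theorem IsTourn.exists_connector (hG : IsTourn G) (hk : 2 ≤ k)
    (hD : 10 ^ 6 * k * 2 ^ (100 * k) ≤ D) {H U : Finset V}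
    (hH : Balanced G H) (hh : D ^ 4 ≤ H.card) (hU : U.card * D ^ 2 ≤ H.card)
    {A B : List V} (hA : A.Pairwise G) (hB : B.Pairwise G) (hAr : RichIn D G H A)
    (hBr : RichOut D G H B) :
    ∃ L : List V, L.length = 4 * k ∧ L.Nodup ∧ (∀ x ∈ L, x ∈ H ∧ x ∉ U) ∧
      PowPath k G (B ++ L ++ A) := by
  have hDk := le_of_pow_hundred_le hD
  obtain ⟨T, hT⟩ : ∃ T, T = 2 ^ (100 * k) := ⟨_, rfl⟩
  rw [← hT] at hD
  have hT1 : 0 < T := hT ▸ Nat.two_pow_pos _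
  have hTh : 10 ^ 6 * (2 ^ (100 * k)) ^ 3 ≤ H.card := by
    have h6 : 10 ^ 6 * T ≤ D := by nlinarith
    have h3 : (10 ^ 6 * T) ^ 3 ≤ D ^ 3 := Nat.pow_le_pow_left h6 3
    rw [mul_pow] at h3
    have h34 : D ^ 3 ≤ D ^ 4 := Nat.pow_le_pow_right (by omega) (by norm_num)
    rw [← hT]
    omega
  have hTD : T ≤ D := by nlinarith
  have hD3 : D * 1000000 ≤ D ^ 3 := by
    rw [pow_succ']
    exact Nat.mul_le_mul_left _ (by nlinarith)
  have hD34 : D ^ 3 ≤ D ^ 4 := Nat.pow_le_pow_right (by omega) (by norm_num)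
  have hU' : 200 * U.card ≤ H.card := by nlinarith
  obtain ⟨hz1, hz2⟩ := card_lower_of_rich (by omega) hBr hU hh
  obtain ⟨X₀, hX₀l, hX₀p, hX₀m⟩ := hG.exists_transitive (100 * k) (commonNbr G B H \ U) (by
    have := Finset.le_card_sdiff U (commonNbr G B H)
    omega)
  have hX₀c : X₀.toFinset.card = 100 * k := by
    rw [List.toFinset_card_of_nodup (hG.nodup hX₀p), hX₀l]
  obtain ⟨hz3, hz4⟩ := card_lower_of_rich (by omega) hAr hU hh
  obtain ⟨X₁, hX₁l, hX₁p, hX₁m⟩ := hG.exists_transitive (100 * k)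
    (commonNbr (fun x y => G y x) A H \ (U ∪ X₀.toFinset)) (by
    have := Finset.le_card_sdiff (U ∪ X₀.toFinset) (commonNbr (fun x y => G y x) A H)
    have := Finset.card_union_le U X₀.toFinset
    omega)
  have hX₁c : X₁.toFinset.card = 100 * k := by
    rw [List.toFinset_card_of_nodup (hG.nodup hX₁p), hX₁l]
  simp only [Finset.mem_sdiff, Finset.mem_union, List.mem_toFinset, mem_commonNbr] at hX₀m hX₁m
  obtain ⟨U', hU'def⟩ : ∃ U', U' = U ∪ X₀.toFinset ∪ X₁.toFinset := ⟨_, rfl⟩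
  have hU'c : 100 * U'.card ≤ H.card := by
    rw [hU'def]
    have := Finset.card_union_le (U ∪ X₀.toFinset) X₁.toFinset
    have := Finset.card_union_le U X₀.toFinset
    omega
  have hp₁ := card_popular (k := k) G (by omega) (fun x => (hH x).1) hX₀l
  have hp₂ := card_popular (k := k) (fun x y => G y x) (by omega) (fun x => (hH x).2) hX₁l
  obtain ⟨Y₁, hY₁⟩ : ∃ Y, Y = (H.filter fun y => k ≤ X₀.countP (fun x => G x y)) \ U' :=
    ⟨_, rfl⟩
  obtain ⟨Y₂, hY₂⟩ : ∃ Y, Y = (H.filter fun y => k ≤ X₁.countP (fun x => G y x)) \ U' :=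
    ⟨_, rfl⟩
  have hY₁c : 43 * H.card ≤ 100 * Y₁.card := by
    rw [hY₁]
    have := Finset.le_card_sdiff U' (H.filter fun y => k ≤ X₀.countP (fun x => G x y))
    omega
  have hY₂c : 43 * H.card ≤ 100 * Y₂.card := by
    rw [hY₂]
    have := Finset.le_card_sdiff U' (H.filter fun y => k ≤ X₁.countP (fun x => G y x))
    omega
  have hY₁H : Y₁ ⊆ H := hY₁ ▸ Finset.sdiff_subset.trans (Finset.filter_subset _ _)
  have hY₂H : Y₂ ⊆ H := hY₂ ▸ Finset.sdiff_subset.trans (Finset.filter_subset _ _)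
  obtain ⟨X, C, C', X', hXs, hX's, hXl, hCl, hC'l, hX'l, hCp, hC'p, hC₁, hC'₂⟩ :=
    hG.exists_bridge (by omega) hH hTh hY₁H hY₂H hY₁c hY₂c hX₀l hX₁l
    (fun y hy => by
      rw [hY₁] at hy
      exact (Finset.mem_filter.1 (Finset.mem_sdiff.1 hy).1).2)
    (fun y hy => by
      rw [hY₂] at hy
      exact (Finset.mem_filter.1 (Finset.mem_sdiff.1 hy).1).2)
  have hXp := hX₀p.sublist hXs
  have hX'p := hX₁p.sublist hX's
  have memY₁ : ∀ x ∈ C, x ∈ H ∧ x ∉ U' := fun x hx => by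
    have := (hC₁ x hx).1
    exact ⟨hY₁H this, (Finset.mem_sdiff.1 (hY₁ ▸ this)).2⟩
  have memY₂ : ∀ x ∈ C', x ∈ H ∧ x ∉ U' := fun x hx => by
    have := (hC'₂ x hx).1
    exact ⟨hY₂H this, (Finset.mem_sdiff.1 (hY₂ ▸ this)).2⟩
  simp only [hU'def, Finset.mem_union, List.mem_toFinset, not_or] at memY₁ memY₂
  have e1 : (B ++ X).Pairwise G := List.pairwise_append.2 ⟨hB, hXp, fun b hb x hx =>
    (hX₀m x (hXs.subset hx)).1.2 b hb⟩
  have e2 : (X ++ C).Pairwise G := List.pairwise_append.2 ⟨hXp, hCp, fun b hb x hx =>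
    (hC₁ x hx).2 b hb⟩
  have e3 : (C ++ C').Pairwise G := List.pairwise_append.2 ⟨hCp, hC'p, fun b hb x hx =>
    (hC'₂ x hx).2.1 b hb⟩
  have e4 : (C' ++ X').Pairwise G := List.pairwise_append.2 ⟨hC'p, hX'p, fun b hb x hx =>
    (hC'₂ b hb).2.2 x hx⟩
  have e5 : (X' ++ A).Pairwise G := List.pairwise_append.2 ⟨hX'p, hA, fun b hb x hx =>
    (hX₁m b (hX's.subset hb)).1.2 x hx⟩
  refine ⟨X ++ C ++ C' ++ X', by simp; omega, ?_, ?_, ?_⟩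
  · have n1 := hG.nodup e2
    have n2 := hG.nodup e4
    rw [List.append_assoc, List.nodup_append']
    refine ⟨n1, n2, ?_⟩
    intro x hx hx'
    rcases List.mem_append.1 hx with hx | hx <;> rcases List.mem_append.1 hx' with hx' | hx'
    · exact (memY₂ x hx').2.1.2 (hXs.subset hx)
    · exact (hX₁m x (hX's.subset hx')).2 (Or.inr (hXs.subset hx))
    · exact List.disjoint_of_nodup_append (hG.nodup e3) hx hx'
    · exact (memY₁ x hx).2.2 (hX's.subset hx')
  · intro x hx
    simp only [List.mem_append] at hx
    rcases hx with ((hx | hx) | hx) | hx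
    · exact ⟨(hX₀m x (hXs.subset hx)).1.1, (hX₀m x (hXs.subset hx)).2⟩
    · exact ⟨(memY₁ x hx).1, (memY₁ x hx).2.1.1⟩
    · exact ⟨(memY₂ x hx).1, (memY₂ x hx).2.1.1⟩
    · exact ⟨(hX₁m x (hX's.subset hx)).1.1, fun h => (hX₁m x (hX's.subset hx)).2 (Or.inl h)⟩
  · have f1 := (powPath_of_pairwise (k := k) e1).glue (powPath_of_pairwise e2) (by omega)
    have f2 := f1.glue (powPath_of_pairwise e3) (by omega)
    have f3 := f2.glue (powPath_of_pairwise e4) (by omega)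
    have f4 := f3.glue (powPath_of_pairwise e5) (by omega)
    simpa [List.append_assoc] using f4

end Connecting

section Segments

variable {V : Type*} [DecidableEq V] {G : V → V → Prop} [DecidableRel G] {k D : ℕ}

theorem exists_sublist_richOut {V : Type*} {G : V → V → Prop} [DecidableRel G] (hk : 0 < k)
    (hD : 10 ^ 6 * k * 2 ^ (100 * k) ≤ D) {H : Finset V}
    (hH : Balanced G H) {X : List V} (hX : X.length = 6 * k) :
    ∃ X', X'.Sublist X ∧ X'.length = k ∧ RichOut D G H X' := by
  obtain ⟨X', h1, h2, h3⟩ := exists_sublist_rich G X k 3 hk (by norm_num) H (by omega)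
    (fun x _ => by have := (hH x).1; omega)
  refine ⟨X', h1, h2, h3.trans (Nat.mul_le_mul_right _ (le_trans ?_ hD))⟩
  exact Nat.mul_le_mul (by omega) (Nat.pow_le_pow_right (by norm_num) (by omega))

theorem exists_sublist_richIn {V : Type*} {G : V → V → Prop} [DecidableRel G] (hk : 0 < k)
    (hD : 10 ^ 6 * k * 2 ^ (100 * k) ≤ D) {H : Finset V}
    (hH : Balanced G H) {X : List V} (hX : X.length = 6 * k) :
    ∃ X', X'.Sublist X ∧ X'.length = k ∧ RichIn D G H X' := by
  obtain ⟨X', h1, h2, h3⟩ := exists_sublist_rich (fun x y => G y x) X k 3 hk (by norm_num) H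
    (by omega) (fun x _ => by have := (hH x).2; omega)
  refine ⟨X', h1, h2, h3.trans (Nat.mul_le_mul_right _ (le_trans ?_ hD))⟩
  exact Nat.mul_le_mul (by omega) (Nat.pow_le_pow_right (by norm_num) (by omega))

/-- Data of a flexible segment: a power of a path from `A` to `B` through all vertices of `K`
that may absorb an arbitrary subset of `F`. -/
structure Seg (V : Type*) where
  K : Finset V
  F : Finset V
  A : List V
  B : List V

/-- The segment `σ` is realised in `G`, and both of its ends are richly attached to `H`. -/
structure Seg.Valid (k D : ℕ) (G : V → V → Prop) [DecidableRel G] (H : Finset V) (σ : Seg V) :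
    Prop where
  lenA : σ.A.length = k
  lenB : σ.B.length = k
  pairA : σ.A.Pairwise G
  pairB : σ.B.Pairwise G
  richA : RichIn D G H σ.A
  richB : RichOut D G H σ.B
  flex : ∀ E ⊆ σ.F, ∃ M, PowPath k G (σ.A ++ M ++ σ.B) ∧ (σ.A ++ M ++ σ.B).Nodup ∧
    ∀ x, x ∈ σ.A ++ M ++ σ.B ↔ x ∈ σ.K ∨ x ∈ E

/-- Around every vertex `v` there is a short segment that may or may not absorb `v`. -/
theorem IsTourn.exists_gap (hG : IsTourn G) (hk : 2 ≤ k) (hD : 10 ^ 6 * k * 2 ^ (100 * k) ≤ D)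
    {H U : Finset V} (hH : Balanced G H) (hh : D ^ 4 ≤ H.card) (hU : U.card * D ^ 2 ≤ H.card)
    (v : V) :
    ∃ σ : Seg V, σ.Valid k D G H ∧ σ.F = {v} ∧ v ∉ σ.K ∧ σ.K.card ≤ 4 * k ∧
      ∀ x ∈ σ.K, x ∈ H ∧ x ∉ U := by
  have hDk := le_of_pow_hundred_le hD
  obtain ⟨T, hT⟩ : ∃ T, T = 2 ^ (100 * k) := ⟨_, rfl⟩
  have hT1 : 0 < T := hT ▸ Nat.two_pow_pos _
  have hTD : 1000000 * T ≤ D := by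
    refine le_trans ?_ hD
    rw [← hT]
    nlinarith
  have hD2 : 10 ^ 12 * T ^ 2 ≤ D ^ 2 := by
    have := Nat.pow_le_pow_left hTD 2
    rwa [mul_pow] at this
  have hD24 : D ^ 2 ≤ D ^ 4 := Nat.pow_le_pow_right (by omega) (by norm_num)
  have hT2 : T ≤ T ^ 2 := Nat.le_self_pow (by norm_num) T
  have hUc : 200 * U.card ≤ H.card := by
    have h200 : 200 ≤ D ^ 2 := by omega
    have := Nat.mul_le_mul_left U.card h200
    omega
  obtain ⟨Y₁, hY₁⟩ : ∃ Y, Y = (H.filter fun y => G y v) \ U := ⟨_, rfl⟩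
  obtain ⟨Y₂, hY₂⟩ : ∃ Y, Y = (H.filter (G v)) \ U := ⟨_, rfl⟩
  have hY₁c : 43 * H.card ≤ 100 * Y₁.card := by
    have := Finset.le_card_sdiff U (H.filter fun y => G y v)
    have := (hH v).2
    rw [hY₁]
    omega
  have hY₂c : 43 * H.card ≤ 100 * Y₂.card := by
    have := Finset.le_card_sdiff U (H.filter (G v))
    have := (hH v).1
    rw [hY₂]
    omega
  have hY₁m : ∀ y ∈ Y₁, G y v ∧ y ∈ H ∧ y ∉ U := fun y hy => by
    rw [hY₁, Finset.mem_sdiff, Finset.mem_filter] at hy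
    tauto
  have hY₂m : ∀ y ∈ Y₂, G v y ∧ y ∈ H ∧ y ∉ U := fun y hy => by
    rw [hY₂, Finset.mem_sdiff, Finset.mem_filter] at hy
    tauto
  have hd := hG.exists_dense hH (by omega) (fun y hy => (hY₁m y hy).2.1)
    (fun y hy => (hY₂m y hy).2.1) hY₁c hY₂c
  obtain ⟨X, hXl, hXp, hXm⟩ := hG.exists_transitive (106 * k) _ (by
    have h1 : 2 ^ (106 * k) ≤ T ^ 2 := by
      rw [hT, ← pow_mul]
      exact Nat.pow_le_pow_right (by norm_num) (by omega)
    have h2 : 50 * T ^ 2 ≤ H.card := by omega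
    exact h1.trans (by omega) : 2 ^ (106 * k) ≤
      (Y₁.filter fun y => H.card ≤ 50 * (Y₂.filter (G y)).card).card)
  simp only [Finset.mem_filter] at hXm
  obtain ⟨A, hAs, hAl, hAr⟩ := exists_sublist_richIn (by omega) hD hH (X := X.take (6 * k))
    (by simp; omega)
  obtain ⟨A', hA's, hA'l, hA'c⟩ := exists_sublist_rich G (X.drop (6 * k)) k 50 (by omega)
    (by norm_num) Y₂ (by simp; omega) (fun x hx =>
      (Finset.card_le_card fun y hy => (hY₂m y hy).2.1).trans (hXm x (List.mem_of_mem_drop hx)).2)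
  rw [show 2 * 50 * k = 100 * k by ring, ← hT] at hA'c
  obtain ⟨Y, hYl, hYp, hYm⟩ := hG.exists_transitive (7 * k) (commonNbr G A' Y₂) (by
    have h1 : 2 ^ (7 * k) ≤ T := hT ▸ Nat.pow_le_pow_right (by norm_num) (by omega)
    refine h1.trans ?_
    by_contra hlt
    have h2 : 2 * 50 * T * (commonNbr G A' Y₂).card ≤ 2 * 50 * T * T :=
      Nat.mul_le_mul_left _ (by omega)
    have h3 : 2 * 50 * T * T = 100 * T ^ 2 := by ring
    omega)
  simp only [mem_commonNbr] at hYm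
  obtain ⟨B, hBs, hBl, hBr⟩ := exists_sublist_richOut (by omega) hD hH (X := Y.drop k)
    (by simp; omega)
  obtain ⟨B', hB'⟩ : ∃ B', B' = Y.take k := ⟨_, rfl⟩
  have hAA' : (A ++ A').Pairwise G := by
    refine hXp.sublist ?_
    rw [← List.take_append_drop (6 * k) X]
    exact hAs.append hA's
  have hB'B : (B' ++ B).Pairwise G := by
    refine hYp.sublist ?_
    rw [← List.take_append_drop k Y, hB']
    exact (List.Sublist.refl _).append hBs
  have hA₁ : ∀ x ∈ A ++ A', x ∈ Y₁ := fun x hx => by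
    refine (hXm x ?_).1
    rcases List.mem_append.1 hx with hx | hx
    · exact List.mem_of_mem_take (hAs.subset hx)
    · exact List.mem_of_mem_drop (hA's.subset hx)
  have hB₂ : ∀ x ∈ B' ++ B, x ∈ Y := fun x hx => by
    rcases List.mem_append.1 hx with hx | hx
    · exact List.mem_of_mem_take (hB' ▸ hx)
    · exact List.mem_of_mem_drop (hBs.subset hx)
  have hB'l : B'.length = k := by rw [hB']; simp; omega
  have hA'B' : (A' ++ B').Pairwise G := List.pairwise_append.2
    ⟨(List.pairwise_append.1 hAA').2.1, (List.pairwise_append.1 hB'B).1, fun a ha b hb =>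
      (hYm b (hB₂ b (List.mem_append_left _ hb))).2 a ha⟩
  have hA'vB' : (A' ++ ([v] ++ B')).Pairwise G := by
    refine List.pairwise_append.2 ⟨(List.pairwise_append.1 hAA').2.1, List.pairwise_append.2
      ⟨List.pairwise_singleton _ _, (List.pairwise_append.1 hB'B).1, fun a ha b hb => ?_⟩,
      fun a ha b hb => ?_⟩
    · obtain rfl := List.mem_singleton.1 ha
      exact (hY₂m b (hYm b (hB₂ b (List.mem_append_left _ hb))).1).1
    · rcases List.mem_append.1 hb with hb | hb
      · obtain rfl := List.mem_singleton.1 hb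
        exact (hY₁m a (hA₁ a (List.mem_append_right _ ha))).1
      · exact (List.pairwise_append.1 hA'B').2.2 a ha b hb
  have hdisj : ∀ x, x ∈ A ++ A' → x ∉ B' ++ B := fun x hx hx' =>
    hG.asymm _ _ (hY₁m x (hA₁ x hx)).1 (hY₂m x (hYm x (hB₂ x hx')).1).1
  have hvA : v ∉ A ++ A' := fun hx => hG.irrefl _ (hY₁m v (hA₁ v hx)).1
  have hvB : v ∉ B' ++ B := fun hx => hG.irrefl _ (hY₂m v (hYm v (hB₂ v hx)).1).1
  have hpath : ∀ Z, (A' ++ (Z ++ B')).Pairwise G → PowPath k G (A ++ (A' ++ Z ++ B') ++ B) := by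
    intro Z hZ
    have f1 := (powPath_of_pairwise (k := k) hAA').glue (powPath_of_pairwise hZ) (by omega)
    have f2 : PowPath k G ((A ++ A' ++ Z) ++ B') := by simpa only [List.append_assoc] using f1
    have f3 := f2.glue (powPath_of_pairwise hB'B) (by omega)
    simpa only [List.append_assoc] using f3
  have hnd : (A ++ A' ++ (B' ++ B)).Nodup :=
    List.nodup_append'.2 ⟨hG.nodup hAA', hG.nodup hB'B, hdisj⟩
  refine ⟨⟨(A ++ A' ++ (B' ++ B)).toFinset, {v}, A, B⟩, ⟨hAl, hBl,
    (List.pairwise_append.1 hAA').1, (List.pairwise_append.1 hB'B).2.1, hAr, hBr, ?_⟩, rfl, ?_,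
    ?_, ?_⟩
  · intro E hE
    rcases Finset.subset_singleton_iff.1 hE with rfl | rfl
    · refine ⟨A' ++ [] ++ B', hpath [] (by simpa using hA'B'), ?_, fun x => ?_⟩
      · simpa [List.append_assoc] using hnd
      · simp [List.append_assoc]
    · refine ⟨A' ++ [v] ++ B', hpath [v] hA'vB', ?_, fun x => ?_⟩
      · have : (A ++ A' ++ ([v] ++ (B' ++ B))).Nodup := by
          refine List.nodup_append'.2 ⟨hG.nodup hAA', List.nodup_append'.2
            ⟨List.nodup_singleton _, hG.nodup hB'B, ?_⟩, ?_⟩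
          · intro x hx hx'
            exact hvB (List.mem_singleton.1 hx ▸ hx')
          · intro x hx hx'
            rcases List.mem_append.1 hx' with hx' | hx'
            · exact hvA (List.mem_singleton.1 hx' ▸ hx)
            · exact hdisj x hx hx'
        simpa only [List.append_assoc] using this
      · simp only [List.append_assoc, List.mem_append, List.mem_singleton, List.mem_toFinset,
          Finset.mem_singleton]
        tauto
  · rw [List.mem_toFinset, List.mem_append]
    exact not_or.2 ⟨hvA, hvB⟩
  · refine (List.toFinset_card_le _).trans ?_
    simp
    omega
  · intro x hx
    rw [List.mem_toFinset, List.mem_append] at hx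
    rcases hx with hx | hx
    · exact (hY₁m x (hA₁ x hx)).2
    · exact (hY₂m x (hYm x (hB₂ x hx)).1).2

/-- Any list of disjoint segments can be joined, through `H`, into a single power of a path. -/
theorem IsTourn.exists_join (hG : IsTourn G) (hk : 2 ≤ k) (hD : 10 ^ 6 * k * 2 ^ (100 * k) ≤ D)
    {H : Finset V} (hH : Balanced G H) (hh : D ^ 4 ≤ H.card) {A : List V} (hA : A.Pairwise G)
    (hAr : RichIn D G H A) (σs : List (Seg V)) :
    ∀ (U : Finset V) (B : List V), B.Pairwise G → RichOut D G H B → k ≤ B.length →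
    (∀ σ ∈ σs, σ.Valid k D G H) →
    σs.Pairwise (fun σ τ => Disjoint (σ.K ∪ σ.F) (τ.K ∪ τ.F)) →
    (∀ σ ∈ σs, ∀ x ∈ σ.K ∪ σ.F, x ∈ H → x ∈ U) →
    (U.card + 4 * k * (σs.length + 1)) * D ^ 2 ≤ H.card →
    ∃ R₀ : Finset V, R₀.card ≤ 4 * k * (σs.length + 1) ∧ (∀ x ∈ R₀, x ∈ H ∧ x ∉ U) ∧
      ∀ E : Finset V, (∀ x ∈ E, ∃ σ ∈ σs, x ∈ σ.F) →
        ∃ M, PowPath k G (B ++ M ++ A) ∧ M.Nodup ∧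
          ∀ x, x ∈ M ↔ (∃ σ ∈ σs, x ∈ σ.K) ∨ x ∈ R₀ ∨ x ∈ E := by
  induction σs with
  | nil =>
    intro U B hB hBr _ _ _ _ hU
    obtain ⟨L, hLl, hLn, hLm, hLp⟩ := hG.exists_connector hk hD hH hh (U := U)
      (le_trans (Nat.mul_le_mul_right _ (by omega)) hU) hA hB hAr hBr
    refine ⟨L.toFinset, ?_, by simpa using hLm, fun E hE => ⟨L, hLp, hLn, fun x => ?_⟩⟩
    · simpa [hLl] using List.toFinset_card_le L
    · have : x ∉ E := fun hx => by simpa using hE x hx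
      simp [this]
  | cons σ σs ih =>
    intro U B hB hBr hBl hval hdis hHU hU
    have hσ := hval σ (by simp)
    obtain ⟨L, hLl, hLn, hLm, hLp⟩ := hG.exists_connector hk hD hH hh (U := U)
      (le_trans (Nat.mul_le_mul_right _ (by omega)) hU) hσ.pairA hB hσ.richA hBr
    have hLc : L.toFinset.card ≤ 4 * k := by simpa [hLl] using List.toFinset_card_le L
    rw [List.pairwise_cons] at hdis
    obtain ⟨R₀, hRc, hRm, hR⟩ := ih (U ∪ L.toFinset) σ.B hσ.pairB hσ.richB hσ.lenB.ge
      (fun τ hτ => hval τ (by simp [hτ])) hdis.2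
      (fun τ hτ x hx hxH => Finset.mem_union_left _ (hHU τ (by simp [hτ]) x hx hxH)) (by
        refine le_trans (Nat.mul_le_mul_right _ ?_) hU
        have := Finset.card_union_le U L.toFinset
        simp only [List.length_cons]
        nlinarith)
    simp only [Finset.mem_union, List.mem_toFinset, not_or] at hRm hHU
    refine ⟨L.toFinset ∪ R₀, ?_, ?_, fun E hE => ?_⟩
    · have := Finset.card_union_le L.toFinset R₀
      simp only [List.length_cons]
      nlinarith
    · intro x hx
      rcases Finset.mem_union.1 hx with hx | hx
      · exact hLm x (List.mem_toFinset.1 hx)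
      · exact ⟨(hRm x hx).1, (hRm x hx).2.1⟩
    · obtain ⟨Mσ, hMp, hMn, hMm⟩ := hσ.flex (E ∩ σ.F) Finset.inter_subset_right
      classical
      obtain ⟨M, hp, hn, hm⟩ := hR (E.filter fun x => ∃ τ ∈ σs, x ∈ τ.F)
        (fun x hx => (Finset.mem_filter.1 hx).2)
      have hMH : ∀ x ∈ σ.A ++ Mσ ++ σ.B, x ∈ σ.K ∨ x ∈ σ.F := fun x hx =>
        ((hMm x).1 hx).imp_right fun h => (Finset.mem_inter.1 h).2
      have hM : ∀ x ∈ M, (∃ τ ∈ σs, x ∈ τ.K ∨ x ∈ τ.F) ∨ x ∈ R₀ := fun x hx => by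
        rcases (hm x).1 hx with ⟨τ, hτ, h⟩ | h | h
        · exact Or.inl ⟨τ, hτ, Or.inl h⟩
        · exact Or.inr h
        · obtain ⟨τ, hτ, h⟩ := (Finset.mem_filter.1 h).2
          exact Or.inl ⟨τ, hτ, Or.inr h⟩
      refine ⟨L ++ (σ.A ++ Mσ ++ σ.B) ++ M, ?_, ?_, fun x => ?_⟩
      · have f1 := hLp.glue (Y := Mσ ++ σ.B) (by simpa only [List.append_assoc] using hMp)
          hσ.lenA.ge
        have f2 : PowPath k G ((B ++ L ++ σ.A ++ Mσ) ++ σ.B) := by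
          simpa only [List.append_assoc] using f1
        have f3 := f2.glue (Y := M ++ A) (by simpa only [List.append_assoc] using hp) hσ.lenB.ge
        simpa only [List.append_assoc] using f3
      · rw [List.append_assoc, List.nodup_append', List.nodup_append']
        refine ⟨hLn, ⟨hMn, hn, ?_⟩, ?_⟩
        · intro x hx hx'
          have hxσ := hMH x hx
          rcases hM x hx' with ⟨τ, hτ, h⟩ | h
          · exact Finset.disjoint_left.1 (hdis.1 τ hτ) (Finset.mem_union.2 hxσ)
              (Finset.mem_union.2 h)
          · exact (hRm x h).2.1 (hHU σ (by simp) x hxσ (hRm x h).1)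
        · intro x hx hx'
          have hxL := hLm x hx
          rcases List.mem_append.1 hx' with hx' | hx'
          · exact hxL.2 (hHU σ (by simp) x (hMH x hx') hxL.1)
          · rcases hM x hx' with ⟨τ, hτ, h⟩ | h
            · exact hxL.2 (hHU τ (by simp [hτ]) x h hxL.1)
            · exact (hRm x h).2.2 hx
      · rw [List.mem_append, List.mem_append, hMm, hm]
        simp only [List.mem_cons, exists_eq_or_imp, Finset.mem_union, List.mem_toFinset,
          Finset.mem_inter, Finset.mem_filter]
        have : x ∈ E → x ∈ σ.F ∨ ∃ τ ∈ σs, x ∈ τ.F := fun h => by simpa using hE x h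
        generalize (∃ τ ∈ σs, x ∈ τ.F) = p at this ⊢
        generalize (∃ τ ∈ σs, x ∈ τ.K) = q
        clear * - this
        tauto

end Segments

section GapFamily

variable {V : Type*} [DecidableEq V] {G : V → V → Prop} [DecidableRel G] {k D : ℕ}

/-- Disjoint segments around all vertices of a small set. -/
theorem IsTourn.exists_gaps (hG : IsTourn G) (hk : 2 ≤ k) (hD : 10 ^ 6 * k * 2 ^ (100 * k) ≤ D)
    {H U : Finset V} (hH : Balanced G H) (hh : D ^ 4 ≤ H.card) (vs : Finset V)
    (hU : (U.card + 4 * k * vs.card) * D ^ 2 ≤ H.card) :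
    ∃ σ : V → Seg V, (∀ v ∈ vs, (σ v).Valid k D G H ∧ (σ v).F = {v} ∧ v ∉ (σ v).K ∧
      (σ v).K.card ≤ 4 * k ∧ ∀ x ∈ (σ v).K, x ∈ H ∧ x ∉ U) ∧
      ∀ v ∈ vs, ∀ w ∈ vs, v ≠ w → Disjoint (σ v).K (σ w).K := by
  induction vs using Finset.induction_on with
  | empty => exact ⟨fun _ => ⟨∅, ∅, [], []⟩, by simp, by simp⟩
  | insert a vs ha ih =>
    rw [Finset.card_insert_of_notMem ha] at hU
    obtain ⟨σ, hσ, hdis⟩ := ih (le_trans (Nat.mul_le_mul_right _ (by nlinarith)) hU)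
    have hc : (vs.biUnion fun v => (σ v).K).card ≤ vs.card * (4 * k) :=
      Finset.card_biUnion_le_card_mul _ _ _ fun v hv => (hσ v hv).2.2.2.1
    obtain ⟨τ, hτ, hτF, hτa, hτc, hτm⟩ := hG.exists_gap hk hD hH hh
      (U := U ∪ vs.biUnion fun v => (σ v).K) (by
        refine le_trans (Nat.mul_le_mul_right _ ?_) hU
        have := Finset.card_union_le U (vs.biUnion fun v => (σ v).K)
        nlinarith) a
    have hne : ∀ v ∈ vs, v ≠ a := fun v hv h => ha (h ▸ hv)
    have hτd : ∀ v ∈ vs, Disjoint τ.K (σ v).K := fun v hv => Finset.disjoint_left.2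
      fun x hx hx' => (hτm x hx).2
        (Finset.mem_union_right _ (Finset.mem_biUnion.2 ⟨v, hv, hx'⟩))
    refine ⟨Function.update σ a τ, fun v hv => ?_, fun v hv w hw hvw => ?_⟩
    · rcases Finset.mem_insert.1 hv with rfl | hv
      · rw [Function.update_self]
        exact ⟨hτ, hτF, hτa, hτc, fun x hx => ⟨(hτm x hx).1,
          fun h => (hτm x hx).2 (Finset.mem_union_left _ h)⟩⟩
      · rw [Function.update_of_ne (hne v hv)]
        exact hσ v hv
    · rcases Finset.mem_insert.1 hv with rfl | hv' <;> rcases Finset.mem_insert.1 hw with rfl | hw'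
      · exact absurd rfl hvw
      · rw [Function.update_self, Function.update_of_ne hvw.symm]
        exact hτd w hw'
      · rw [Function.update_self, Function.update_of_ne hvw]
        exact (hτd v hv').symm
      · rw [Function.update_of_ne (hne v hv'), Function.update_of_ne (hne w hw')]
        exact hdis v hv' w hw' hvw

end GapFamily

section MedianOrder

variable {V : Type*} {G : V → V → Prop} [DecidableRel G]

/-- The number of edges of `G` pointing forward in the list. -/
def fwdEdges (G : V → V → Prop) [DecidableRel G] : List V → ℕ
  | [] => 0
  | x :: l => l.countP (fun y => G x y) + fwdEdges G l

theorem fwdEdges_append_perm {l l' : List V} (h : l.Perm l') (a : List V) :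
    fwdEdges G (a ++ l) + fwdEdges G l' = fwdEdges G (a ++ l') + fwdEdges G l := by
  induction a with
  | nil => exact Nat.add_comm _ _
  | cons x a ih =>
    have := (h.append_left a).countP_eq (fun y => decide (G x y))
    simp only [List.cons_append, fwdEdges]
    omega

theorem fwdEdges_move (x : V) (b c : List V) :
    fwdEdges G (b ++ x :: c) + b.countP (fun y => G x y) =
      fwdEdges G (x :: (b ++ c)) + b.countP (fun y => G y x) := by
  induction b with
  | nil => simp
  | cons y b ih =>
    simp only [List.cons_append, fwdEdges, List.countP_cons, List.countP_append] at ih ⊢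
    omega

theorem fwdEdges_le (l : List V) : fwdEdges G l ≤ l.length * l.length := by
  induction l with
  | nil => simp [fwdEdges]
  | cons x l ih =>
    have : l.countP (fun y => G x y) ≤ l.length := List.countP_le_length
    simp only [fwdEdges, List.length_cons]
    nlinarith

/-- `l` is a median order: every vertex dominates at least half of each interval that follows. -/
structure IsMedian (G : V → V → Prop) [DecidableRel G] (l : List V) : Prop where
  nodup : l.Nodup
  half : ∀ a x b c, l = a ++ x :: (b ++ c) → b.length ≤ 2 * b.countP (fun y => G x y)

theorem IsMedian.drop {l : List V} (h : IsMedian G l) (i : ℕ) : IsMedian G (l.drop i) where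
  nodup := h.nodup.sublist (List.drop_sublist i l)
  half a x b c e := h.half (l.take i ++ a) x b c (by
    rw [List.append_assoc, ← e, List.take_append_drop])

theorem IsTourn.exists_median (hG : IsTourn G) (W : Finset V) :
    ∃ l : List V, IsMedian G l ∧ (∀ x, x ∈ l ↔ x ∈ W) ∧ l.length = W.card := by
  obtain ⟨n, ⟨l, hl, rfl⟩, hmax⟩ : ∃ n, (∃ l : List V, l.Perm W.toList ∧ fwdEdges G l = n) ∧
      ∀ l : List V, l.Perm W.toList → fwdEdges G l ≤ n := by
    classical
    have hex : ∃ n, ∃ l : List V, l.Perm W.toList ∧ fwdEdges G l = n := ⟨_, _, .rfl, rfl⟩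
    have hb : ∀ n, (∃ l : List V, l.Perm W.toList ∧ fwdEdges G l = n) → n ≤ W.card * W.card := by
      rintro n ⟨l, hl, rfl⟩
      simpa [hl.length_eq] using fwdEdges_le (G := G) l
    obtain ⟨n, hn⟩ := hex
    refine ⟨_, Nat.findGreatest_spec (P := fun n => ∃ l : List V, l.Perm W.toList ∧
      fwdEdges G l = n) (hb n hn) hn, fun l hl => Nat.le_findGreatest (hb _ ⟨l, hl, rfl⟩)
      ⟨l, hl, rfl⟩⟩
  have hnd : l.Nodup := hl.nodup_iff.2 W.nodup_toList
  refine ⟨l, ⟨hnd, ?_⟩, fun x => by rw [hl.mem_iff, Finset.mem_toList],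
    by rw [hl.length_eq, Finset.length_toList]⟩
  rintro a x b c rfl
  have hp : (x :: (b ++ c)).Perm (b ++ x :: c) := List.perm_middle.symm
  have h1 := hmax _ ((hp.symm.append_left a).trans hl)
  have h2 := fwdEdges_append_perm (G := G) hp a
  have h3 := fwdEdges_move (G := G) x b c
  have hxb : x ∉ b := fun h => by
    have := (List.nodup_append'.1 hnd).2.1
    rw [List.nodup_cons] at this
    exact this.1 (List.mem_append_left _ h)
  have h4 := List.length_eq_countP_add_countP (fun y => decide (G x y)) (l := b)
  have h5 : b.countP (fun y => ¬ decide (G x y) = true) ≤ b.countP (fun y => G y x) :=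
    List.countP_mono_left fun y hy => by
      simp only [decide_eq_true_eq]
      intro h
      exact (hG.total x y (by rintro rfl; exact hxb hy)).resolve_left h
  simp only [decide_eq_true_eq] at h4 h5
  omega

theorem IsMedian.disjoint_take_drop {l : List V} (hl : IsMedian G l) {i : ℕ} {x : V}
    (h₁ : x ∈ l.take i) (h₂ : x ∈ l.drop i) : False := by
  have h := hl.nodup
  rw [← List.take_append_drop i l] at h
  exact List.disjoint_of_nodup_append h h₁ h₂

end MedianOrder

section LongPieces

variable {V : Type*} [DecidableEq V] {G : V → V → Prop} [DecidableRel G] {k D : ℕ}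

theorem IsMedian.card_filter_le {l : List V} (hl : IsMedian G l) {m : ℕ} (hm : 3 * m ≤ l.length)
    {x : V} (hx : x ∈ l.take m) :
    2 * m ≤ 4 * (((l.drop m).take (2 * m)).toFinset.filter (G x)).card := by
  obtain ⟨a, b, hab⟩ := List.append_of_mem hx
  have hlen := congrArg List.length hab
  simp only [List.length_take, List.length_append, List.length_cons] at hlen
  have h := hl.half a x (b ++ (l.drop m).take (2 * m)) ((l.drop m).drop (2 * m)) (by
    rw [List.append_assoc, List.take_append_drop, ← List.cons_append, ← List.append_assoc, ← hab,
      List.take_append_drop])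
  rw [List.countP_append, List.length_append] at h
  have h1 : b.countP (fun y => G x y) ≤ b.length := List.countP_le_length
  have h2 : ((l.drop m).take (2 * m)).length = 2 * m := by simp; omega
  have hnd : ((l.drop m).take (2 * m)).Nodup :=
    hl.nodup.sublist ((List.take_sublist _ _).trans (List.drop_sublist _ _))
  have h3 : (((l.drop m).take (2 * m)).toFinset.filter (G x)).card =
      ((l.drop m).take (2 * m)).countP (fun y => G x y) := by
    rw [List.countP_eq_length_filter, ← List.toFinset_card_of_nodup (hnd.filter _),
      List.toFinset_filter]
    simp
  omega

/-- A median order contains a long power of a path starting inside any transitive list in the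
first block. -/
theorem IsTourn.exists_long_path (hG : IsTourn G) (hk : 2 ≤ k)
    (hD : 10 ^ 6 * k * 2 ^ (100 * k) ≤ D) {R : Finset V} (hR : Balanced G R) (t : ℕ) :
    ∀ l, IsMedian G l → 2 * D * t + D ≤ l.length →
    ∀ X₀ : List V, X₀.Pairwise G → X₀.length = 8 * k → (∀ x ∈ X₀, x ∈ l.take D) →
    ∃ X Y Z B : List V, X ++ Y = Z ++ B ∧ X.Sublist X₀ ∧ X.length = k ∧ B.length = k ∧
      B.Pairwise G ∧ RichOut D G R B ∧ PowPath k G (X ++ Y) ∧ (X ++ Y).Nodup ∧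
      t ≤ Y.length ∧ ∀ x ∈ Y, x ∈ l.drop D := by
  induction t with
  | zero =>
    intro l _ _ X₀ hp hX₀ hm
    obtain ⟨X, hXs, hXl, hXr⟩ := exists_sublist_richOut (by omega) hD hR (X := X₀.take (6 * k))
      (by simp; omega)
    have hXs' := hXs.trans (List.take_sublist _ _)
    have hXp := hp.sublist hXs'
    exact ⟨X, [], [], X, by simp, hXs', hXl, hXl, hXp, hXr, by simpa using powPath_of_pairwise hXp,
      by simpa using hG.nodup hXp, by simp, by simp⟩
  | succ t ih =>
    intro l hl hlen X₀ hp hX₀ hm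
    have hDl : 2 * D * t + 3 * D ≤ l.length := by nlinarith
    obtain ⟨b₁, hb₁⟩ : ∃ b, b = (l.drop D).take D := ⟨_, rfl⟩
    obtain ⟨b₂, hb₂⟩ : ∃ b, b = (l.drop (2 * D)).take D := ⟨_, rfl⟩
    have hb : (l.drop D).take (2 * D) = b₁ ++ b₂ := by
      rw [hb₁, hb₂, two_mul, List.take_add, List.drop_drop]
    have hYc : (b₁ ++ b₂).toFinset.card = 2 * D := by
      rw [← hb, List.toFinset_card_of_nodup
        (hl.nodup.sublist ((List.take_sublist _ _).trans (List.drop_sublist _ _)))]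
      simp
      omega
    obtain ⟨X, hXs, hXl, hXc⟩ := exists_sublist_rich G X₀ k 4 (by omega) (by norm_num)
      (b₁ ++ b₂).toFinset (by omega) (fun x hx => by
        rw [hYc, ← hb]
        exact hl.card_filter_le (by omega) (hm x hx))
    rw [hYc] at hXc
    have hXp := hp.sublist hXs
    have key : ∃ i, D ≤ i ∧ i ≤ 2 * D ∧
        2 ^ (8 * k) ≤ (commonNbr G X ((l.drop i).take D).toFinset).card := by
      have hsub : commonNbr G X (b₁ ++ b₂).toFinset ⊆
          commonNbr G X b₁.toFinset ∪ commonNbr G X b₂.toFinset := by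
        intro y
        simp only [mem_commonNbr, Finset.mem_union, List.mem_toFinset, List.mem_append]
        tauto
      have hle := (Finset.card_le_card hsub).trans (Finset.card_union_le _ _)
      obtain ⟨T, hT⟩ : ∃ T, T = 2 ^ (8 * k) := ⟨_, rfl⟩
      have hTD : 16 * (T * T) ≤ D := by
        refine le_trans ?_ hD
        rw [hT, ← pow_add]
        exact Nat.mul_le_mul (by omega) (Nat.pow_le_pow_right (by norm_num) (by omega))
      have hT1 : 0 < T := hT ▸ Nat.two_pow_pos _
      rw [show 2 * 4 * k = 8 * k by ring, ← hT] at hXc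
      rw [← hT]
      by_contra! hcon
      have c1 := hcon D le_rfl (by omega)
      have c2 := hcon (2 * D) (by omega) le_rfl
      rw [← hb₁] at c1
      rw [← hb₂] at c2
      have : 2 * 4 * T * (commonNbr G X (b₁ ++ b₂).toFinset).card ≤ 2 * 4 * T * (2 * T) :=
        Nat.mul_le_mul_left _ (by omega)
      nlinarith
    obtain ⟨i, hi₁, hi₂, hi⟩ := key
    obtain ⟨X₁, hX₁l, hX₁p, hX₁m⟩ := hG.exists_transitive (8 * k) _ hi
    simp only [mem_commonNbr, List.mem_toFinset] at hX₁m
    obtain ⟨X', Y, Z, B, e, hX's, hX'l, hBl, hBp, hBr, hpath, hnd, ht, hmem⟩ := ih (l.drop i)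
      (hl.drop i) (by simp; omega) X₁ hX₁p hX₁l (fun x hx => (hX₁m x hx).1)
    have hXX' : (X ++ X').Pairwise G := List.pairwise_append.2 ⟨hXp, hX₁p.sublist hX's,
      fun a ha b hb => (hX₁m b (hX's.subset hb)).2 a ha⟩
    have hmem' : ∀ x ∈ X' ++ Y, x ∈ l.drop D := fun x hx => by
      refine List.drop_subset_drop_left l hi₁ ?_
      rcases List.mem_append.1 hx with hx | hx
      · exact List.mem_of_mem_take (hX₁m x (hX's.subset hx)).1
      · exact List.mem_of_mem_drop (hmem x hx)
    refine ⟨X, X' ++ Y, X ++ Z, B, by rw [e, List.append_assoc], hXs, hXl, hBl, hBp, hBr, ?_, ?_,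
      by simp; omega, hmem'⟩
    · have := (powPath_of_pairwise (k := k) hXX').glue hpath hX'l.ge
      simpa only [List.append_assoc] using this
    · exact List.nodup_append'.2 ⟨hG.nodup hXp, hnd, fun x hx hxB =>
        hl.disjoint_take_drop (hm x (hXs.subset hx)) (hmem' x hxB)⟩

/-- Every large set contains a long segment whose ends are richly attached to `R`. -/
theorem IsTourn.exists_piece (hG : IsTourn G) (hk : 2 ≤ k)
    (hD : 10 ^ 6 * k * 2 ^ (100 * k) ≤ D) {R : Finset V} (hR : Balanced G R) (t : ℕ)
    {W : Finset V} (hW : 2 * D * t + D ≤ W.card) :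
    ∃ σ : Seg V, σ.Valid k D G R ∧ σ.F = ∅ ∧ σ.K ⊆ W ∧ t ≤ σ.K.card := by
  obtain ⟨l, hl, hlW, hlc⟩ := hG.exists_median W
  rw [← hlc] at hW
  obtain ⟨X, hXl, hXp, hXm⟩ := hG.exists_transitive (14 * k) (l.take D).toFinset (by
    rw [List.toFinset_card_of_nodup (hl.nodup.sublist (List.take_sublist _ _)), List.length_take,
      min_eq_left (by omega)]
    refine le_trans ?_ hD
    rw [← one_mul (2 ^ (14 * k))]
    exact Nat.mul_le_mul (by omega) (Nat.pow_le_pow_right (by norm_num) (by omega)))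
  simp only [List.mem_toFinset] at hXm
  obtain ⟨A, hAs, hAl, hAr⟩ := exists_sublist_richIn (by omega) hD hR (X := X.take (6 * k))
    (by simp; omega)
  obtain ⟨X', Y, Z, B, e, hX's, hX'l, hBl, hBp, hBr, hpath, hnd, ht, hmem⟩ :=
    hG.exists_long_path hk hD hR t l hl hW (X.drop (6 * k)) (hXp.sublist (List.drop_sublist _ _))
    (by simp; omega) (fun x hx => hXm x (List.mem_of_mem_drop hx))
  have hAX' : (A ++ X').Pairwise G := by
    refine hXp.sublist ?_
    rw [← List.take_append_drop (6 * k) X]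
    exact hAs.append hX's
  have hAm : ∀ x ∈ A ++ X', x ∈ l.take D := fun x hx => by
    rcases List.mem_append.1 hx with hx | hx
    · exact hXm x (List.mem_of_mem_take (hAs.subset hx))
    · exact hXm x (List.mem_of_mem_drop (hX's.subset hx))
  have hnd' : (A ++ X' ++ Y).Nodup := List.nodup_append'.2 ⟨hG.nodup hAX',
    (List.nodup_append'.1 hnd).2.1, fun x hx hx' => hl.disjoint_take_drop (hAm x hx) (hmem x hx')⟩
  have e' : A ++ Z ++ B = A ++ X' ++ Y := by rw [List.append_assoc, ← e, List.append_assoc]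
  refine ⟨⟨(A ++ X' ++ Y).toFinset, ∅, A, B⟩, ⟨hAl, hBl, (List.pairwise_append.1 hAX').1, hBp, hAr,
    hBr, fun E hE => ⟨Z, ?_, ?_, fun x => ?_⟩⟩, rfl, fun x hx => ?_, ?_⟩
  · change PowPath k G (A ++ Z ++ B)
    rw [e']
    exact (powPath_of_pairwise (k := k) hAX').glue hpath hX'l.ge
  · change (A ++ Z ++ B).Nodup
    rwa [e']
  · change x ∈ A ++ Z ++ B ↔ _
    rw [e', Finset.subset_empty.1 hE]
    simp
  · rw [← hlW]
    rcases List.mem_append.1 (List.mem_toFinset.1 hx) with hx | hx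
    · exact List.mem_of_mem_take (hAm x hx)
    · exact List.mem_of_mem_drop (hmem x hx)
  · rw [List.toFinset_card_of_nodup hnd']
    simp
    omega

/-- Every set can be decomposed into long segments and a small remainder. -/
theorem IsTourn.exists_pieces (hG : IsTourn G) (hk : 2 ≤ k)
    (hD : 10 ^ 6 * k * 2 ^ (100 * k) ≤ D) {R : Finset V} (hR : Balanced G R) (t : ℕ)
    (W : Finset V) :
    ∃ (σs : List (Seg V)) (W₀ : Finset V), W₀ ⊆ W ∧ W₀.card ≤ 2 * D * t + D ∧
      σs.length * t ≤ W.card ∧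
      (∀ σ ∈ σs, σ.Valid k D G R ∧ σ.F = ∅ ∧ σ.K ⊆ W ∧ Disjoint σ.K W₀) ∧
      σs.Pairwise (fun σ τ => Disjoint σ.K τ.K) ∧
      ∀ x ∈ W, x ∈ W₀ ∨ ∃ σ ∈ σs, x ∈ σ.K := by
  induction hn : W.card using Nat.strong_induction_on generalizing W with
  | _ n ih =>
    subst hn
    by_cases hW : 2 * D * t + D ≤ W.card
    · obtain ⟨σ, hσ, hF, hKW, ht⟩ := hG.exists_piece hk hD hR t hW
      have hKc : 0 < σ.K.card := by
        obtain ⟨M, -, -, hM⟩ := hσ.flex ∅ (by simp)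
        obtain ⟨a, ha⟩ := List.exists_mem_of_length_pos (l := σ.A) (by rw [hσ.lenA]; omega)
        have := (hM a).1 (by simp [ha])
        exact Finset.card_pos.2 ⟨a, by simpa using this⟩
      have hc := Finset.card_sdiff_add_card_eq_card hKW
      obtain ⟨σs, W₀, h1, h2, h3, h4, h5, h6⟩ := ih (W \ σ.K).card (by omega) (W \ σ.K) rfl
      refine ⟨σ :: σs, W₀, h1.trans Finset.sdiff_subset, h2, ?_, ?_, ?_, ?_⟩
      · simp only [List.length_cons]
        nlinarith
      · intro τ hτ
        rcases List.mem_cons.1 hτ with rfl | hτ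
        · exact ⟨hσ, hF, hKW, Finset.disjoint_left.2 fun x hx hx' =>
            (Finset.mem_sdiff.1 (h1 hx')).2 hx⟩
        · obtain ⟨g1, g2, g3, g4⟩ := h4 τ hτ
          exact ⟨g1, g2, g3.trans Finset.sdiff_subset, g4⟩
      · exact List.pairwise_cons.2 ⟨fun τ hτ => Finset.disjoint_left.2 fun x hx hx' =>
          (Finset.mem_sdiff.1 ((h4 τ hτ).2.2.1 hx')).2 hx, h5⟩
      · intro x hx
        by_cases hxK : x ∈ σ.K
        · exact Or.inr ⟨σ, by simp, hxK⟩
        · rcases h6 x (Finset.mem_sdiff.2 ⟨hx, hxK⟩) with h | ⟨τ, hτ, h⟩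
          · exact Or.inl h
          · exact Or.inr ⟨τ, by simp [hτ], h⟩
    · exact ⟨[], W, subset_rfl, by omega, by simp, by simp, by simp, fun x hx => Or.inl hx⟩

end LongPieces

section Assembly

variable {V : Type*} [DecidableEq V] {G : V → V → Prop} [DecidableRel G] {k D : ℕ}

theorem RichIn.sublist {V : Type*} {G : V → V → Prop} [DecidableRel G] {H : Finset V}
    {X X' : List V} (h : RichIn D G H X) (hs : X'.Sublist X) :
    RichIn D G H X' :=
  le_trans h (Nat.mul_le_mul_left _ (Finset.card_le_card (commonNbr_mono hs.subset H)))

/-- Every long list has a sublist with many common in-neighbours in `H₁` and many common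
out-neighbours in `H₂`. -/
theorem exists_sublist_richIn_richOut {V : Type*} {G : V → V → Prop} [DecidableRel G]
    (hk : 0 < k) (hD : 10 ^ 6 * k * 2 ^ (100 * k) ≤ D)
    {H₁ H₂ : Finset V} (h₁ : Balanced G H₁) (h₂ : Balanced G H₂) {X : List V}
    (hX : X.length = 36 * k) :
    ∃ X', X'.Sublist X ∧ X'.length = k ∧ RichIn D G H₁ X' ∧ RichOut D G H₂ X' := by
  obtain ⟨X₁, hs, hl, hr⟩ := exists_sublist_rich (fun x y => G y x) X (6 * k) 3 (by omega)
    (by norm_num) H₁ (by omega) (fun x _ => by have := (h₁ x).2; omega)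
  have hr' : RichIn D G H₁ X₁ := by
    refine hr.trans (Nat.mul_le_mul_right _ (le_trans ?_ hD))
    exact Nat.mul_le_mul (by omega) (Nat.pow_le_pow_right (by norm_num) (by omega))
  obtain ⟨X₂, hs₂, hl₂, hr₂⟩ := exists_sublist_richOut hk hD h₂ hl
  exact ⟨X₂, hs₂.trans hs, hl₂, hr'.sublist hs₂, hr₂⟩

/-- Force a segment to absorb its optional vertex. -/
theorem Seg.Valid.absorb {H : Finset V} {σ : Seg V} (h : σ.Valid k D G H) {v : V}
    (hF : σ.F = {v}) : Seg.Valid k D G H ⟨insert v σ.K, ∅, σ.A, σ.B⟩ where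
  lenA := h.lenA
  lenB := h.lenB
  pairA := h.pairA
  pairB := h.pairB
  richA := h.richA
  richB := h.richB
  flex E hE := by
    obtain ⟨M, h1, h2, h3⟩ := h.flex {v} hF.ge
    refine ⟨M, h1, h2, fun x => ?_⟩
    rw [h3, Finset.subset_empty.1 hE]
    simp only [Finset.mem_singleton, Finset.mem_insert, Finset.notMem_empty, or_false]
    exact or_comm

/-- A power of a path that may absorb an arbitrary subset of `R`. -/
theorem IsTourn.exists_absorber [Fintype V] (hG : IsTourn G) (hk : 2 ≤ k)
    (hD : 10 ^ 6 * k * 2 ^ (100 * k) ≤ D) (hV : Balanced G Finset.univ) {R : Finset V}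
    (hRD : D ^ 4 ≤ R.card) (hRV : R.card * D ^ 3 ≤ Fintype.card V) {P₀ P₁ : List V}
    (hp₀ : P₀.Pairwise G) (hp₁ : P₁.Pairwise G) (hl₀ : P₀.length = k) (hl₁ : P₁.length = k)
    (hr₀ : RichOut D G Finset.univ P₀) (hr₁ : RichIn D G Finset.univ P₁) :
    ∃ Z : Finset V, (∀ x ∈ Z, x ∉ R ∧ x ∉ P₀ ∧ x ∉ P₁) ∧ ∀ E ⊆ R,
      ∃ M, PowPath k G (P₀ ++ M ++ P₁) ∧ M.Nodup ∧ ∀ x, x ∈ M ↔ x ∈ Z ∨ x ∈ E := by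
  have hDk := le_of_pow_hundred_le hD
  have hD4 : D ^ 4 = D * D ^ 3 := by ring
  have hD3 : D ^ 3 = D * D ^ 2 := by ring
  have hD2 : 0 < D ^ 2 := Nat.pow_pos (by omega)
  have hDR : D ≤ R.card := le_trans (by nlinarith) hRD
  obtain ⟨U₀, hU₀⟩ : ∃ U₀, U₀ = R ∪ (P₀ ++ P₁).toFinset := ⟨_, rfl⟩
  have hU₀c : U₀.card ≤ R.card + 2 * k := by
    have h1 := Finset.card_union_le R (P₀ ++ P₁).toFinset
    have h2 := List.toFinset_card_le (P₀ ++ P₁)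
    rw [List.length_append] at h2
    rw [hU₀]
    omega
  have hbound : ∀ u, u ≤ 20 * k * R.card → u * D ^ 2 ≤ (Finset.univ : Finset V).card := by
    intro u hu
    have h1 : u ≤ R.card * D := hu.trans (by nlinarith)
    calc u * D ^ 2 ≤ R.card * D * D ^ 2 := Nat.mul_le_mul_right _ h1
      _ = R.card * D ^ 3 := by ring
      _ ≤ _ := hRV
  have hkR : k ≤ k * R.card := Nat.le_mul_of_pos_right _ (by omega)
  have hRk : R.card ≤ k * R.card := Nat.le_mul_of_pos_left _ (by omega)
  have hVD : D ^ 4 ≤ (Finset.univ : Finset V).card := by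
    refine le_trans (hRD.trans ?_) hRV
    exact Nat.le_mul_of_pos_right _ (by rw [hD3]; exact Nat.mul_pos (by omega) hD2)
  obtain ⟨σ, hσ, hσd⟩ := hG.exists_gaps hk hD (U := U₀) hV hVD R (hbound _ (by nlinarith))
  obtain ⟨K, hK⟩ : ∃ K, K = R.biUnion fun v => (σ v).K := ⟨_, rfl⟩
  have hKc : K.card ≤ R.card * (4 * k) := hK ▸
    Finset.card_biUnion_le_card_mul _ _ _ fun v hv => (hσ v hv).2.2.2.1
  have hRU : ∀ x ∈ R, x ∈ U₀ := fun x hx => hU₀ ▸ Finset.mem_union_left _ hx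
  obtain ⟨R₁, -, hR₁, hM⟩ := hG.exists_join hk hD hV hVD hp₁ hr₁ (R.toList.map σ) (U₀ ∪ K) P₀ hp₀
    hr₀ hl₀.ge
    (fun τ hτ => by
      obtain ⟨v, hv, rfl⟩ := List.mem_map.1 hτ
      exact (hσ v (Finset.mem_toList.1 hv)).1)
    (by
      rw [List.pairwise_map]
      refine R.nodup_toList.imp_of_mem fun {v w} hv hw hvw => ?_
      rw [Finset.mem_toList] at hv hw
      rw [(hσ v hv).2.1, (hσ w hw).2.1]
      simp only [Finset.disjoint_union_left, Finset.disjoint_union_right,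
        Finset.disjoint_singleton_left, Finset.disjoint_singleton_right, Finset.mem_union,
        Finset.mem_singleton, not_or]
      exact ⟨⟨hσd v hv w hw hvw, fun h => ((hσ w hw).2.2.2.2 v h).2 (hRU v hv)⟩,
        fun h => ((hσ v hv).2.2.2.2 w h).2 (hRU w hw), hvw.symm⟩)
    (fun τ hτ x hx _ => by
      obtain ⟨v, hv, rfl⟩ := List.mem_map.1 hτ
      rw [Finset.mem_toList] at hv
      rw [(hσ v hv).2.1, Finset.mem_union, Finset.mem_singleton] at hx
      rcases hx with hx | rfl
      · exact Finset.mem_union_right _ (hK ▸ Finset.mem_biUnion.2 ⟨v, hv, hx⟩)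
      · exact Finset.mem_union_left _ (hRU x hv))
    (by
      refine hbound _ ?_
      have := Finset.card_union_le U₀ K
      rw [List.length_map, Finset.length_toList]
      nlinarith)
  have hout : ∀ x, x ∉ U₀ → x ∉ R ∧ x ∉ P₀ ∧ x ∉ P₁ := fun x hx => by
    rw [hU₀] at hx
    simpa [not_or] using hx
  refine ⟨K ∪ R₁, fun x hx => hout x ?_, fun E hE => ?_⟩
  · rcases Finset.mem_union.1 hx with hx | hx
    · obtain ⟨v, hv, hx⟩ := Finset.mem_biUnion.1 (hK ▸ hx)
      exact ((hσ v hv).2.2.2.2 x hx).2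
    · exact fun h => (hR₁ x hx).2 (Finset.mem_union_left _ h)
  · obtain ⟨M, h1, h2, h3⟩ := hM E (fun x hx =>
      ⟨σ x, List.mem_map.2 ⟨x, Finset.mem_toList.2 (hE hx), rfl⟩, by
        rw [(hσ x (hE hx)).2.1]
        exact Finset.mem_singleton_self x⟩)
    refine ⟨M, h1, h2, fun x => ?_⟩
    rw [h3, hK, Finset.mem_union, Finset.mem_biUnion]
    simp [or_assoc]

/-- A power of a path that covers `W`, using some vertices of `R`. -/
theorem IsTourn.exists_cover (hG : IsTourn G) (hk : 2 ≤ k)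
    (hD : 10 ^ 6 * k * 2 ^ (100 * k) ≤ D) {R : Finset V} (hR : Balanced G R)
    (hRD : D ^ 10 ≤ R.card) {W : Finset V} (hW : W.card ≤ 2 * R.card * D ^ 3) (hWR : Disjoint W R)
    {P₀ P₁ : List V} (hp₀ : P₀.Pairwise G) (hp₁ : P₁.Pairwise G) (hl₁ : P₁.length = k)
    (hr₁ : RichOut D G R P₁) (hr₀ : RichIn D G R P₀) :
    ∃ S ⊆ R, ∃ M, PowPath k G (P₁ ++ M ++ P₀) ∧ M.Nodup ∧ ∀ x, x ∈ M ↔ x ∈ W ∨ x ∈ S := by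
  have hDk := le_of_pow_hundred_le hD
  have hDpos : 0 < D := by omega
  have hR4 : D ^ 4 ≤ R.card := (Nat.pow_le_pow_right hDpos (by norm_num)).trans hRD
  obtain ⟨σs, W₀, hW₀W, hW₀c, hlen, hσ, hσd, hcov⟩ := hG.exists_pieces hk hD hR (D ^ 6) W
  have hW₀c' : W₀.card ≤ 3 * D ^ 7 := by
    have h1 : 2 * D * D ^ 6 = 2 * D ^ 7 := by ring
    have h2 : D ≤ D ^ 7 := Nat.le_self_pow (by norm_num) D
    omega
  have hR' : 1000000 * k * D ^ 7 * D ^ 2 ≤ R.card := by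
    refine le_trans ?_ hRD
    calc 1000000 * k * D ^ 7 * D ^ 2 ≤ D * D ^ 7 * D ^ 2 := by gcongr; simpa using hDk
      _ = D ^ 10 := by ring
  have hσlen : 1000000 * k * σs.length * D ^ 2 ≤ 2 * R.card := by
    have h1 : σs.length * D ^ 3 * D ^ 3 ≤ 2 * R.card * D ^ 3 := by
      refine le_trans (le_of_eq ?_) (hlen.trans hW)
      ring
    have h2 := Nat.le_of_mul_le_mul_right h1 (by positivity)
    refine le_trans ?_ h2
    calc 1000000 * k * σs.length * D ^ 2 ≤ D * σs.length * D ^ 2 := by gcongr; simpa using hDk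
      _ = σs.length * D ^ 3 := by ring
  have hk7 : k * W₀.card * D ^ 2 ≤ k * (3 * D ^ 7) * D ^ 2 := by gcongr
  obtain ⟨τ, hτ, hτd⟩ := hG.exists_gaps hk hD (U := ∅) hR hR4 W₀ (by
    rw [Finset.card_empty]
    nlinarith)
  obtain ⟨U, hU⟩ : ∃ U, U = W₀.biUnion fun v => (τ v).K := ⟨_, rfl⟩
  have hUc : U.card ≤ W₀.card * (4 * k) := hU ▸
    Finset.card_biUnion_le_card_mul _ _ _ fun v hv => (hτ v hv).2.2.2.1
  have hUR : U ⊆ R := fun x hx => by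
    obtain ⟨v, hv, hx⟩ := Finset.mem_biUnion.1 (hU ▸ hx)
    exact ((hτ v hv).2.2.2.2 x hx).1
  have hWR' : ∀ x ∈ W, x ∉ R := fun x hx hx' => Finset.disjoint_left.1 hWR hx hx'
  obtain ⟨τ', hτ'⟩ : ∃ τ' : V → Seg V, ∀ v, τ' v = ⟨insert v (τ v).K, ∅, (τ v).A, (τ v).B⟩ :=
    ⟨_, fun _ => rfl⟩
  obtain ⟨R₂, -, hR₂, hM⟩ := hG.exists_join hk hD hR hR4 hp₀ hr₀ (σs ++ W₀.toList.map τ') U P₁ hp₁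
    hr₁ hl₁.ge
    (fun ρ hρ => by
      rcases List.mem_append.1 hρ with hρ | hρ
      · exact (hσ ρ hρ).1
      · obtain ⟨v, hv, rfl⟩ := List.mem_map.1 hρ
        have := hτ v (Finset.mem_toList.1 hv)
        exact hτ' v ▸ this.1.absorb this.2.1)
    (by
      refine List.pairwise_append.2 ⟨hσd.imp_of_mem fun {ρ ρ'} h h' hd => ?_, ?_, ?_⟩
      · rwa [(hσ ρ h).2.1, (hσ ρ' h').2.1, Finset.union_empty, Finset.union_empty]
      · rw [List.pairwise_map]
        refine W₀.nodup_toList.imp_of_mem fun {v w} hv hw hvw => ?_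
        rw [Finset.mem_toList] at hv hw
        rw [hτ', hτ']
        simp only [Finset.union_empty, Finset.disjoint_insert_left, Finset.disjoint_insert_right,
          Finset.mem_insert, not_or]
        exact ⟨⟨hvw.symm, fun h => hWR' w (hW₀W hw) ((hτ v hv).2.2.2.2 w h).1⟩,
          fun h => hWR' v (hW₀W hv) ((hτ w hw).2.2.2.2 v h).1, hτd v hv w hw hvw⟩
      · intro ρ hρ ρ' hρ'
        obtain ⟨v, hv, rfl⟩ := List.mem_map.1 hρ'
        rw [Finset.mem_toList] at hv
        obtain ⟨-, hF, hKW, hd⟩ := hσ ρ hρ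
        rw [hτ', hF]
        simp only [Finset.union_empty, Finset.disjoint_insert_right]
        exact ⟨fun h => Finset.disjoint_left.1 hd h hv, Finset.disjoint_left.2 fun x hx hx' =>
          hWR' x (hKW hx) ((hτ v hv).2.2.2.2 x hx').1⟩)
    (fun ρ hρ x hx hxR => by
      rcases List.mem_append.1 hρ with hρ | hρ
      · obtain ⟨-, hF, hKW, -⟩ := hσ ρ hρ
        rw [hF, Finset.union_empty] at hx
        exact absurd hxR (hWR' x (hKW hx))
      · obtain ⟨v, hv, rfl⟩ := List.mem_map.1 hρ
        rw [Finset.mem_toList] at hv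
        rw [hτ', Finset.union_empty, Finset.mem_insert] at hx
        rcases hx with rfl | hx
        · exact absurd hxR (hWR' x (hW₀W hv))
        · exact hU ▸ Finset.mem_biUnion.2 ⟨v, hv, hx⟩)
    (by
      rw [List.length_append, List.length_map, Finset.length_toList]
      have h1 : k * D ^ 2 ≤ k * D ^ 7 * D ^ 2 := by
        have : 1 ≤ D ^ 7 := Nat.one_le_pow _ _ hDpos
        nlinarith [Nat.mul_le_mul_left (k * D ^ 2) this]
      have h2 := Nat.mul_le_mul_right (D ^ 2) hUc
      nlinarith)
  obtain ⟨M, h1, h2, h3⟩ := hM ∅ (by simp)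
  refine ⟨U ∪ R₂, Finset.union_subset hUR fun x hx => (hR₂ x hx).1, M, h1, h2, fun x => ?_⟩
  rw [h3, Finset.mem_union]
  constructor
  · rintro (⟨ρ, hρ, hx⟩ | hx | hx)
    · rcases List.mem_append.1 hρ with hρ | hρ
      · exact Or.inl ((hσ ρ hρ).2.2.1 hx)
      · obtain ⟨v, hv, rfl⟩ := List.mem_map.1 hρ
        rw [Finset.mem_toList] at hv
        rw [hτ', Finset.mem_insert] at hx
        rcases hx with rfl | hx
        · exact Or.inl (hW₀W hv)
        · exact Or.inr (Or.inl (hU ▸ Finset.mem_biUnion.2 ⟨v, hv, hx⟩))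
    · exact Or.inr (Or.inr hx)
    · simp at hx
  · have hin : ∀ v ∈ W₀, ∀ x ∈ insert v (τ v).K, ∃ ρ ∈ σs ++ W₀.toList.map τ', x ∈ ρ.K :=
      fun v hv x hx => ⟨τ' v, List.mem_append_right _ (List.mem_map.2
        ⟨v, Finset.mem_toList.2 hv, rfl⟩), by rw [hτ']; exact hx⟩
    rintro (hx | hx | hx)
    · rcases hcov x hx with hx | ⟨ρ, hρ, hx⟩
      · exact Or.inl (hin x hx x (Finset.mem_insert_self _ _))
      · exact Or.inl ⟨ρ, List.mem_append_left _ hρ, hx⟩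
    · obtain ⟨v, hv, hx⟩ := Finset.mem_biUnion.1 (hU ▸ hx)
      exact Or.inl (hin v hv x (Finset.mem_insert_of_mem hx))
    · exact Or.inr (Or.inl hx)

/-- A balanced tournament with a balanced reservoir contains the `k`-th power of a Hamilton
cycle. -/
theorem IsTourn.exists_powHamCycle [Fintype V] (hG : IsTourn G) (hk : 2 ≤ k)
    (hD : 10 ^ 6 * k * 2 ^ (100 * k) ≤ D) (hV : Balanced G Finset.univ) {R : Finset V}
    (hR : Balanced G R) (hRD : D ^ 10 ≤ R.card) (hRV : R.card * D ^ 3 ≤ Fintype.card V)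
    (hVR : Fintype.card V ≤ 2 * R.card * D ^ 3) :
    ∃ C : List V, C.Nodup ∧ (∀ x, x ∈ C) ∧ k ≤ C.length ∧ PowPath k G (C ++ C.take k) := by
  have hDk := le_of_pow_hundred_le hD
  have hDpos : 0 < D := by omega
  have hR4 : D ^ 4 ≤ R.card := (Nat.pow_le_pow_right hDpos (by norm_num)).trans hRD
  have hDR : D ≤ R.card := (Nat.le_self_pow (by norm_num) D).trans hR4
  obtain ⟨X, hXl, hXp, hXm⟩ := hG.exists_transitive (72 * k) Rᶜ (by
    have h1 : 2 ^ (72 * k) ≤ D := by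
      refine le_trans ?_ hD
      rw [← one_mul (2 ^ (72 * k))]
      exact Nat.mul_le_mul (by omega) (Nat.pow_le_pow_right (by norm_num) (by omega))
    have h2 : 2 ≤ D ^ 3 := le_trans (by omega) (Nat.le_self_pow (by norm_num) D)
    have h3 := Nat.mul_le_mul_left R.card h2
    rw [Finset.card_compl]
    omega)
  obtain ⟨P₀, hs₀, hl₀, hi₀, ho₀⟩ := exists_sublist_richIn_richOut (by omega) hD hR hV
    (X := X.take (36 * k)) (by simp; omega)
  obtain ⟨P₁, hs₁, hl₁, hi₁, ho₁⟩ := exists_sublist_richIn_richOut (by omega) hD hV hR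
    (X := X.drop (36 * k)) (by simp; omega)
  have hP : (P₀ ++ P₁).Pairwise G := by
    refine hXp.sublist ?_
    rw [← List.take_append_drop (36 * k) X]
    exact hs₀.append hs₁
  have hP₀ : ∀ x ∈ P₀, x ∉ R := fun x hx =>
    Finset.mem_compl.1 (hXm x (List.mem_of_mem_take (hs₀.subset hx)))
  have hP₁ : ∀ x ∈ P₁, x ∉ R := fun x hx =>
    Finset.mem_compl.1 (hXm x (List.mem_of_mem_drop (hs₁.subset hx)))
  obtain ⟨hp₀, hp₁, -⟩ := List.pairwise_append.1 hP
  have hPd : ∀ x ∈ P₀, x ∉ P₁ := fun x hx hx' =>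
    List.disjoint_of_nodup_append (hG.nodup hP) hx hx'
  obtain ⟨Z, hZ, habs⟩ := hG.exists_absorber hk hD hV hR4 hRV hp₀ hp₁ hl₀ hl₁ ho₀ hi₁
  obtain ⟨W, hW⟩ : ∃ W : Finset V, ∀ x, x ∈ W ↔ x ∉ R ∧ x ∉ P₀ ∧ x ∉ P₁ ∧ x ∉ Z :=
    ⟨Finset.univ \ (R ∪ P₀.toFinset ∪ P₁.toFinset ∪ Z), fun x => by simp [not_or]⟩
  obtain ⟨S, hSR, M', hp', hn', hm'⟩ := hG.exists_cover hk hD hR hRD (W := W)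
    ((Finset.card_le_univ W).trans hVR)
    (Finset.disjoint_left.2 fun x hx => ((hW x).1 hx).1) hp₀ hp₁ hl₁ ho₁ hi₀
  obtain ⟨M, hp, hn, hm⟩ := habs (R \ S) Finset.sdiff_subset
  have htake : (P₀ ++ (M ++ (P₁ ++ M'))).take k = P₀ := by
    rw [← hl₀, List.take_left]
  have hmemM : ∀ x ∈ M, x ∉ P₀ ∧ x ∉ P₁ := fun x hx => by
    rcases (hm x).1 hx with h | h
    · exact (hZ x h).2
    · have := (Finset.mem_sdiff.1 h).1
      exact ⟨fun h' => hP₀ x h' this, fun h' => hP₁ x h' this⟩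
  have hmemM' : ∀ x ∈ M', x ∉ P₀ ∧ x ∉ P₁ ∧ x ∉ M := fun x hx => by
    rw [hm, Finset.mem_sdiff]
    rcases (hm' x).1 hx with h | h
    · obtain ⟨h1, h2, h3, h4⟩ := (hW x).1 h
      exact ⟨h2, h3, fun h' => h'.elim h4 fun h' => h1 h'.1⟩
    · have hxR := hSR h
      exact ⟨fun h' => hP₀ x h' hxR, fun h' => hP₁ x h' hxR,
        fun h' => h'.elim (fun h' => (hZ x h').1 hxR) fun h' => h'.2 h⟩
  refine ⟨P₀ ++ (M ++ (P₁ ++ M')), ?_, fun x => ?_, by simp; omega, ?_⟩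
  · simp only [List.nodup_append']
    refine ⟨hG.nodup hp₀, ⟨hn, ⟨hG.nodup hp₁, hn', fun x hx hx' => (hmemM' x hx').2.1 hx⟩, ?_⟩, ?_⟩
    · intro x hx hx'
      rcases List.mem_append.1 hx' with hx' | hx'
      · exact (hmemM x hx).2 hx'
      · exact (hmemM' x hx').2.2 hx
    · intro x hx hx'
      rcases List.mem_append.1 hx' with hx' | hx'
      · exact (hmemM x hx').1 hx
      · rcases List.mem_append.1 hx' with hx' | hx'
        · exact hPd x hx hx'
        · exact (hmemM' x hx').1 hx
  · simp only [List.mem_append, hm, hm', hW, Finset.mem_sdiff]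
    tauto
  · rw [htake]
    have := PowPath.glue (P := P₀ ++ M) (X := P₁) (Y := M' ++ P₀) hp
      (by simpa only [List.append_assoc] using hp') hl₁.ge
    simpa only [List.append_assoc] using this

end Assembly

section Sampling

variable {X ι : Type*} [Fintype X] [Fintype ι] [DecidableEq ι]

/-- Fixing one coordinate does not matter for a property that is independent of it. -/
theorem card_filter_indep_le [Nonempty X] (a : ι) (P : X → (ι → X) → Prop)
    [∀ x, DecidablePred (P x)] (hP : ∀ x u y, P x u → P x (Function.update u a y)) (C : ℝ)
    (hC : ∀ x, ((Finset.univ.filter (P x)).card : ℝ) ≤ C) :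
    ((Finset.univ.filter fun u : ι → X => P (u a) u).card : ℝ) ≤ C := by
  have h1 : (Finset.univ : Finset X).card * (Finset.univ.filter fun u : ι → X => P (u a) u).card ≤
      ∑ x : X, (Finset.univ.filter (P x)).card := by
    rw [← Finset.card_product, ← Finset.card_sigma]
    refine Finset.card_le_card_of_injOn
      (fun p => ⟨p.2 a, Function.update p.2 a p.1⟩) (fun p hp => ?_) ?_
    · simp only [Finset.coe_product, Finset.coe_univ, Finset.coe_filter, Finset.mem_univ,
        true_and, Set.mem_prod, Set.mem_univ, Set.mem_ofPred_eq] at hp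
      simp only [Finset.coe_sigma, Finset.coe_univ, Finset.coe_filter, Finset.mem_univ, true_and,
        Set.mem_sigma_iff, Set.mem_univ, Set.mem_ofPred_eq]
      exact hP _ _ _ hp
    · rintro ⟨y, u⟩ - ⟨y', u'⟩ - h
      simp only [Sigma.mk.injEq, heq_eq_eq] at h
      obtain ⟨h1, h2⟩ := h
      have h3 := congrFun h2 a
      simp only [Function.update_self] at h3
      refine Prod.ext h3 (funext fun i => ?_)
      by_cases hi : i = a
      · exact hi ▸ h1
      · simpa [Function.update_of_ne hi] using congrFun h2 i
  have h2 : (Fintype.card X : ℝ) * ((Finset.univ.filter fun u : ι → X => P (u a) u).card : ℝ) ≤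
      Fintype.card X * C := by
    have h3 : ((∑ x : X, (Finset.univ.filter (P x)).card : ℕ) : ℝ) ≤ Fintype.card X * C := by
      push_cast
      refine (Finset.sum_le_card_nsmul _ _ C fun x _ => hC x).trans ?_
      simp
    refine le_trans ?_ h3
    exact_mod_cast h1
  exact le_of_mul_le_mul_left h2 (by exact_mod_cast Fintype.card_pos)

theorem card_filter_coord_le [DecidableEq X] [Nonempty X] (a : ι) (A : Finset X) (c : ℝ)
    (hA : (A.card : ℝ) ≤ c * Fintype.card X) :
    ((Finset.univ.filter fun u : ι → X => u a ∈ A).card : ℝ) ≤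
      c * (Fintype.card X : ℝ) ^ Fintype.card ι := by
  have h1 : (Finset.univ : Finset X).card * (Finset.univ.filter fun u : ι → X => u a ∈ A).card ≤
      A.card * (Finset.univ : Finset (ι → X)).card := by
    rw [← Finset.card_product, ← Finset.card_product]
    refine Finset.card_le_card_of_injOn
      (fun p => (p.2 a, Function.update p.2 a p.1)) (fun p hp => ?_) ?_
    · simpa using hp
    · rintro ⟨y, u⟩ - ⟨y', u'⟩ - h
      simp only [Prod.mk.injEq] at h
      obtain ⟨h1, h2⟩ := h
      have h3 := congrFun h2 a
      simp only [Function.update_self] at h3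
      refine Prod.ext h3 (funext fun i => ?_)
      by_cases hi : i = a
      · exact hi ▸ h1
      · simpa [Function.update_of_ne hi] using congrFun h2 i
  have hpos : (0 : ℝ) < Fintype.card X := by exact_mod_cast Fintype.card_pos
  refine le_of_mul_le_mul_left (a := (Fintype.card X : ℝ)) ?_ hpos
  have h2 : (Fintype.card X : ℝ) * ((Finset.univ.filter fun u : ι → X => u a ∈ A).card : ℝ) ≤
      A.card * (Fintype.card X : ℝ) ^ Fintype.card ι := by
    have : Fintype.card X * (Finset.univ.filter fun u : ι → X => u a ∈ A).card ≤
        A.card * Fintype.card X ^ Fintype.card ι := by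
      simpa using h1
    exact_mod_cast this
  refine h2.trans ?_
  have h4 : (0 : ℝ) ≤ (Fintype.card X : ℝ) ^ Fintype.card ι := by positivity
  nlinarith [mul_le_mul_of_nonneg_right hA h4]

/-- Chernoff-type bound: few tuples hit a set of density `0.49` in less than 46% of the
coordinates in `J`. -/
theorem card_filter_few_hits_le [DecidableEq X] (J : Finset ι) (A : Finset X)
    (hA : 49 / 100 * (Fintype.card X : ℝ) ≤ A.card) :
    ((Finset.univ.filter fun u : ι → X => 100 * (J.filter fun j => u j ∈ A).card < 46 * J.card).card
      : ℝ) ≤ (999 / 1000) ^ J.card * (Fintype.card X : ℝ) ^ Fintype.card ι := by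
  obtain ⟨s, hs⟩ : ∃ s : ℝ, s = 999 / 1000 := ⟨_, rfl⟩
  have hs0 : 0 < s := by rw [hs]; norm_num
  have hs1 : s ≤ 1 := by rw [hs]; norm_num
  have hbase : (51 + 49 * s ^ 100) / 100 ≤ s * s ^ 46 := by rw [hs]; norm_num
  obtain ⟨g, hg⟩ : ∃ g : ι → X → ℝ, ∀ j x, g j x =
      if j ∈ J then (if x ∈ A then s ^ 100 else 1) else 1 := ⟨_, fun _ _ => rfl⟩
  have hprod : ∀ u : ι → X, ∏ j, g j (u j) = s ^ (100 * (J.filter fun j => u j ∈ A).card) := by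
    intro u
    simp only [hg]
    rw [Finset.prod_ite_mem, Finset.univ_inter, ← Finset.prod_filter, Finset.prod_const, pow_mul]
  have hsum : ∑ u : ι → X, ∏ j, g j (u j) = ∏ j, ∑ x, g j x := by
    rw [Finset.prod_univ_sum, Fintype.piFinset_univ]
  have hcoord : ∀ j, ∑ x, g j x ≤ (if j ∈ J then s * s ^ 46 else 1) * Fintype.card X := by
    intro j
    simp only [hg]
    split_ifs with hj
    · have h1 : ∑ x : X, (if x ∈ A then s ^ 100 else 1) =
          Fintype.card X - A.card * (1 - s ^ 100) := by
        have : ∀ x : X, (if x ∈ A then s ^ 100 else (1 : ℝ)) =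
            1 - if x ∈ A then 1 - s ^ 100 else 0 := fun x => by split_ifs <;> ring
        simp only [this, Finset.sum_sub_distrib, Finset.sum_ite_mem, Finset.univ_inter]
        simp only [Finset.sum_const, Finset.card_univ, nsmul_eq_mul, mul_one]
        ring
      rw [h1]
      have h2 : 0 ≤ 1 - s ^ 100 := sub_nonneg.2 (pow_le_one₀ hs0.le hs1)
      have h3 : (0 : ℝ) ≤ Fintype.card X := by positivity
      nlinarith [mul_le_mul_of_nonneg_right hA h2, mul_le_mul_of_nonneg_right hbase h3]
    · simp
  have hnn : ∀ j, 0 ≤ ∑ x, g j x := fun j => Finset.sum_nonneg fun x _ => by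
    rw [hg]
    split_ifs <;> positivity
  have htot : ∏ j, ∑ x, g j x ≤ (s * s ^ 46) ^ J.card * (Fintype.card X : ℝ) ^ Fintype.card ι := by
    refine (Finset.prod_le_prod (fun j _ => hnn j) fun j _ => hcoord j).trans (le_of_eq ?_)
    rw [Finset.prod_mul_distrib, Finset.prod_ite_mem, Finset.univ_inter, Finset.prod_const,
      Finset.prod_const, Finset.card_univ]
  have hlow : ((Finset.univ.filter fun u : ι → X =>
      100 * (J.filter fun j => u j ∈ A).card < 46 * J.card).card : ℝ) * s ^ (46 * J.card) ≤
      ∑ u : ι → X, ∏ j, g j (u j) := by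
    rw [← nsmul_eq_mul]
    refine (Finset.card_nsmul_le_sum _ (fun u => ∏ j, g j (u j)) _ fun u hu => ?_).trans
      (Finset.sum_le_sum_of_subset_of_nonneg (Finset.filter_subset _ _) fun u _ _ => ?_)
    · rw [hprod]
      exact pow_le_pow_of_le_one hs0.le hs1 (Finset.mem_filter.1 hu).2.le
    · rw [hprod]
      positivity
  rw [hsum] at hlow
  have hfin := hlow.trans htot
  rw [← hs]
  refine le_of_mul_le_mul_right (hfin.trans (le_of_eq ?_)) (pow_pos hs0 (46 * J.card))
  rw [mul_pow, pow_mul]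
  ring

end Sampling

section Events

variable {X ι α β : Type*} [Fintype X] [DecidableEq X] [Fintype ι] [DecidableEq ι] [Fintype α]

theorem card_filter_exists_le [Fintype β] (E : β → α → Prop) [∀ b, DecidablePred (E b)]
    [DecidablePred fun u => ∃ b, E b u] (C : ℝ)
    (h : ∀ b, ((Finset.univ.filter (E b)).card : ℝ) ≤ C) :
    ((Finset.univ.filter fun u => ∃ b, E b u).card : ℝ) ≤ Fintype.card β * C := by
  classical
  have h1 : (Finset.univ.filter fun u => ∃ b, E b u) ⊆
      Finset.univ.biUnion fun b => Finset.univ.filter (E b) := by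
    intro u hu
    simpa using hu
  have h2 : ((Finset.univ.filter fun u => ∃ b, E b u).card : ℝ) ≤
      ∑ b, ((Finset.univ.filter (E b)).card : ℝ) := by
    exact_mod_cast (Finset.card_le_card h1).trans Finset.card_biUnion_le
  refine h2.trans ((Finset.sum_le_card_nsmul _ _ C fun b _ => h b).trans ?_)
  simp

/-- Some two entries of `u`, or `v` and an entry of `u`, are related by `H`. -/
def HasPair (H : X → X → Prop) (v : X) (u : ι → X) : Prop :=
  (∃ j, H v (u j)) ∨ ∃ p : ι × ι, p.1 ≠ p.2 ∧ H (u p.1) (u p.2)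

/-- Some entry of `u`, or `v`, has `H`-neighbours at less than 46% of the other indices in `J`. -/
def LowDegree (H : X → X → Prop) [DecidableRel H] (J : Finset ι) (v : X) (u : ι → X) : Prop :=
  100 * (J.filter fun j => H v (u j)).card < 46 * J.card ∨
    ∃ a, 100 * ((J.erase a).filter fun j => H (u a) (u j)).card < 46 * (J.erase a).card

/-- Few tuples contain a pair related by a sparse relation, even after prepending `v`. -/
theorem card_filter_sparse_le [Nonempty X] (H : X → X → Prop) [DecidableRel H] (v : X)
    [DecidablePred (HasPair (ι := ι) H v)] (c : ℝ)
    (hc : ∀ x, ((Finset.univ.filter (H x)).card : ℝ) ≤ c * Fintype.card X) :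
    ((Finset.univ.filter (HasPair (ι := ι) H v)).card : ℝ) ≤
      Fintype.card ι * (Fintype.card ι + 1) * (c * (Fintype.card X : ℝ) ^ Fintype.card ι) := by
  have hx : ∀ x (j : ι), ((Finset.univ.filter fun u : ι → X => H x (u j)).card : ℝ) ≤
      c * (Fintype.card X : ℝ) ^ Fintype.card ι := fun x j => by
    simpa using card_filter_coord_le j (Finset.univ.filter (H x)) c (hc x)
  have h1 := card_filter_exists_le (fun (j : ι) (u : ι → X) => H v (u j)) _ (hx v)
  have h2 := card_filter_exists_le
    (fun (p : ι × ι) (u : ι → X) => p.1 ≠ p.2 ∧ H (u p.1) (u p.2))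
    (c * (Fintype.card X : ℝ) ^ Fintype.card ι) fun p =>
    card_filter_indep_le p.1 (fun x u => p.1 ≠ p.2 ∧ H x (u p.2))
      (fun x u y h => ⟨h.1, by rw [Function.update_of_ne h.1.symm]; exact h.2⟩) _ fun x =>
        le_trans (by
          refine Nat.cast_le.2 (Finset.card_le_card fun u hu => ?_)
          simp only [Finset.mem_filter, Finset.mem_univ, true_and] at hu ⊢
          exact hu.2) (hx x p.2)
  refine le_trans ?_ ((add_le_add h1 h2).trans (le_of_eq ?_))
  · exact_mod_cast (Finset.card_le_card fun u hu => by
      simpa [HasPair] using hu).trans (Finset.card_union_le _ _)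
  rw [Fintype.card_prod]
  push_cast
  ring

/-- Few tuples have an entry, or the prepended `v`, with too few `H`-neighbours among the entries
indexed by `J`. -/
theorem card_filter_lowDegree_le [Nonempty X] (H : X → X → Prop) [DecidableRel H] (v : X)
    (hH : ∀ x, 49 / 100 * (Fintype.card X : ℝ) ≤ (Finset.univ.filter (H x)).card)
    (J : Finset ι) [DecidablePred (LowDegree H J v)] :
    ((Finset.univ.filter (LowDegree H J v)).card : ℝ) ≤ (Fintype.card ι + 1) *
          ((999 / 1000) ^ (J.card - 1) * (Fintype.card X : ℝ) ^ Fintype.card ι) := by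
  have hx : ∀ x (I : Finset ι), J.card - 1 ≤ I.card → ((Finset.univ.filter fun u : ι → X =>
      100 * (I.filter fun j => H x (u j)).card < 46 * I.card).card : ℝ) ≤
      (999 / 1000) ^ (J.card - 1) * (Fintype.card X : ℝ) ^ Fintype.card ι := fun x I hI => by
    have := card_filter_few_hits_le I (Finset.univ.filter (H x)) (hH x)
    simp only [Finset.mem_filter, Finset.mem_univ, true_and] at this
    refine this.trans (mul_le_mul_of_nonneg_right ?_ (by positivity))
    exact pow_le_pow_of_le_one (by norm_num) (by norm_num) hI
  have h2 := card_filter_exists_le (fun (a : ι) (u : ι → X) =>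
      100 * ((J.erase a).filter fun j => H (u a) (u j)).card < 46 * (J.erase a).card) _ fun a =>
    card_filter_indep_le a (fun x u =>
      100 * ((J.erase a).filter fun j => H x (u j)).card < 46 * (J.erase a).card)
      (fun x u y h => by
        have : ((J.erase a).filter fun j => H x (Function.update u a y j)) =
            (J.erase a).filter fun j => H x (u j) := by
          refine Finset.filter_congr fun j hj => ?_
          rw [Function.update_of_ne (Finset.ne_of_mem_erase hj)]
        rwa [this]) _ fun x => hx x _ Finset.pred_card_le_card_erase
  refine le_trans ?_ ((add_le_add (hx v J (Nat.sub_le _ _)) h2).trans (le_of_eq ?_))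
  · exact_mod_cast (Finset.card_le_card fun u hu => by
      simpa [LowDegree] using hu).trans (Finset.card_union_le _ _)
  ring

end Events

section GoodParts

variable {n k : ℕ} {G : Fin n → Fin n → Prop}

/-- `S` has `q` elements and induces a tournament of large minimum semi-degree that contains the
`k`-th power of a Hamilton cycle. -/
def IsGoodPart (k q : ℕ) (G : Fin n → Fin n → Prop) (S : Finset (Fin n)) : Prop :=
  S.card = q ∧ (∀ x ∈ S, ∀ y ∈ S, x ≠ y → G x y ∨ G y x) ∧
    (∀ x ∈ S, 2 * (S.card : ℝ) / 5 ≤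
      ((min ({w | w ∈ S ∧ G x w} : Set (Fin n)).ncard
        ({w | w ∈ S ∧ G w x} : Set (Fin n)).ncard : ℕ) : ℝ)) ∧
    HasPowHamCycleOn k G S

theorem isGoodPart_image [DecidableRel G] {q D : ℕ} (hG : IsOriented G) (hk : 2 ≤ k)
    (hD : 10 ^ 6 * k * 2 ^ (100 * k) ≤ D) (w : Fin q → Fin n)
    (hadj : ∀ i j, i ≠ j → G (w i) (w j) ∨ G (w j) (w i)) {R : Finset (Fin q)}
    (hV : Balanced (fun i j => G (w i) (w j)) Finset.univ)
    (hR : Balanced (fun i j => G (w i) (w j)) R) (hRD : D ^ 10 ≤ R.card)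
    (hRV : R.card * D ^ 3 ≤ q) (hVR : q ≤ 2 * R.card * D ^ 3) :
    IsGoodPart k q G (Finset.univ.image w) := by
  have hw : Function.Injective w := by
    intro i j hij
    by_contra hne
    have := hadj i j hne
    rw [hij, or_self] at this
    exact hG _ _ this this
  have hcard : (Finset.univ.image w).card = q := by
    rw [Finset.card_image_of_injective _ hw, Finset.card_univ, Fintype.card_fin]
  have htourn : IsTourn fun i j => G (w i) (w j) := ⟨fun i j h => hG _ _ h, hadj⟩
  obtain ⟨C, hCn, hCm, hkC, hCp⟩ := htourn.exists_powHamCycle hk hD hV hR hRD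
    (by simpa using hRV) (by simpa using hVR)
  have hCl : C.length = q := by
    rw [← List.toFinset_card_of_nodup hCn,
      Finset.eq_univ_of_forall fun x => List.mem_toFinset.2 (hCm x), Finset.card_univ,
      Fintype.card_fin]
  have hncard : ∀ (H : Fin n → Prop) [DecidablePred H],
      45 * q ≤ 100 * (Finset.univ.filter fun j => H (w j)).card →
      2 * q ≤ 5 * ({y | y ∈ Finset.univ.image w ∧ H y} : Set (Fin n)).ncard := by
    intro H _ h
    have h1 : ({y | y ∈ Finset.univ.image w ∧ H y} : Set (Fin n)) =
        ((Finset.univ.filter fun j => H (w j)).image w : Finset (Fin n)) := by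
      ext y
      simp only [Finset.mem_image, Finset.mem_univ, true_and, Set.mem_ofPred_eq, Finset.coe_image,
        Finset.coe_filter, Set.mem_image]
      constructor
      · rintro ⟨⟨i, rfl⟩, h⟩
        exact ⟨i, h, rfl⟩
      · rintro ⟨i, h, rfl⟩
        exact ⟨⟨i, rfl⟩, h⟩
    rw [h1, Set.ncard_coe_finset, Finset.card_image_of_injective _ hw]
    omega
  refine ⟨hcard, ?_, ?_, ?_⟩
  · simp only [Finset.mem_image, Finset.mem_univ, true_and]
    rintro _ ⟨i, rfl⟩ _ ⟨j, rfl⟩ hne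
    exact hadj i j fun h => hne (h ▸ rfl)
  · intro x hx
    obtain ⟨i, -, rfl⟩ := Finset.mem_image.1 hx
    obtain ⟨h1, h2⟩ := hV i
    rw [Finset.card_univ, Fintype.card_fin] at h1 h2
    have h3 := hncard (G (w i)) h1
    have h4 := hncard (fun y => G y (w i)) h2
    rw [hcard, div_le_iff₀ (by norm_num)]
    have h5 : 2 * q ≤ min ({y | y ∈ Finset.univ.image w ∧ G (w i) y} : Set (Fin n)).ncard
        ({y | y ∈ Finset.univ.image w ∧ G y (w i)} : Set (Fin n)).ncard * 5 := by omega
    exact_mod_cast h5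
  · have hlen : C.length = (Finset.univ.image w).card := hCl.trans hcard.symm
    refine ⟨fun i => w (C[(i : ℕ)]'(i.2.trans_eq hlen.symm)), fun i j hij => ?_, fun i => ?_,
      fun i j hj hjk => ?_⟩
    · exact Fin.ext ((hCn.getElem_inj_iff).1 (hw hij))
    · exact Finset.mem_image_of_mem _ (Finset.mem_univ _)
    · have := hCp.cyclic hkC (i := i) (i.2.trans_eq hlen.symm) hj hjk
      simpa only [hlen] using this

/-- Degrees of at least 46% into the sampled entries make the whole sample balanced. -/
theorem balanced_cons {m : ℕ} {H : Fin n → Fin n → Prop} [DecidableRel H] {v : Fin n}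
    {u : Fin m → Fin n} {J : Finset (Fin m)} {I : Finset (Fin (m + 1))}
    (hJI : ∀ j ∈ J, j.succ ∈ I) (hI : I.card ≤ J.card + 1) (hJ : 100 ≤ J.card)
    (h : ¬ LowDegree H J v u) (i : Fin (m + 1)) :
    45 * I.card ≤ 100 * (I.filter fun j => H ((Fin.cons v u : Fin (m + 1) → Fin n) i)
      ((Fin.cons v u : Fin (m + 1) → Fin n) j)).card := by
  rw [LowDegree] at h
  push Not at h
  obtain ⟨h1, h2⟩ := h
  have key : ∀ x, (J.filter fun j => H x (u j)).card ≤
      (I.filter fun j => H x ((Fin.cons v u : Fin (m + 1) → Fin n) j)).card := by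
    intro x
    refine Finset.card_le_card_of_injOn Fin.succ (fun j hj => ?_) (Fin.succ_injective _).injOn
    simp only [Finset.coe_filter, Set.mem_ofPred_eq, Fin.cons_succ] at hj ⊢
    exact ⟨hJI j hj.1, hj.2⟩
  refine Fin.cases ?_ (fun a => ?_) i
  · rw [Fin.cons_zero]
    have := key v
    omega
  · rw [Fin.cons_succ]
    have h3 := key (u a)
    have h4 := h2 a
    have h5 : ((J.erase a).filter fun j => H (u a) (u j)).card ≤
      (J.filter fun j => H (u a) (u j)).card :=
      Finset.card_le_card (Finset.filter_subset_filter _ (Finset.erase_subset _ _))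
    have h6 : J.card - 1 ≤ (J.erase a).card := Finset.pred_card_le_card_erase
    omega

theorem card_bad_le [DecidableRel G] {m D r : ℕ} {ε : ℝ} (hG : IsOriented G) (hk : 2 ≤ k)
    (hD : 10 ^ 6 * k * 2 ^ (100 * k) ≤ D) (hε : ε ≤ 1 / 100)
    (hout : ∀ x, (1 / 2 - ε) * n ≤ (Finset.univ.filter (G x)).card)
    (hin : ∀ x, (1 / 2 - ε) * n ≤ (Finset.univ.filter fun y => G y x).card)
    (hrD : D ^ 10 ≤ r) (hrm : r * D ^ 3 ≤ m + 1) (hmr : m + 1 ≤ 2 * r * D ^ 3) (hr : 100 ≤ r)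
    (hrm' : r ≤ m) (v : Fin n) [DecidablePred fun u : Fin m → Fin n =>
      ¬ IsGoodPart k (m + 1) G (Finset.univ.image (Fin.cons v u : Fin (m + 1) → Fin n))] :
    ((Finset.univ.filter fun u : Fin m → Fin n =>
      ¬ IsGoodPart k (m + 1) G (Finset.univ.image (Fin.cons v u : Fin (m + 1) → Fin n))).card : ℝ) ≤
      (m * (m + 1) * (2 * ε) + 4 * (m + 1) * (999 / 1000) ^ (r - 1)) * (n : ℝ) ^ m := by
  classical
  have : Nonempty (Fin n) := ⟨v⟩
  have hn : (0 : ℝ) ≤ n := by positivity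
  obtain ⟨R, hR⟩ : ∃ R : Finset (Fin m), R.card = r := by
    obtain ⟨R, -, hR⟩ := Finset.exists_subset_card_eq
      (show r ≤ (Finset.univ : Finset (Fin m)).card by simpa using hrm')
    exact ⟨R, hR⟩
  have hsp := card_filter_sparse_le (ι := Fin m)
    (fun x y => ¬ G x y ∧ ¬ G y x) v (2 * ε) fun x => by
    have h1 : (Finset.univ.filter fun y => ¬ G x y ∧ ¬ G y x).card +
        ((Finset.univ.filter (G x)).card + (Finset.univ.filter fun y => G y x).card) = n := by
      rw [← Finset.card_union_of_disjoint, ← Finset.filter_or]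
      · simp_rw [← not_or]
        rw [add_comm, Finset.card_filter_add_card_filter_not, Finset.card_univ, Fintype.card_fin]
      · rw [Finset.disjoint_filter]
        exact fun y _ h => hG _ _ h
    have h2 : ((Finset.univ.filter fun y => ¬ G x y ∧ ¬ G y x).card : ℝ) +
        ((Finset.univ.filter (G x)).card + (Finset.univ.filter fun y => G y x).card) = n := by
      exact_mod_cast h1
    rw [Fintype.card_fin]
    nlinarith [hout x, hin x]
  have hout' : ∀ x, 49 / 100 * (Fintype.card (Fin n) : ℝ) ≤ (Finset.univ.filter (G x)).card :=
    fun x => by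
      rw [Fintype.card_fin]
      nlinarith [hout x, mul_le_mul_of_nonneg_right hε hn]
  have hin' : ∀ x, 49 / 100 * (Fintype.card (Fin n) : ℝ) ≤
      (Finset.univ.filter fun y => G y x).card := fun x => by
    rw [Fintype.card_fin]
    nlinarith [hin x, mul_le_mul_of_nonneg_right hε hn]
  have hlow : ∀ (H : Fin n → Fin n → Prop) [DecidableRel H] (J : Finset (Fin m)),
      (∀ x, 49 / 100 * (Fintype.card (Fin n) : ℝ) ≤ (Finset.univ.filter (H x)).card) →
      r ≤ J.card → ((Finset.univ.filter (LowDegree H J v)).card : ℝ) ≤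
        (m + 1) * (999 / 1000) ^ (r - 1) * (n : ℝ) ^ m := by
    intro H _ J hH hJ
    refine (card_filter_lowDegree_le H v hH J).trans ?_
    rw [Fintype.card_fin, Fintype.card_fin, mul_assoc]
    gcongr ?_ * (?_ * ?_)
    exact pow_le_pow_of_le_one (by norm_num) (by norm_num) (by omega)
  have hU : r ≤ (Finset.univ : Finset (Fin m)).card := by simpa using hrm'
  have hsub : (Finset.univ.filter fun u : Fin m → Fin n =>
      ¬ IsGoodPart k (m + 1) G (Finset.univ.image (Fin.cons v u : Fin (m + 1) → Fin n))) ⊆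
      Finset.univ.filter (HasPair (fun x y => ¬ G x y ∧ ¬ G y x) v) ∪
      (Finset.univ.filter (LowDegree G Finset.univ v) ∪ Finset.univ.filter (LowDegree G R v) ∪
      (Finset.univ.filter (LowDegree (fun x y => G y x) Finset.univ v) ∪
        Finset.univ.filter (LowDegree (fun x y => G y x) R v))) := by
    intro u hu
    by_contra hnot
    simp only [Finset.mem_union, Finset.mem_filter, Finset.mem_univ, true_and, not_or] at hnot
    obtain ⟨hpair, ⟨h1, h2⟩, h3, h4⟩ := hnot
    refine (Finset.mem_filter.1 hu).2 ?_
    rw [HasPair] at hpair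
    push Not at hpair
    have hcardR : (R.map (Fin.succEmb m)).card = r := by rw [Finset.card_map, hR]
    have hmemR : ∀ j ∈ R, j.succ ∈ R.map (Fin.succEmb m) := fun j hj =>
      Finset.mem_map_of_mem (Fin.succEmb m) hj
    have hcardU : (Finset.univ : Finset (Fin (m + 1))).card ≤
      (Finset.univ : Finset (Fin m)).card + 1 := by simp
    refine isGoodPart_image hG hk hD _ ?_ (R := R.map (Fin.succEmb m)) (fun i => ⟨?_, ?_⟩)
      (fun i => ⟨?_, ?_⟩) (by omega) (by rw [hcardR]; omega) (by rw [hcardR]; omega)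
    · have hv : ∀ j, G v (u j) ∨ G (u j) v := fun j => or_iff_not_imp_left.2 (hpair.1 j)
      have hu : ∀ i j, i ≠ j → G (u i) (u j) ∨ G (u j) (u i) := fun i j hij =>
        or_iff_not_imp_left.2 (hpair.2 (i, j) hij)
      intro i j
      refine Fin.cases ?_ (fun i => ?_) i <;> refine Fin.cases ?_ (fun j => ?_) j
      · exact fun h => absurd rfl h
      · exact fun _ => hv j
      · exact fun _ => (hv i).symm
      · exact fun h => hu i j fun hij => h (hij ▸ rfl)
    · exact balanced_cons (fun j _ => Finset.mem_univ _) hcardU (hr.trans hU) h1 i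
    · exact balanced_cons (H := fun x y => G y x) (fun j _ => Finset.mem_univ _) hcardU
        (hr.trans hU) h3 i
    · exact balanced_cons hmemR (by omega) (by omega) h2 i
    · exact balanced_cons (H := fun x y => G y x) hmemR (by omega) (by omega) h4 i
  have hcount := (Finset.card_le_card hsub).trans ((Finset.card_union_le _ _).trans
    (Nat.add_le_add_left ((Finset.card_union_le _ _).trans (Nat.add_le_add
      (Finset.card_union_le _ _) (Finset.card_union_le _ _))) _))
  have hcount' := (Nat.cast_le (α := ℝ)).2 hcount
  push_cast at hcount'
  rw [Fintype.card_fin, Fintype.card_fin] at hsp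
  linarith [hlow G Finset.univ hout' hU, hlow G R hout' hR.ge,
    hlow (fun x y => G y x) Finset.univ hin' hU, hlow (fun x y => G y x) R hin' hR.ge]

end GoodParts

section Parameters

theorem pow_le_sampling_bound {r : ℕ} (hr : 10 ^ 10 ≤ r) :
    (999 / 1000 : ℝ) ^ (r - 1) ≤ 1 / (32000 * (r : ℝ) ^ 4) := by
  obtain ⟨t, ht⟩ : ∃ t, t = (r - 1) / 10 := ⟨_, rfl⟩
  have htr : 10 * t ≤ r - 1 := by omega
  have hrt : (r : ℝ) ≤ 20 * t := by
    have : r ≤ 20 * t := by omega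
    exact_mod_cast this
  have hr' : (10 : ℝ) ^ 10 ≤ r := by exact_mod_cast hr
  have hr0 : (0 : ℝ) < r := lt_of_lt_of_le (by norm_num) hr'
  have h1 : (999 / 1000 : ℝ) ^ t * (r / 20000) ≤ 1 := by
    have h2 := one_add_mul_le_pow (a := (1 / 999 : ℝ)) (by norm_num) t
    have h3 : (999 / 1000 : ℝ) ^ t * (1 + 1 / 999) ^ t = 1 := by
      rw [← mul_pow]
      norm_num
    rw [← h3]
    refine mul_le_mul_of_nonneg_left ?_ (by positivity)
    linarith
  have h4 : (999 / 1000 : ℝ) ^ t ≤ 20000 / r := by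
    rw [le_div_iff₀ hr0]
    linarith
  have h5 : (999 / 1000 : ℝ) ^ (r - 1) ≤ (20000 / r) ^ 10 := by
    refine (pow_le_pow_of_le_one (by norm_num) (by norm_num) htr).trans ?_
    rw [mul_comm, pow_mul]
    exact pow_le_pow_left₀ (by positivity) h4 10
  refine h5.trans ?_
  have h6 : ((10 : ℝ) ^ 10) ^ 6 ≤ (r : ℝ) ^ 6 := pow_le_pow_left₀ (by norm_num) hr' 6
  rw [div_pow, div_le_div_iff₀ (by positivity) (by positivity)]
  have h7 : (0 : ℝ) ≤ r ^ 4 := by positivity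
  nlinarith [mul_le_mul_of_nonneg_right h6 h7]

theorem exists_sampling_parameters {k Q m : ℕ} (hk : 2 ≤ k) (hQ : 10 ^ (1000 * k) ≤ Q)
    (hm : m + 1 = Q ∨ m = Q) :
    ∃ D r : ℕ, 10 ^ 6 * k * 2 ^ (100 * k) ≤ D ∧ D ^ 10 ≤ r ∧ r * D ^ 3 ≤ m + 1 ∧
      m + 1 ≤ 2 * r * D ^ 3 ∧ D ^ 3 ≤ r ∧ 10 ^ 10 ≤ r ∧ r ≤ m := by
  obtain ⟨D, hD⟩ : ∃ D, D = 2 ^ (120 * k) := ⟨_, rfl⟩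
  have hD1 : 2 ^ 240 ≤ D := hD ▸ Nat.pow_le_pow_right (by norm_num) (by omega)
  have hDpos : 0 < D := lt_of_lt_of_le (by norm_num) hD1
  have hDQ : D ^ 25 ≤ Q := by
    refine le_trans ?_ hQ
    calc D ^ 25 = (2 ^ 3) ^ (1000 * k) := by rw [hD, ← pow_mul, ← pow_mul]; ring_nf
      _ ≤ 10 ^ (1000 * k) := Nat.pow_le_pow_left (by norm_num) _
  obtain ⟨r, hr⟩ : ∃ r, r = Q / D ^ 3 := ⟨_, rfl⟩
  have hD3 : 0 < D ^ 3 := by positivity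
  have hrQ : r * D ^ 3 ≤ Q := hr ▸ Nat.div_mul_le_self _ _
  have hQr : Q < (r + 1) * D ^ 3 := by
    rw [hr, add_mul, one_mul, mul_comm]
    exact Nat.lt_mul_div_succ _ hD3 |>.trans_eq (by ring)
  have hrD : D ^ 10 ≤ r := by
    rw [hr, Nat.le_div_iff_mul_le hD3, ← pow_add]
    exact (Nat.pow_le_pow_right hDpos (by norm_num)).trans hDQ
  have hrD' : D ^ 3 ≤ r := (Nat.pow_le_pow_right hDpos (by norm_num)).trans hrD
  have hDr : D ≤ r := (Nat.le_self_pow (by norm_num) D).trans hrD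
  have h10 : 10 ^ 10 ≤ r := le_trans (by norm_num) (hD1.trans hDr)
  refine ⟨D, r, ?_, hrD, hrQ.trans (by omega), ?_, hrD', h10, ?_⟩
  · calc 10 ^ 6 * k * 2 ^ (100 * k) ≤ 2 ^ 20 * 2 ^ k * 2 ^ (100 * k) :=
          Nat.mul_le_mul_right _ (Nat.mul_le_mul (by norm_num) k.lt_two_pow_self.le)
      _ = 2 ^ (20 + k + 100 * k) := by rw [pow_add, pow_add]
      _ ≤ D := hD ▸ Nat.pow_le_pow_right (by norm_num) (by omega)
  · have : (r + 1) * D ^ 3 ≤ 2 * r * D ^ 3 := Nat.mul_le_mul_right _ (by omega)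
    omega
  · have : r * 2 ≤ r * D ^ 3 := Nat.mul_le_mul_left _
      (le_trans (le_trans (by norm_num) hD1) (Nat.le_self_pow (by norm_num) D))
    omega

theorem ncard_setOf_eq_card_filter {α : Type*} [Fintype α] (P : α → Prop) [DecidablePred P] :
    ({x | P x} : Set α).ncard = (Finset.univ.filter P).card := by
  rw [← Set.ncard_coe_finset]
  simp

theorem card_not_isGoodPart_le {k Q m n : ℕ} (hk : 2 ≤ k) (hQ : 10 ^ (1000 * k) ≤ Q)
    (hm : m + 1 = Q ∨ m = Q) {G : Fin n → Fin n → Prop} (hG : IsOriented G)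
    (hdeg : ∀ v, (1 / 2 - 1 / (20 * (Q : ℝ)) ^ 3) * n ≤
      ((min (outDeg G v) (inDeg G v) : ℕ) : ℝ)) (v : Fin n)
    [DecidablePred fun u : Fin m → Fin n =>
      ¬ IsGoodPart k (m + 1) G (Finset.univ.image (Fin.cons v u : Fin (m + 1) → Fin n))] :
    ((Finset.univ.filter fun u : Fin m → Fin n =>
      ¬ IsGoodPart k (m + 1) G (Finset.univ.image (Fin.cons v u : Fin (m + 1) → Fin n))).card : ℝ) ≤
      1 / (1000 * (m + 1)) * (n : ℝ) ^ m := by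
  classical
  obtain ⟨D, r, hD, hrD, hrm, hmr, hDr, h10, hrm'⟩ := exists_sampling_parameters hk hQ hm
  have hmQ : m ≤ Q ∧ Q ≤ m + 1 := by omega
  have hQ1 : (100 : ℝ) ≤ Q := by
    have : 100 ≤ Q := by omega
    exact_mod_cast this
  have hQ3 : (0 : ℝ) < (20 * (Q : ℝ)) ^ 3 := by positivity
  refine (card_bad_le hG hk hD (ε := 1 / (20 * (Q : ℝ)) ^ 3) ?_ (fun x => ?_) (fun x => ?_) hrD hrm
    hmr (by omega) hrm' v).trans (mul_le_mul_of_nonneg_right ?_ (by positivity))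
  · refine one_div_le_one_div_of_le (by norm_num) ?_
    have h1 := pow_le_pow_left₀ (by norm_num) (show (100 : ℝ) ≤ 20 * Q by linarith) 3
    linarith
  · refine (hdeg x).trans (Nat.cast_le.2 ((min_le_left _ _).trans_eq ?_))
    exact ncard_setOf_eq_card_filter _
  · refine (hdeg x).trans (Nat.cast_le.2 ((min_le_right _ _).trans_eq ?_))
    exact ncard_setOf_eq_card_filter _
  · have hm1 : (0 : ℝ) < m + 1 := by positivity
    have hmr' : ((m : ℝ) + 1) ≤ 2 * r ^ 2 := by
      have : m + 1 ≤ 2 * r ^ 2 := hmr.trans (by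
        rw [pow_two, ← mul_assoc]
        exact Nat.mul_le_mul_left _ hDr)
      exact_mod_cast this
    have hr0 : (0 : ℝ) < r := by
      have : 0 < r := by omega
      exact_mod_cast this
    have h1 : 4 * ((m : ℝ) + 1) * (999 / 1000) ^ (r - 1) ≤ 1 / (2000 * (m + 1)) := by
      refine (mul_le_mul_of_nonneg_left (pow_le_sampling_bound h10) (by positivity)).trans ?_
      rw [mul_one_div, div_le_div_iff₀ (by positivity) (by positivity)]
      nlinarith [pow_le_pow_left₀ hm1.le hmr' 2]
    have h2 : (m : ℝ) * (m + 1) * (2 * (1 / (20 * (Q : ℝ)) ^ 3)) ≤ 1 / (2000 * (m + 1)) := by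
      rw [mul_one_div, mul_div_assoc', div_le_div_iff₀ (by positivity) (by positivity)]
      have hmQ' : (m : ℝ) ≤ Q := by exact_mod_cast hmQ.1
      have h3 : ((m : ℝ) + 1) ^ 2 ≤ 2 * Q ^ 2 := by nlinarith
      have h4 := mul_le_mul hmQ' h3 (by positivity) (by positivity)
      nlinarith
    calc _ ≤ 1 / (2000 * ((m : ℝ) + 1)) + 1 / (2000 * (m + 1)) := add_le_add h2 h1
      _ = 1 / (1000 * (m + 1)) := by field_simp; norm_num

end Parameters

section Tiling

variable {Y : Type*} [DecidableEq Y]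

theorem exists_not_and_not {α : Type*} [Fintype α] {P R : α → Prop} [DecidablePred P]
    [DecidablePred R] (h : ((Finset.univ.filter P).card : ℝ) + (Finset.univ.filter R).card <
      Fintype.card α) : ∃ u, ¬ P u ∧ ¬ R u := by
  classical
  by_contra! hno
  have hcover : (Finset.univ : Finset α) ⊆ Finset.univ.filter P ∪ Finset.univ.filter R := by
    intro u _
    simp only [Finset.mem_union, Finset.mem_filter, Finset.mem_univ, true_and]
    exact or_iff_not_imp_left.2 (hno u)
  refine absurd h (not_lt.2 ?_)
  exact_mod_cast (Finset.card_le_card hcover).trans (Finset.card_union_le _ _)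

/-- If rows `r 0, r 1, …` of an array are rearranged into the sets
`{e (r a, s a + i) | a}`, all of which are good, the array stays injective and no good row is
lost. -/
theorem exists_rearrangement {m M : ℕ} {Good : Finset Y → Prop}
    {e : Fin M × Fin (m + 1) → Y} (he : Function.Injective e) {r : Fin (m + 1) → Fin M}
    (hr : Function.Injective r) (s : Fin (m + 1) → Fin (m + 1))
    (hgood : ∀ i, Good (Finset.univ.image fun a => e (r a, s a + i))) :
    ∃ f : Fin M × Fin (m + 1) → Fin M × Fin (m + 1), Function.Injective (e ∘ f) ∧
      (∀ i, Good (Finset.univ.image fun a => e (f (r i, a)))) ∧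
      ∀ j, Good (Finset.univ.image fun a => e (j, a)) →
        Good (Finset.univ.image fun a => e (f (j, a))) := by
  classical
  obtain ⟨f, hf⟩ : ∃ f : Fin M × Fin (m + 1) → Fin M × Fin (m + 1), ∀ p, f p =
      if h : ∃ i, r i = p.1 then (r p.2, s p.2 + h.choose) else p := ⟨_, fun _ => rfl⟩
  have hfr : ∀ i a, f (r i, a) = (r a, s a + i) := by
    intro i a
    have h : ∃ i', r i' = (r i, a).1 := ⟨i, rfl⟩
    rw [hf, dif_pos h, hr h.choose_spec]
  have hfn : ∀ j a, (¬ ∃ i, r i = j) → f (j, a) = (j, a) := fun j a h => by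
    rw [hf, dif_neg h]
  have hrow : ∀ i, Good (Finset.univ.image fun a => e (f (r i, a))) := fun i => by
    simpa only [hfr] using hgood i
  refine ⟨f, he.comp ?_, hrow, fun j hj => ?_⟩
  · rintro ⟨j, a⟩ ⟨j', a'⟩ h
    by_cases h1 : ∃ i, r i = j <;> by_cases h2 : ∃ i, r i = j'
    · obtain ⟨i, rfl⟩ := h1
      obtain ⟨i', rfl⟩ := h2
      rw [hfr, hfr, Prod.mk.injEq] at h
      obtain rfl := hr h.1
      rw [add_left_cancel h.2]
    · obtain ⟨i, rfl⟩ := h1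
      rw [hfr, hfn _ _ h2, Prod.mk.injEq] at h
      exact absurd ⟨a, h.1⟩ h2
    · obtain ⟨i', rfl⟩ := h2
      rw [hfr, hfn _ _ h1, Prod.mk.injEq] at h
      exact absurd ⟨a', h.1.symm⟩ h1
    · rwa [hfn _ _ h1, hfn _ _ h2] at h
  · by_cases h1 : ∃ i, r i = j
    · obtain ⟨i, rfl⟩ := h1
      exact hrow i
    · simpa only [hfn _ _ h1] using hj

/-- If few tuples are bad for every vertex, any row can be combined with shifts of other rows
into good sets. -/
theorem exists_good_shifts [Fintype Y] {m M : ℕ} {Good : Finset Y → Prop}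
    {e : Fin M × Fin (m + 1) → Y} (he : Function.Injective e) {c : ℝ}
    (hc : (m + 1) * c ≤ 1 / 2) (hM : 2 * (m * (m + 1)) < M)
    (hbad : ∀ v, ({u : Fin m → Y |
      ¬ Good (Finset.univ.image (Fin.cons v u : Fin (m + 1) → Y))}.ncard : ℝ) ≤
        c * ((M * (m + 1) : ℕ) : ℝ) ^ m) (j : Fin M) :
    ∃ (r : Fin (m + 1) → Fin M) (s : Fin (m + 1) → Fin (m + 1)), Function.Injective r ∧ r 0 = j ∧
      ∀ i, Good (Finset.univ.image fun a => e (r a, s a + i)) := by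
  classical
  have hMpos : (0 : ℝ) < M := by
    have : 0 < M := by omega
    exact_mod_cast this
  have : Nonempty (Fin M × Fin (m + 1)) := ⟨(j, 0)⟩
  have hcard : Fintype.card (Fin M × Fin (m + 1)) = M * (m + 1) := by simp
  have h1 := card_filter_sparse_le (ι := Fin m)
    (fun z z' : Fin M × Fin (m + 1) => z.1 = z'.1) (j, 0) (1 / M) fun z => by
      have : (Finset.univ.filter fun z' : Fin M × Fin (m + 1) => z.1 = z'.1) =
          {z.1} ×ˢ Finset.univ := by
        ext z'
        simp only [Finset.mem_filter, Finset.mem_univ, true_and, Finset.mem_product,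
          Finset.mem_singleton, and_true, eq_comm]
      rw [this, Finset.card_product, hcard]
      simp only [Finset.card_singleton, Finset.card_univ, Fintype.card_fin]
      push_cast
      field_simp
      rfl
  have h2 := card_filter_exists_le
    (fun (i : Fin (m + 1)) (u : Fin m → Fin M × Fin (m + 1)) => ¬ Good (Finset.univ.image
      (Fin.cons (e (j, i)) fun a => e ((u a).1, (u a).2 + i) : Fin (m + 1) → Y)))
    (c * ((M * (m + 1) : ℕ) : ℝ) ^ m) fun i => by
      refine le_trans (Nat.cast_le.2 ?_) (hbad (e (j, i)))
      rw [← Set.ncard_coe_finset]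
      refine Set.ncard_le_ncard_of_injOn (fun u a => e ((u a).1, (u a).2 + i)) (fun u hu => ?_)
        (fun u _ u' _ h => funext fun a => ?_) (Set.toFinite _)
      · simpa using hu
      · have := he (congrFun h a)
        simp only [Prod.mk.injEq, add_left_inj] at this
        exact Prod.ext this.1 this.2
  obtain ⟨u, hu1, hu2⟩ := exists_not_and_not (P := HasPair _ _) (R := fun u => ∃ i, _) (by
    refine (add_le_add h1 h2).trans_lt ?_
    rw [Fintype.card_fun, hcard]
    simp only [Fintype.card_fin]
    push_cast
    obtain ⟨N, hN⟩ : ∃ N : ℝ, N = ((M : ℝ) * (m + 1)) ^ m := ⟨_, rfl⟩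
    have hNpos : 0 < N := by rw [hN]; positivity
    rw [← hN]
    have h3 : (m : ℝ) * (m + 1) * (1 / M) < 1 / 2 := by
      have : (2 * (m * (m + 1)) : ℝ) < M := by exact_mod_cast hM
      rw [mul_one_div, div_lt_iff₀ hMpos]
      linarith
    nlinarith)
  rw [HasPair] at hu1
  push Not at hu1 hu2
  refine ⟨Fin.cons j fun a => (u a).1, Fin.cons 0 fun a => (u a).2, ?_, rfl, fun i => ?_⟩
  · rw [Fin.cons_injective_iff]
    refine ⟨?_, fun a b hab => ?_⟩
    · rintro ⟨a, ha⟩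
      exact hu1.1 a ha.symm
    · by_contra hne
      exact hu1.2 (a, b) hne hab
  · convert hu2 i using 2
    funext a
    refine Fin.cases ?_ (fun a => ?_) a
    · simp
    · simp

theorem exists_tiling [Fintype Y] {m M : ℕ} {Good : Finset Y → Prop} {W : Finset Y}
    (hW : W.card = M * (m + 1)) {c : ℝ} (hc : (m + 1) * c ≤ 1 / 2) (hM : 2 * (m * (m + 1)) < M)
    (hbad : ∀ v, ({u : Fin m → Y |
      ¬ Good (Finset.univ.image (Fin.cons v u : Fin (m + 1) → Y))}.ncard : ℝ) ≤
        c * (W.card : ℝ) ^ m) :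
    ∃ e : Fin M × Fin (m + 1) → Y, Function.Injective e ∧ (∀ z, e z ∈ W) ∧
      ∀ j, Good (Finset.univ.image fun a => e (j, a)) := by
  classical
  rw [hW] at hbad
  have hne : (Finset.univ.filter fun e : Fin M × Fin (m + 1) → Y =>
      Function.Injective e ∧ ∀ z, e z ∈ W).Nonempty := by
    refine ⟨fun z => (W.equivFinOfCardEq hW).symm (finProdFinEquiv z), ?_⟩
    rw [Finset.mem_filter]
    refine ⟨Finset.mem_univ _, ?_, fun z => Finset.coe_mem _⟩
    exact Subtype.val_injective.comp ((Equiv.injective _).comp (Equiv.injective _))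
  obtain ⟨e, he, hmax⟩ := Finset.exists_max_image _ (fun e : Fin M × Fin (m + 1) → Y =>
    (Finset.univ.filter fun j => Good (Finset.univ.image fun a => e (j, a))).card) hne
  simp only [Finset.mem_filter, Finset.mem_univ, true_and] at he hmax
  refine ⟨e, he.1, he.2, ?_⟩
  by_contra! hj
  obtain ⟨j, hj⟩ := hj
  obtain ⟨r, s, hr, hr0, hgood⟩ := exists_good_shifts he.1 hc hM hbad j
  obtain ⟨f, hf, hfr, hfj⟩ := exists_rearrangement he.1 hr s hgood
  refine absurd (hmax (e ∘ f) ⟨hf, fun z => he.2 _⟩) (not_le.2 (Finset.card_lt_card ?_))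
  refine Finset.ssubset_iff_of_subset (fun j' h => ?_) |>.2 ⟨j, ?_, ?_⟩
  · simp only [Finset.mem_filter, Finset.mem_univ, true_and] at h ⊢
    exact hfj j' h
  · simpa using hr0 ▸ hfr 0
  · simpa using hj

/-- Disjoint good sets can be chosen greedily. -/
theorem exists_disjoint_good [Fintype Y] {m b : ℕ} {Good : Finset Y → Prop}
    (hcard : ∀ S, Good S → S.card = m + 1)
    (hb : 2 * (b * (m + 1) * (m + 1)) < Fintype.card Y)
    (hbad : ∀ v, ({u : Fin m → Y |
      ¬ Good (Finset.univ.image (Fin.cons v u : Fin (m + 1) → Y))}.ncard : ℝ) ≤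
        1 / 2 * (Fintype.card Y : ℝ) ^ m) :
    ∃ T : Finset (Finset Y), T.card = b ∧ (∀ S ∈ T, Good S) ∧
      ∀ S ∈ T, ∀ S' ∈ T, S ≠ S' → Disjoint S S' := by
  classical
  induction b with
  | zero => exact ⟨∅, by simp⟩
  | succ b ih =>
    obtain ⟨T, hTb, hTg, hTd⟩ := ih (lt_of_le_of_lt (by gcongr; omega) hb)
    obtain ⟨U, hU⟩ : ∃ U, U = T.biUnion id := ⟨_, rfl⟩
    have hUc : U.card ≤ b * (m + 1) := by
      rw [hU, ← hTb]
      exact Finset.card_biUnion_le_card_mul _ _ _ fun S hS => (hcard S (hTg S hS)).le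
    have hUY : 2 * (U.card * (m + 1)) < Fintype.card Y := by
      refine lt_of_le_of_lt ?_ hb
      gcongr
      exact hUc.trans (Nat.mul_le_mul_right _ (by omega))
    obtain ⟨v, hv⟩ : ∃ v, v ∉ U := by
      by_contra! h
      rw [Finset.eq_univ_of_forall h, Finset.card_univ] at hUY
      nlinarith
    have : Nonempty Y := ⟨v⟩
    have hpos : (0 : ℝ) < Fintype.card Y := by exact_mod_cast Fintype.card_pos
    have h1 := card_filter_exists_le (fun (j : Fin m) (u : Fin m → Y) => u j ∈ U) _ fun j =>
      card_filter_coord_le j U (U.card / Fintype.card Y) (by field_simp; rfl)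
    obtain ⟨u, hu, huU⟩ : ∃ u : Fin m → Y,
        Good (Finset.univ.image (Fin.cons v u : Fin (m + 1) → Y)) ∧ ∀ j, u j ∉ U := by
      obtain ⟨u, hu1, hu2⟩ := exists_not_and_not (P := fun u : Fin m → Y =>
        ¬ Good (Finset.univ.image (Fin.cons v u : Fin (m + 1) → Y)))
        (R := fun u : Fin m → Y => ∃ j, u j ∈ U) (by
        have h2 := hbad v
        rw [ncard_setOf_eq_card_filter] at h2
        refine (add_le_add h2 h1).trans_lt ?_
        rw [Fintype.card_fun, Fintype.card_fin]
        push_cast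
        obtain ⟨N, hN⟩ : ∃ N : ℝ, N = (Fintype.card Y : ℝ) ^ m := ⟨_, rfl⟩
        have hNpos : 0 < N := by rw [hN]; positivity
        rw [← hN]
        have h3 : (m : ℝ) * (U.card / Fintype.card Y) < 1 / 2 := by
          have : (2 * (U.card * (m + 1)) : ℝ) < Fintype.card Y := by exact_mod_cast hUY
          have h0 : (0 : ℝ) ≤ U.card := by positivity
          rw [mul_div_assoc', div_lt_iff₀ hpos]
          linarith
        nlinarith)
      exact ⟨u, not_not.1 hu1, not_exists.1 hu2⟩
    obtain ⟨S, hS⟩ : ∃ S, S = Finset.univ.image (Fin.cons v u : Fin (m + 1) → Y) := ⟨_, rfl⟩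
    rw [← hS] at hu
    have hSU : Disjoint S U := by
      rw [hS, Finset.disjoint_left]
      simp only [Finset.mem_image, Finset.mem_univ, true_and]
      rintro _ ⟨i, rfl⟩
      exact Fin.cases hv huU i
    have hST : ∀ S' ∈ T, Disjoint S S' := fun S' hS' =>
      hSU.mono_right (hU ▸ Finset.subset_biUnion_of_mem id hS')
    have hSne : S ∉ T := fun h => by
      have := hcard S hu
      rw [disjoint_self.1 (hST S h)] at this
      simp at this
    refine ⟨insert S T, by rw [Finset.card_insert_of_notMem hSne, hTb], ?_, ?_⟩
    · simpa using ⟨hu, hTg⟩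
    · intro A hA B hB hAB
      rw [Finset.mem_insert] at hA hB
      rcases hA with rfl | hA <;> rcases hB with rfl | hB
      · exact absurd rfl hAB
      · exact hST B hB
      · exact (hST A hA).symm
      · exact hTd A hA B hB hAB

end Tiling

/-- Removing a bounded number of vertices at most halves the number of tuples. -/
theorem pow_le_two_mul_pow {n w m d : ℕ} (hw : n ≤ w + d) (hd : 2 * (m * d) ≤ n) (hdn : d ≤ n) :
    (n : ℝ) ^ m ≤ 2 * (w : ℝ) ^ m := by
  rcases Nat.eq_zero_or_pos n with rfl | hn
  · rcases Nat.eq_zero_or_pos m with rfl | hm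
    · norm_num
    · rw [Nat.cast_zero, zero_pow hm.ne']
      positivity
  have hn' : (0 : ℝ) < n := by exact_mod_cast hn
  have hdn' : (d : ℝ) ≤ n := by exact_mod_cast hdn
  have hd' : (2 * (m * d) : ℝ) ≤ n := by exact_mod_cast hd
  have hw' : (n : ℝ) ≤ w + d := by exact_mod_cast hw
  have h1 := one_add_mul_le_pow (a := -((d : ℝ) / n))
    (by linarith [(div_le_one hn').2 hdn']) m
  have h2 : (1 : ℝ) / 2 ≤ 1 + m * -((d : ℝ) / n) := by
    have : (m : ℝ) * (d / n) ≤ 1 / 2 := by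
      rw [mul_div_assoc', div_le_iff₀ hn']
      linarith
    linarith
  have h3 : (1 + -((d : ℝ) / n)) ^ m * (n : ℝ) ^ m ≤ (w : ℝ) ^ m := by
    rw [← mul_pow]
    have h4 : (1 + -((d : ℝ) / n)) * n = n - d := by field_simp; ring
    rw [h4]
    exact pow_le_pow_left₀ (by linarith) (by linarith) m
  have h5 := mul_le_mul_of_nonneg_right (h2.trans h1) (by positivity : (0 : ℝ) ≤ (n : ℝ) ^ m)
  linarith

theorem exists_good_partition {k m n : ℕ} (hk : 2 ≤ k) (hQ : 10 ^ (1000 * k) ≤ m + 1)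
    (hn : 10 * (m + 1) ^ 4 ≤ n) {G : Fin n → Fin n → Prop} (hG : IsOriented G)
    (hdeg : ∀ v, (1 / 2 - 1 / (20 * ((m + 1 : ℕ) : ℝ)) ^ 3) * n ≤
      ((min (outDeg G v) (inDeg G v) : ℕ) : ℝ)) :
    ∃ Parts : Finset (Finset (Fin n)),
      (∀ S ∈ Parts, ∀ T ∈ Parts, S ≠ T → Disjoint S T) ∧
      (∀ v : Fin n, ∃ S ∈ Parts, v ∈ S) ∧
      ∀ S ∈ Parts, IsGoodPart k (m + 1) G S ∨ IsGoodPart k (m + 2) G S := by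
  classical
  obtain ⟨Q, hQdef⟩ : ∃ Q, Q = m + 1 := ⟨_, rfl⟩
  have hQ1 : 1 ≤ Q := by omega
  have hb : n % Q < Q := Nat.mod_lt _ hQ1
  have hn4 : 10 * Q ^ 4 ≤ n := hQdef ▸ hn
  have hQ34 : Q ^ 3 ≤ Q ^ 4 := Nat.pow_le_pow_right hQ1 (by norm_num)
  have hQ23 : Q ^ 2 ≤ Q ^ 3 := Nat.pow_le_pow_right hQ1 (by norm_num)
  have hQ12 : Q ≤ Q ^ 2 := Nat.le_self_pow (by norm_num) Q
  have hbQ : n % Q * (Q + 1) ≤ 2 * Q ^ 2 := by nlinarith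
  obtain ⟨T, hTb, hTg, hTd⟩ := exists_disjoint_good (Y := Fin n) (m := m + 1) (b := n % Q)
    (Good := IsGoodPart k (m + 2) G) (fun S hS => hS.1) (by
      rw [Fintype.card_fin, ← hQdef]
      nlinarith) (fun v => by
      rw [ncard_setOf_eq_card_filter]
      refine (card_not_isGoodPart_le hk hQ (Or.inr rfl) hG hdeg v).trans ?_
      rw [Fintype.card_fin]
      refine mul_le_mul_of_nonneg_right (one_div_le_one_div_of_le (by norm_num) ?_) (by positivity)
      have : (0 : ℝ) ≤ ((m + 1 : ℕ) : ℝ) := by positivity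
      linarith)
  have hUcard : (T.biUnion id).card = n % Q * (Q + 1) := by
    rw [Finset.card_biUnion (t := id) hTd,
      Finset.sum_const_nat (f := fun S => (id S).card) fun S hS => (hTg S hS).1, hTb, hQdef]
  obtain ⟨W, hWdef⟩ : ∃ W, W = (T.biUnion id)ᶜ := ⟨_, rfl⟩
  have hWcard : W.card + n % Q * (Q + 1) = n := by
    rw [hWdef, ← hUcard, Finset.card_compl_add_card, Fintype.card_fin]
  have hdiv : 10 * Q ^ 3 ≤ n / Q := by
    rw [Nat.le_div_iff_mul_le hQ1]
    exact le_trans (le_of_eq (by ring)) hn4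
  have hMcard : W.card = (n / Q - n % Q) * (m + 1) := by
    rw [← hQdef]
    have h1 := Nat.div_add_mod' n Q
    have h2 : (n / Q - n % Q) * Q + n % Q * Q = n / Q * Q := by
      rw [← add_mul, Nat.sub_add_cancel (by omega)]
    have h3 : n % Q * (Q + 1) = n % Q * Q + n % Q := by ring
    omega
  have hpow : (n : ℝ) ^ m ≤ 2 * (W.card : ℝ) ^ m := by
    refine pow_le_two_mul_pow hWcard.ge ?_ (by omega)
    have : m * (n % Q * (Q + 1)) ≤ Q * (2 * Q ^ 2) := Nat.mul_le_mul (by omega) hbQ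
    have h2 : Q * (2 * Q ^ 2) = 2 * Q ^ 3 := by ring
    omega
  obtain ⟨e, he, heW, heg⟩ := exists_tiling (Good := IsGoodPart k (m + 1) G) hMcard
    (c := 1 / (1000 * (m + 1)) * 2) (by field_simp; norm_num) (by
      have : m * (m + 1) ≤ Q ^ 2 := by rw [pow_two]; exact Nat.mul_le_mul (by omega) hQdef.ge
      omega) (fun v => by
      rw [ncard_setOf_eq_card_filter]
      refine (card_not_isGoodPart_le hk hQ (Or.inl rfl) hG hdeg v).trans ?_
      rw [mul_assoc]
      exact mul_le_mul_of_nonneg_left hpow (by positivity))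
  obtain ⟨row, hrow⟩ : ∃ row : Fin (n / Q - n % Q) → Finset (Fin n),
      ∀ j, row j = Finset.univ.image fun a => e (j, a) := ⟨_, fun _ => rfl⟩
  have hrowW : ∀ j, row j ⊆ W := fun j => by
    rw [hrow, Finset.image_subset_iff]
    exact fun a _ => heW _
  have hrowT : ∀ j, ∀ S ∈ T, Disjoint (row j) S := fun j S hS =>
    (disjoint_compl_left.mono_left (hWdef ▸ hrowW j)).mono_right
      (Finset.subset_biUnion_of_mem id hS)
  have hcover : Finset.univ.image e = W := by
    refine Finset.eq_of_subset_of_card_le (Finset.image_subset_iff.2 fun z _ => heW z) ?_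
    rw [Finset.card_image_of_injective _ he, hMcard]
    simp
  refine ⟨T ∪ Finset.univ.image row, ?_, fun v => ?_, ?_⟩
  · intro A hA B hB hAB
    simp only [Finset.mem_union, Finset.mem_image, Finset.mem_univ, true_and] at hA hB
    rcases hA with hA | ⟨i, rfl⟩ <;> rcases hB with hB | ⟨j, rfl⟩
    · exact hTd A hA B hB hAB
    · exact (hrowT j A hA).symm
    · exact hrowT i B hB
    · rw [Finset.disjoint_left]
      intro x hx hx'
      simp only [hrow, Finset.mem_image, Finset.mem_univ, true_and] at hx hx'
      obtain ⟨a, rfl⟩ := hx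
      obtain ⟨b, hab⟩ := hx'
      exact hAB (congrArg row (Prod.mk.inj (he hab)).1.symm)
  · by_cases hv : v ∈ W
    · rw [← hcover] at hv
      obtain ⟨⟨j, a⟩, -, rfl⟩ := Finset.mem_image.1 hv
      refine ⟨row j, Finset.mem_union_right _ (Finset.mem_image_of_mem _ (Finset.mem_univ _)), ?_⟩
      rw [hrow]
      exact Finset.mem_image_of_mem (fun a => e (j, a)) (Finset.mem_univ a)
    · rw [hWdef, Finset.mem_compl, not_not, Finset.mem_biUnion] at hv
      obtain ⟨S, hS, hvS⟩ := hv
      exact ⟨S, Finset.mem_union_left _ hS, hvS⟩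
  · intro S hS
    simp only [Finset.mem_union, Finset.mem_image, Finset.mem_univ, true_and] at hS
    rcases hS with hS | ⟨j, rfl⟩
    · exact Or.inr (hTg S hS)
    · rw [hrow]
      exact Or.inl (heg j)

/-- Almost covering lemma for oriented graphs: for `k ≥ 2` and `Q ≥ 10^(1000k)` there is
`n₀` such that the vertex set of any oriented graph on `n ≥ n₀` vertices with minimum
semi-degree at least `(1/2 - 1/(20Q)³)n` can be partitioned into sets `S` of size `Q` or
`Q+1`, each inducing a tournament with minimum semi-degree at least `2|S|/5` that contains
the `k`-th power of a Hamilton cycle; in particular, into at most `n/Q` `k`-cycles. -/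
theorem statement_17 (k Q : ℕ) (hk : 2 ≤ k) (hQ : 10^(1000*k) ≤ Q) :
    ∃ n₀ : ℕ, ∀ n : ℕ, n₀ ≤ n → ∀ G : Fin n → Fin n → Prop, IsOriented G →
      (∀ v, (1/2 - 1/(20*(Q:ℝ))^3) * n ≤ ((min (outDeg G v) (inDeg G v) : ℕ) : ℝ)) →
      ∃ Parts : Finset (Finset (Fin n)),
        (∀ S ∈ Parts, ∀ T ∈ Parts, S ≠ T → Disjoint S T) ∧
        (∀ v : Fin n, ∃ S ∈ Parts, v ∈ S) ∧
        (∀ S ∈ Parts,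
          (S.card = Q ∨ S.card = Q + 1) ∧
          (∀ x ∈ S, ∀ y ∈ S, x ≠ y → G x y ∨ G y x) ∧
          (∀ x ∈ S,
            2 * (S.card : ℝ) / 5 ≤
              ((min ({w | w ∈ S ∧ G x w} : Set (Fin n)).ncard
                ({w | w ∈ S ∧ G w x} : Set (Fin n)).ncard : ℕ) : ℝ)) ∧
          HasPowHamCycleOn k G S) ∧
        (Parts.card : ℝ) ≤ (n : ℝ) / (Q : ℝ) := by
  obtain ⟨m, rfl⟩ : ∃ m, Q = m + 1 :=
    ⟨Q - 1, (Nat.sub_add_cancel ((Nat.one_le_pow _ _ (by norm_num)).trans hQ)).symm⟩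
  refine ⟨10 * (m + 1) ^ 4, fun n hn G hG hdeg => ?_⟩
  obtain ⟨Parts, hdisj, hcov, hgood⟩ := exists_good_partition hk hQ hn hG hdeg
  have hcard : ∀ S ∈ Parts, S.card = m + 1 ∨ S.card = m + 1 + 1 := fun S hS =>
    (hgood S hS).imp (fun h => h.1) fun h => h.1
  refine ⟨Parts, hdisj, hcov, fun S hS => ⟨hcard S hS, ?_⟩, ?_⟩
  · exact (hgood S hS).elim (fun h => h.2) fun h => h.2
  · have h1 : Parts.card * (m + 1) ≤ n := by
      calc Parts.card * (m + 1) ≤ ∑ S ∈ Parts, S.card :=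
            Finset.card_nsmul_le_sum Parts Finset.card (m + 1) fun S hS => by
              rcases hcard S hS with h | h <;> omega
        _ = (Parts.biUnion id).card := (Finset.card_biUnion hdisj).symm
        _ ≤ n := (Finset.card_le_univ _).trans_eq (Fintype.card_fin n)
    rw [le_div_iff₀ (by positivity)]
    exact_mod_cast h1

end Paper
end

section
/- Let k ≥ 1 and ℓ ≥ 2k+1. Then C^k_ℓ, the kth power of the directed cycle on ℓ vertices, is Turánable if and only if ℓ ≥ 3k. -/
namespace Paper

/-- The `k`-th power of the directed cycle on `ℓ` vertices: there is an edge from `i` to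
`i + t (mod ℓ)` for every `1 ≤ t ≤ k`. -/
def powCycle (ℓ k : ℕ) : Fin ℓ → Fin ℓ → Prop :=
  fun i j => ∃ t : ℕ, 1 ≤ t ∧ t ≤ k ∧ (j : ℕ) = ((i : ℕ) + t) % ℓ

/-- An oriented graph `H` is Turánable if there is `n₀` such that every oriented graph on
`n ≥ n₀` vertices with minimum semi-degree at least `⌊(n-1)/2⌋` contains a copy of `H`. -/
def Turanable {m : ℕ} (H : Fin m → Fin m → Prop) : Prop :=
  ∃ n₀ : ℕ, ∀ n : ℕ, n₀ ≤ n → ∀ G : Fin n → Fin n → Prop, IsOriented G →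
    (∀ v, (n - 1) / 2 ≤ min (outDeg G v) (inDeg G v)) →
    ∃ f : Fin m → Fin n, Function.Injective f ∧ ∀ i j, H i j → G (f i) (f j)

/-! ### Powers of short cycles: iterated blow-ups of the cyclic triangle -/

section LowerBound

/-- Once a walk that only stays or advances in the cyclic triangle advances, it stays in the new
class for at least `k` steps before it advances again. -/
lemma exists_next_advance {k : ℕ} {g : ℕ → Fin 3}
    (hg : ∀ i t, 1 ≤ t → t ≤ k → g (i + t) = g i ∨ g (i + t) = g i + 1)
    (hk : 1 ≤ k) {i e : ℕ} (hi : g (i + 1) = g i + 1) (he : i + 1 < e) (hge : g e ≠ g i + 1) :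
    ∃ p, i + k ≤ p ∧ p < e ∧ g p = g i + 1 ∧ g (p + 1) = g p + 1 := by
  classical
  have hstay : ∀ t, 1 ≤ t → t ≤ k → g (i + t) = g i + 1 := by
    intro t ht htk
    rcases Nat.eq_or_lt_of_le ht with rfl | ht'
    · exact hi
    · have h1 := hg i t ht htk
      have h2 := hg (i + 1) (t - 1) (by omega) (by omega)
      rw [show i + 1 + (t - 1) = i + t by omega, hi] at h2
      revert h1 h2
      generalize g (i + t) = x
      generalize g i = y
      revert x y
      decide
  have hex : ∃ p, i < p ∧ g p ≠ g i + 1 := ⟨e, by omega, hge⟩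
  obtain ⟨hip, hp⟩ := Nat.find_spec hex
  have hmin : ∀ q, q < Nat.find hex → i < q → g q = g i + 1 := by
    intro q hq hiq
    by_contra hne
    exact Nat.find_min hex hq ⟨hiq, hne⟩
  have hle : Nat.find hex ≤ e := Nat.find_min' hex ⟨by omega, hge⟩
  generalize Nat.find hex = p at *
  have hpk : i + k < p := by
    by_contra hcon
    exact hp (by simpa [show i + (p - i) = p by omega] using hstay (p - i) (by omega) (by omega))
  have hq := hmin (p - 1) (by omega) (by omega)
  refine ⟨p - 1, by omega, by omega, hq, ?_⟩
  have h := hg (p - 1) 1 le_rfl hk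
  rw [show p - 1 + 1 = p by omega] at h ⊢
  rcases h with h | h
  · exact absurd (h.trans hq) hp
  · exact h

/-- A homomorphism from a short cycle power to the reflexive cyclic triangle is constant. -/
lemma eq_of_periodic_of_lt {k ℓ : ℕ} {g : ℕ → Fin 3}
    (hg : ∀ i t, 1 ≤ t → t ≤ k → g (i + t) = g i ∨ g (i + t) = g i + 1)
    (hk : 1 ≤ k) (hℓ : 2 * k + 1 ≤ ℓ) (hlt : ℓ < 3 * k) (hper : ∀ i, g (i + ℓ) = g i) (i : ℕ) :
    g i = g 0 := by
  have hstep : ∀ i, g (i + 1) = g i := by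
    intro i
    by_contra hne
    have hi : g (i + 1) = g i + 1 := (hg i 1 le_rfl hk).resolve_left hne
    have key : ∀ c : Fin 3, c ≠ c + 1 ∧ c ≠ c + 1 + 1 ∧ c + 1 ≠ c ∧ c + 1 + 1 + 1 = c := by decide
    obtain ⟨h01, h02, h10, h03⟩ := key (g i)
    obtain ⟨p, hp, hpe, hgp, hgp'⟩ :=
      exists_next_advance hg hk hi (e := i + ℓ) (by omega) (by rwa [hper])
    have hpe' : p + 1 < i + ℓ := by
      rcases Nat.lt_or_ge (p + 1) (i + ℓ) with h | h
      · exact h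
      · have : p + 1 = i + ℓ := by omega
        rw [this, hper, hgp] at hgp'
        exact absurd hgp' h02
    obtain ⟨q, hq, hqe, hgq, hgq'⟩ :=
      exists_next_advance hg hk hgp' (e := i + ℓ) hpe' (by rwa [hper, hgp])
    have hq3 : g q + 1 = g i := by rw [hgq, hgp, h03]
    obtain ⟨r, hr, hre, -, -⟩ :=
      exists_next_advance hg hk hgq' (e := i + 1 + ℓ) (by omega) (by rwa [hper, hi, hq3])
    omega
  induction i with
  | zero => rfl
  | succ i ih => rw [hstep, ih]

/-- The blow-up of the cyclic triangle with a copy of `G` in each class. -/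
def triangleBlowup {V : Type} (G : V → V → Prop) : Fin 3 × V → Fin 3 × V → Prop :=
  fun x y => y.1 = x.1 + 1 ∨ (y.1 = x.1 ∧ G x.2 y.2)

lemma ncard_fiber_union {V : Type} [Finite V] {a b : Fin 3} (hab : a ≠ b) (S : Set V) :
    {y : Fin 3 × V | y.1 = a ∨ (y.1 = b ∧ y.2 ∈ S)}.ncard = Nat.card V + S.ncard := by
  have h : {y : Fin 3 × V | y.1 = a ∨ (y.1 = b ∧ y.2 ∈ S)} =
      ({a} ×ˢ Set.univ) ∪ ({b} ×ˢ S) := by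
    ext ⟨y, v⟩
    simp
  rw [h, Set.ncard_union_eq, Set.ncard_prod, Set.ncard_prod, Set.ncard_singleton,
    Set.ncard_singleton, Set.ncard_univ, one_mul, one_mul]
  rw [Set.disjoint_left]
  rintro ⟨y, v⟩ h1 h2
  simp only [Set.mem_prod, Set.mem_singleton_iff] at h1 h2
  exact hab (h1.1.symm.trans h2.1)

/-- There are arbitrarily large regular tournaments without powers of short cycles. -/
lemma exists_regular_without_powCycle {k ℓ : ℕ} (hk : 1 ≤ k) (hℓ : 2 * k + 1 ≤ ℓ)
    (hlt : ℓ < 3 * k) (j : ℕ) :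
    ∃ (V : Type) (_ : Finite V) (G : V → V → Prop), Nat.card V = 3 ^ j ∧
      (∀ u v, G u v → ¬ G v u) ∧
      (∀ v, 2 * {w | G v w}.ncard + 1 = 3 ^ j) ∧ (∀ v, 2 * {w | G w v}.ncard + 1 = 3 ^ j) ∧
      ∀ h : ℕ → V, (∀ i, h (i + ℓ) = h i) →
        ¬ ∀ i t, 1 ≤ t → t ≤ k → G (h i) (h (i + t)) := by
  induction j with
  | zero =>
    refine ⟨Unit, inferInstance, fun _ _ => False, by simp, by simp, by simp, by simp, ?_⟩
    intro h _ hG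
    exact hG 0 1 le_rfl hk
  | succ j ih =>
    obtain ⟨V, _, G, hcard, hor, hout, hin, hno⟩ := ih
    have key : ∀ c : Fin 3, c + 1 ≠ c ∧ c ≠ c + 1 + 1 := by decide
    refine ⟨Fin 3 × V, inferInstance, triangleBlowup G, ?_, ?_, ?_, ?_, ?_⟩
    · simp [Nat.card_prod, hcard, pow_succ, mul_comm]
    · rintro ⟨a, u⟩ ⟨b, v⟩ h1 h2
      simp only [triangleBlowup] at h1 h2
      rcases h1 with h1 | ⟨h1, h1'⟩ <;> rcases h2 with h2 | ⟨h2, h2'⟩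
      · rw [h1] at h2
        exact (key a).2 h2
      · exact (key a).1 (h1.symm.trans h2.symm)
      · exact (key b).1 (h2.symm.trans h1.symm)
      · exact hor _ _ h1' h2'
    · rintro ⟨a, u⟩
      have h := ncard_fiber_union (key a).1 {w | G u w}
      have h' := hout u
      simp only [triangleBlowup, Set.mem_ofPred_eq] at h ⊢
      rw [h, hcard, pow_succ]
      omega
    · rintro ⟨a, u⟩
      have key' : ∀ c : Fin 3, c + 2 ≠ c := by decide
      have hsub : ∀ b : Fin 3, a = b + 1 ↔ b = a + 2 := by
        revert a
        decide
      have h := ncard_fiber_union (key' a) {w | G w u}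
      have h' := hin u
      simp only [triangleBlowup, Set.mem_ofPred_eq] at h ⊢
      simp only [hsub, eq_comm (a := a)] at h ⊢
      rw [h, hcard, pow_succ]
      omega
    · intro h hper hG
      have hconst := eq_of_periodic_of_lt (g := fun i => (h i).1) (k := k) (ℓ := ℓ)
        (fun i t ht htk => (hG i t ht htk).symm.imp And.left id) hk hℓ hlt
        (fun i => by simp only [hper])
      refine hno (fun i => (h i).2) (fun i => by simp only [hper]) ?_
      intro i t ht htk
      rcases hG i t ht htk with hh | hh
      · have h1 := hconst i
        have h2 := hconst (i + t)
        rw [h2.trans h1.symm] at hh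
        exact absurd hh.symm (key _).1
      · exact hh.2

lemma not_turanable_powCycle {k ℓ : ℕ} (hk : 1 ≤ k) (hℓ : 2 * k + 1 ≤ ℓ) (hlt : ℓ < 3 * k) :
    ¬ Turanable (powCycle ℓ k) := by
  rintro ⟨n₀, hn₀⟩
  obtain ⟨V, _, G, hcard, hor, hout, hin, hno⟩ :=
    exists_regular_without_powCycle hk hℓ hlt n₀
  let e : V ≃ Fin (3 ^ n₀) := Finite.equivFinOfCardEq hcard
  have hpull : ∀ S : Set V, {w : Fin (3 ^ n₀) | e.symm w ∈ S}.ncard = S.ncard := by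
    intro S
    rw [← Set.ncard_image_of_injective S e.injective]
    congr 1
    ext w
    simp [Equiv.image_eq_preimage_symm]
  obtain ⟨f, -, hf⟩ := hn₀ (3 ^ n₀) (Nat.lt_pow_self (by norm_num)).le
    (fun u v => G (e.symm u) (e.symm v)) (fun u v => hor _ _) (by
      intro v
      have h1 := hout (e.symm v)
      have h2 := hin (e.symm v)
      have h3 := hpull {w | G (e.symm v) w}
      have h4 := hpull {w | G w (e.symm v)}
      simp only [Set.mem_ofPred_eq] at h3 h4
      simp only [outDeg, inDeg, le_min_iff, h3, h4]
      omega)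
  have hpos : 0 < ℓ := by omega
  refine hno (fun i => e.symm (f ⟨i % ℓ, Nat.mod_lt _ hpos⟩)) (fun i => by simp) ?_
  intro i t ht htk
  exact hf _ _ ⟨t, ht, htk, by simp⟩

end LowerBound

/-! ### Powers of long cycles: transitive blow-ups of the cyclic triangle -/

section UpperBound

open Finset

open scoped Classical in
/-- A dense bipartite relation in which one side is large but of bounded size contains `M`
vertices on this side with linearly many common neighbours. -/
lemma exists_subset_many_common {X Y : Type*} [Fintype Y] (R : X → Y → Prop) {d M : ℕ}
    (hM : 1 ≤ M) (hd : 1 ≤ d) (T : Finset X) (hT : #T = 2 * d * M)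
    (hR : ∀ x ∈ T, Fintype.card Y ≤ d * #{y | R x y}) :
    ∃ S ⊆ T, #S = M ∧
      Fintype.card Y ≤ 2 * d * ((2 * d * M).choose M * #{y | ∀ x ∈ S, R x y}) := by
  set t := #{y : Y | M ≤ #{x ∈ T | R x y}} with ht
  have hsum : ∑ x ∈ T, #{y | R x y} = ∑ y : Y, #{x ∈ T | R x y} :=
    sum_card_bipartiteAbove_eq_sum_card_bipartiteBelow R
  have hlow : 2 * d * M * Fintype.card Y ≤ d * ∑ y : Y, #{x ∈ T | R x y} := by
    rw [← hsum, mul_sum, ← hT, ← smul_eq_mul]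
    exact card_nsmul_le_sum _ _ _ hR
  have hup : ∑ y : Y, #{x ∈ T | R x y} ≤ M * Fintype.card Y + 2 * d * M * t := by
    have h : ∀ y : Y, #{x ∈ T | R x y} ≤
        M + (if M ≤ #{x ∈ T | R x y} then 2 * d * M else 0) := by
      intro y
      split_ifs with hy
      · have := card_filter_le T (fun x => R x y)
        omega
      · omega
    refine (sum_le_sum fun y _ => h y).trans ?_
    rw [sum_add_distrib, ← sum_filter, sum_const, sum_const, ← ht, smul_eq_mul, smul_eq_mul,
      card_univ]
    exact le_of_eq (by ring)
  have hYt : Fintype.card Y ≤ 2 * d * t := by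
    have hpos : 0 < d * M := by positivity
    refine Nat.le_of_mul_le_mul_left ?_ hpos
    nlinarith [Nat.mul_le_mul_left d hup]
  have hcover : t ≤ ∑ S ∈ T.powersetCard M, #{y : Y | ∀ x ∈ S, R x y} := by
    refine le_trans (card_le_card ?_) card_biUnion_le
    intro y hy
    simp only [mem_filter, mem_univ, true_and] at hy
    obtain ⟨S, hS, hcard⟩ := exists_subset_card_eq hy
    simp only [mem_biUnion, mem_powersetCard, mem_filter, mem_univ, true_and]
    exact ⟨S, ⟨hS.trans (filter_subset _ _), hcard⟩, fun x hx => (mem_filter.mp (hS hx)).2⟩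
  have hne : (T.powersetCard M).Nonempty := by
    rw [powersetCard_nonempty, hT]
    nlinarith
  obtain ⟨S, hS, hmax⟩ := exists_max_image _ (fun S => #{y : Y | ∀ x ∈ S, R x y}) hne
  rw [mem_powersetCard] at hS
  refine ⟨S, hS.1, hS.2, hYt.trans (Nat.mul_le_mul_left _ (hcover.trans ?_))⟩
  refine (sum_le_card_nsmul _ _ _ hmax).trans ?_
  rw [card_powersetCard, hT, smul_eq_mul]

open scoped Classical in
/-- A dense relation on a large set has many vertices of linear degree. -/
lemma exists_many_large_degree {V : Type*} [Fintype V] (R : V → V → Prop) {d N : ℕ}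
    (hn : 2 * d * N < Fintype.card V)
    (hR : Fintype.card V * Fintype.card V ≤ d * #{p : V × V | R p.1 p.2}) :
    ∃ T : Finset V, #T = N ∧ ∀ x ∈ T, Fintype.card V ≤ 2 * d * #{y | R x y} := by
  set U : Finset V := {x | Fintype.card V ≤ 2 * d * #{y | R x y}} with hU
  suffices hN : N ≤ #U by
    obtain ⟨T, hT, hcard⟩ := exists_subset_card_eq hN
    exact ⟨T, hcard, fun x hx => (mem_filter.mp (hT hx)).2⟩
  by_contra! hlt
  set n := Fintype.card V
  have hsum : #{p : V × V | R p.1 p.2} = ∑ x : V, #{y | R x y} := by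
    simp only [card_filter, ← univ_product_univ, sum_product]
  have hdeg : ∀ x : V, 2 * d * #{y | R x y} ≤
      n + (if n ≤ 2 * d * #{y | R x y} then 2 * d * n else 0) := by
    intro x
    split_ifs with hx
    · have : #{y | R x y} ≤ n := card_le_univ _
      nlinarith
    · omega
  have hup : ∑ x : V, 2 * d * #{y | R x y} ≤ n * n + 2 * d * n * #U := by
    refine (sum_le_sum fun x _ => hdeg x).trans ?_
    rw [sum_add_distrib, ← sum_filter, sum_const, sum_const, ← hU, smul_eq_mul, smul_eq_mul,
      card_univ]
    exact le_of_eq (by ring)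
  rw [← mul_sum, ← hsum] at hup
  have h1 : 2 * d * n * #U ≤ n * (2 * d * N) := by
    calc 2 * d * n * #U ≤ 2 * d * n * N := Nat.mul_le_mul_left _ hlt.le
      _ = n * (2 * d * N) := by ring
  nlinarith

open scoped Classical in
/-- In a ternary relation in which every vertex starts a positive proportion of the triples,
there is a complete tripartite box. -/
lemma exists_box (d M : ℕ) (hM : 1 ≤ M) (hd : 1 ≤ d) :
    ∃ n₀ : ℕ, ∀ (V : Type) [Fintype V] (R : V → V → V → Prop), n₀ ≤ Fintype.card V →
      (∀ a, Fintype.card V * Fintype.card V ≤ d * #{p : V × V | R a p.1 p.2}) →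
      ∃ A B C : Finset V, #A = M ∧ #B = M ∧ #C = M ∧
        ∀ a ∈ A, ∀ b ∈ B, ∀ c ∈ C, R a b c := by
  set d₁ := 2 * d * (2 * d * M).choose M with hd₁
  set N := 2 * (2 * d₁) * M with hN
  set d₂ := 2 * (2 * d₁) * N.choose M with hd₂
  have hc₁ : 0 < (2 * d * M).choose M := Nat.choose_pos (by nlinarith)
  have hd₁pos : 1 ≤ d₁ := Nat.succ_le_of_lt (by positivity)
  refine ⟨2 * d * M + (2 * d₁ * N + 1) + d₂ * M + 1, ?_⟩
  intro V _ R hn hR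
  obtain ⟨T, -, hT⟩ := exists_subset_card_eq (s := (univ : Finset V)) (n := 2 * d * M)
    (by rw [card_univ]; omega)
  obtain ⟨A, -, hA, hAR⟩ := exists_subset_many_common (fun a (p : V × V) => R a p.1 p.2)
    hM hd T hT (fun a _ => by rw [Fintype.card_prod]; exact hR a)
  rw [Fintype.card_prod, ← mul_assoc, ← hd₁] at hAR
  obtain ⟨T', hT', hTR⟩ := exists_many_large_degree (fun b c => ∀ a ∈ A, R a b c) (d := d₁)
    (N := N) (by omega) (by convert hAR)
  obtain ⟨B, -, hB, hBR⟩ := exists_subset_many_common (fun b c => ∀ a ∈ A, R a b c)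
    hM (d := 2 * d₁) (by omega) T' hT' (by convert hTR)
  rw [← mul_assoc, ← hN, ← hd₂] at hBR
  have hC : M ≤ #{c : V | ∀ b ∈ B, ∀ a ∈ A, R a b c} := by
    by_contra! hlt
    have hle := Nat.mul_le_mul_left d₂ hlt.le
    have hBR' : Fintype.card V ≤ d₂ * #{c : V | ∀ b ∈ B, ∀ a ∈ A, R a b c} := by convert hBR
    omega
  obtain ⟨C, hCs, hCc⟩ := exists_subset_card_eq hC
  exact ⟨A, B, C, hA, hB, hCc, fun a ha b hb c hc => (mem_filter.mp (hCs hc)).2 b hb a ha⟩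

variable {n : ℕ} {G : Fin n → Fin n → Prop}

open scoped Classical in
lemma card_filter_out (v : Fin n) : #{w | G v w} = outDeg G v := by
  rw [outDeg, Set.ncard_eq_toFinset_card', Set.toFinset_ofPred]

open scoped Classical in
lemma card_filter_in (v : Fin n) : #{w | G w v} = inDeg G v := by
  rw [inDeg, Set.ncard_eq_toFinset_card', Set.toFinset_ofPred]

open scoped Classical in
/-- Besides itself, each vertex has at most one non-neighbour. -/
lemma card_nonadjacent_le (hG : IsOriented G)
    (hdeg : ∀ v, (n - 1) / 2 ≤ min (outDeg G v) (inDeg G v)) (v : Fin n) :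
    #{w | ¬ G v w ∧ ¬ G w v} ≤ 2 := by
  have hv := le_min_iff.mp (hdeg v)
  rw [← card_filter_out, ← card_filter_in] at hv
  have hdisj : Disjoint ({w | G v w} : Finset (Fin n)) ({w | G w v} : Finset (Fin n)) := by
    rw [disjoint_left]
    intro w h1 h2
    exact hG v w (mem_filter.mp h1).2 (mem_filter.mp h2).2
  have hun := card_union_of_disjoint hdisj
  rw [← filter_or] at hun
  have hcompl := card_filter_add_card_filter_not (s := (univ : Finset (Fin n)))
    (fun w => G v w ∨ G w v)
  simp only [not_or, card_univ, Fintype.card_fin] at hcompl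
  omega

open scoped Classical in
lemma two_mul_card_edges_le (hG : IsOriented G) (S : Finset (Fin n)) :
    2 * #{p ∈ S ×ˢ S | G p.1 p.2} ≤ #S * #S := by
  have hswap : #{p ∈ S ×ˢ S | G p.1 p.2} = #{p ∈ S ×ˢ S | G p.2 p.1} := by
    refine card_bij (fun p _ => p.swap) ?_ ?_ ?_
    · simp +contextual
    · intro p _ q _ h
      exact Prod.swap_injective h
    · intro p hp
      exact ⟨p.swap, by simpa [and_comm, and_assoc, and_left_comm] using hp, by simp⟩
  have hdisj : Disjoint {p ∈ S ×ˢ S | G p.1 p.2} {p ∈ S ×ˢ S | G p.2 p.1} := by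
    rw [disjoint_left]
    intro p h1 h2
    exact hG _ _ (mem_filter.mp h1).2 (mem_filter.mp h2).2
  have h := card_union_of_disjoint hdisj
  have hle : #({p ∈ S ×ˢ S | G p.1 p.2} ∪ {p ∈ S ×ˢ S | G p.2 p.1}) ≤ #(S ×ˢ S) :=
    card_le_card (union_subset (filter_subset _ _) (filter_subset _ _))
  rw [card_product] at hle
  omega

open scoped Classical in
/-- Every vertex lies on quadratically many cyclic triangles. -/
lemma sq_le_card_cyclic_triangles (hG : IsOriented G)
    (hdeg : ∀ v, (n - 1) / 2 ≤ min (outDeg G v) (inDeg G v)) (hn : 100 ≤ n) (a : Fin n) :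
    n * n ≤ 100 * #{p : Fin n × Fin n | G a p.1 ∧ G p.1 p.2 ∧ G p.2 a} := by
  set O : Finset (Fin n) := {w | G a w} with hO
  set E := #{p : Fin n × Fin n | G a p.1 ∧ G p.1 p.2 ∧ G p.2 a} with hE
  have hEsum : E = ∑ b ∈ O, #{c | G b c ∧ G c a} := by
    rw [hE, hO, card_filter, ← univ_product_univ, sum_product, sum_filter]
    refine sum_congr rfl fun b _ => ?_
    by_cases hb : G a b <;> simp [hb]
  have hOsum : #{p ∈ O ×ˢ O | G p.1 p.2} = ∑ b ∈ O, #{c ∈ O | G b c} := by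
    simp only [card_filter, sum_product]
  have hmin : ∀ b ∈ O, (n - 1) / 2 ≤ #{c | G b c ∧ G c a} + #{c ∈ O | G b c} + 2 := by
    intro b _
    have h1 := (le_min_iff.mp (hdeg b)).1
    rw [← card_filter_out] at h1
    have h2 := card_nonadjacent_le hG hdeg a
    have h3 : ({c | G b c} : Finset (Fin n)) ⊆
        ({c | G b c ∧ G c a} : Finset (Fin n)) ∪ {c ∈ O | G b c} ∪
          ({w | ¬ G a w ∧ ¬ G w a} : Finset (Fin n)) := by
      intro c hc
      simp only [hO, mem_union, mem_filter, mem_univ, true_and] at hc ⊢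
      tauto
    have h4 := (card_le_card h3).trans (card_union_le _ _)
    have h5 := card_union_le ({c | G b c ∧ G c a} : Finset (Fin n)) {c ∈ O | G b c}
    omega
  have hsum := card_nsmul_le_sum O _ _ hmin
  rw [sum_add_distrib, sum_add_distrib, ← hEsum, ← hOsum, sum_const, smul_eq_mul,
    smul_eq_mul] at hsum
  have hOO := two_mul_card_edges_le hG O
  have ha := le_min_iff.mp (hdeg a)
  have hOle : #O + (n - 1) / 2 ≤ n := by
    have hdisj : Disjoint O ({w | G w a} : Finset (Fin n)) := by
      rw [disjoint_left]
      intro w h1 h2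
      exact hG a w (mem_filter.mp h1).2 (mem_filter.mp h2).2
    have h1 := card_union_of_disjoint hdisj
    have h2 := card_le_univ (O ∪ ({w | G w a} : Finset (Fin n)))
    rw [Fintype.card_fin] at h2
    have h3 := card_filter_in (G := G) a
    omega
  have hOge : (n - 1) / 2 ≤ #O := by
    rw [hO, card_filter_out]
    exact ha.1
  generalize #{p ∈ O ×ˢ O | G p.1 p.2} = F at *
  generalize #O = s at *
  have hnm : n ≤ 2 * ((n - 1) / 2) + 2 := by omega
  generalize (n - 1) / 2 = m at *
  have hm49 : 49 ≤ m := by omega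
  have hs : s ≤ m + 2 := by omega
  have h2E : s * m ≤ 2 * E + 6 * s := by nlinarith
  have hmE : m * m ≤ 2 * E + 6 * m := by nlinarith
  nlinarith [Nat.mul_le_mul hnm hnm]

open scoped Classical in
/-- Large vertex sets contain large transitive tournaments. -/
lemma exists_transitive (hG : IsOriented G)
    (hdeg : ∀ v, (n - 1) / 2 ≤ min (outDeg G v) (inDeg G v)) (m : ℕ) (S : Finset (Fin n))
    (hS : 4 ^ m ≤ #S) :
    ∃ L : List (Fin n), L.length = m ∧ L.Pairwise G ∧ ∀ v ∈ L, v ∈ S := by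
  induction m generalizing S with
  | zero => exact ⟨[], rfl, List.Pairwise.nil, by simp⟩
  | succ m ih =>
    have hpos : 1 ≤ 4 ^ m := Nat.one_le_pow _ _ (by norm_num)
    rw [pow_succ] at hS
    obtain ⟨v, hv⟩ : S.Nonempty := card_pos.mp (by omega)
    have hsub : S ⊆ {w ∈ S | G v w} ∪ {w ∈ S | G w v} ∪
        ({w | ¬ G v w ∧ ¬ G w v} : Finset (Fin n)) := by
      intro c hc
      simp only [mem_union, mem_filter, mem_univ, true_and]
      tauto
    have h1 := (card_le_card hsub).trans (card_union_le _ _)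
    have h2 := card_union_le {w ∈ S | G v w} {w ∈ S | G w v}
    have h3 := card_nonadjacent_le hG hdeg v
    rcases Nat.lt_or_ge (#{w ∈ S | G v w}) (4 ^ m) with h | h
    · obtain ⟨L, hlen, hL, hLS⟩ := ih {w ∈ S | G w v} (by omega)
      refine ⟨L ++ [v], by simp [hlen], ?_, ?_⟩
      · rw [List.pairwise_append]
        refine ⟨hL, List.pairwise_singleton _ _, fun w hw u hu => ?_⟩
        rw [List.mem_singleton.mp hu]
        exact (mem_filter.mp (hLS w hw)).2
      · intro w hw
        rcases List.mem_append.mp hw with hw | hw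
        · exact (mem_filter.mp (hLS w hw)).1
        · rwa [List.mem_singleton.mp hw]
    · obtain ⟨L, hlen, hL, hLS⟩ := ih {w ∈ S | G v w} h
      refine ⟨v :: L, by simp [hlen], ?_, ?_⟩
      · exact List.pairwise_cons.mpr ⟨fun w hw => (mem_filter.mp (hLS w hw)).2, hL⟩
      · intro w hw
        rcases List.mem_cons.mp hw with rfl | hw
        · exact hv
        · exact (mem_filter.mp (hLS w hw)).1

lemma exists_transitive_fin (hG : IsOriented G)
    (hdeg : ∀ v, (n - 1) / 2 ≤ min (outDeg G v) (inDeg G v)) (m : ℕ) (S : Finset (Fin n))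
    (hS : 4 ^ m ≤ #S) :
    ∃ f : Fin m → Fin n, (∀ i j, i < j → G (f i) (f j)) ∧ ∀ i, f i ∈ S := by
  obtain ⟨L, rfl, hL, hLS⟩ := exists_transitive hG hdeg m S hS
  exact ⟨L.get, fun i j hij => List.pairwise_iff_get.mp hL i j hij, fun i => hLS _ (L.get_mem i)⟩

/-- A blow-up of the cyclic triangle by large transitive tournaments contains powers of long
cycles. -/
lemma exists_embedding_of_blowup (hG : IsOriented G) {k ℓ : ℕ} (hk : 1 ≤ k) (hℓ : 3 * k ≤ ℓ)
    {a b c : Fin ℓ → Fin n} (ha : ∀ i j, i < j → G (a i) (a j))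
    (hb : ∀ i j, i < j → G (b i) (b j)) (hc : ∀ i j, i < j → G (c i) (c j))
    (hab : ∀ i j, G (a i) (b j)) (hbc : ∀ i j, G (b i) (c j)) (hca : ∀ i j, G (c i) (a j)) :
    ∃ f : Fin ℓ → Fin n, Function.Injective f ∧ ∀ i j, powCycle ℓ k i j → G (f i) (f j) := by
  have hne : ∀ {u v}, G u v → u ≠ v := by
    rintro u v huv rfl
    exact hG _ _ huv huv
  let f : Fin ℓ → Fin n := fun i =>
    if (i : ℕ) < k then a i else if (i : ℕ) < 2 * k then b i else c i
  have hlt : ∀ i j, i < j → f i ≠ f j := by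
    intro i j hij
    have hij' : (i : ℕ) < j := hij
    simp only [f]
    split_ifs <;>
      first
        | omega
        | exact hne (ha _ _ hij)
        | exact hne (hb _ _ hij)
        | exact hne (hc _ _ hij)
        | exact hne (hab _ _)
        | exact hne (hbc _ _)
        | exact (hne (hca _ _)).symm
  refine ⟨f, ?_, ?_⟩
  · intro i j hij
    rcases lt_trichotomy i j with h | h | h
    · exact absurd hij (hlt i j h)
    · exact h
    · exact absurd hij.symm (hlt j i h)
  · rintro i j ⟨t, ht, htk, hj⟩
    have hi := i.isLt
    rcases Nat.lt_or_ge (i + t) ℓ with h | h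
    · rw [Nat.mod_eq_of_lt h] at hj
      have hij : i < j := Fin.lt_def.mpr (by omega)
      simp only [f]
      split_ifs <;>
        first
          | omega
          | exact ha _ _ hij
          | exact hb _ _ hij
          | exact hc _ _ hij
          | exact hab _ _
          | exact hbc _ _
    · rw [Nat.mod_eq_sub_mod h, Nat.mod_eq_of_lt (by omega)] at hj
      simp only [f]
      rw [if_neg (show ¬ (i : ℕ) < k by omega), if_neg (show ¬ (i : ℕ) < 2 * k by omega),
        if_pos (show (j : ℕ) < k by omega)]
      exact hca _ _

lemma turanable_powCycle {k ℓ : ℕ} (hk : 1 ≤ k) (hℓ : 3 * k ≤ ℓ) :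
    Turanable (powCycle ℓ k) := by
  classical
  obtain ⟨n₀, hn₀⟩ := exists_box 100 (4 ^ ℓ) (Nat.one_le_pow _ _ (by norm_num)) (by norm_num)
  refine ⟨n₀ + 100, fun n hn G hG hdeg => ?_⟩
  obtain ⟨A, B, C, hA, hB, hC, hR⟩ := hn₀ (Fin n) (fun a b c => G a b ∧ G b c ∧ G c a)
    (by rw [Fintype.card_fin]; omega) (fun a => by
      rw [Fintype.card_fin]
      convert sq_le_card_cyclic_triangles hG hdeg (by omega) a)
  obtain ⟨a, ha, haA⟩ := exists_transitive_fin hG hdeg ℓ A hA.ge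
  obtain ⟨b, hb, hbB⟩ := exists_transitive_fin hG hdeg ℓ B hB.ge
  obtain ⟨c, hc, hcC⟩ := exists_transitive_fin hG hdeg ℓ C hC.ge
  let z : Fin ℓ := ⟨0, by omega⟩
  exact exists_embedding_of_blowup hG hk hℓ ha hb hc
    (fun i j => (hR _ (haA i) _ (hbB j) _ (hcC z)).1)
    (fun i j => (hR _ (haA z) _ (hbB i) _ (hcC j)).2.1)
    (fun i j => (hR _ (haA j) _ (hbB z) _ (hcC i)).2.2)

end UpperBound

/-- For `k ≥ 1` and `ℓ ≥ 2k+1`, the `k`-th power of the directed cycle on `ℓ` vertices is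
Turánable if and only if `ℓ ≥ 3k`. -/
theorem statement_18 (k ℓ : ℕ) (hk : 1 ≤ k) (hℓ : 2*k + 1 ≤ ℓ) :
    Turanable (powCycle ℓ k) ↔ 3*k ≤ ℓ := by
  refine ⟨fun h => ?_, turanable_powCycle hk⟩
  by_contra! hlt
  exact not_turanable_powCycle hk hℓ hlt h

end Paper
end
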